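/- Suppose Assumption (V) and Assumption (φ) hold, and in addition (V(x)+M)⁻¹ is uniformly Hölder continuous of order α ∈ (0,1] for some M > 0. Then for any μ ∈ ℂ \ ℝ and any 0 < β < α there is a constant C_μ such that ‖P_h*(H_h − μ)⁻¹P_h − (H − μ)⁻¹‖_{B(L²(ℝ^d))} ≤ C_μ h^β as h → 0. -/

import Mathlib

open MeasureTheory Complex Real
open scoped FourierTransform InnerProductSpace ENNReal ComplexConjugate

noncomputable section

abbrev Euc (d : ℕ) : Type := EuclideanSpace ℝ (Fin d)
abbrev Zd (d : ℕ) : Type := Fin d → ℤ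

instance (d : ℕ) : MeasurableSingletonClass (Zd d) := by
  constructor
  intro f
  have : ({f} : Set (Zd d)) = Set.univ.pi fun j => {f j} := by
    ext g; simp [Set.eq_univ_iff_forall, funext_iff, Set.mem_pi, eq_comm]
  rw [this]
  exact MeasurableSet.univ_pi fun j => measurableSet_singleton _

/-- The measure on `ℤ^d` giving mass `h^d` to each point, so that `L²` of this measure is
`ℓ²(hℤ^d)` with norm `‖v‖_h² = h^d ∑_z |v(hz)|²`. -/
def latMeas (d : ℕ) (h : ℝ) : Measure (Zd d) := (ENNReal.ofReal (h ^ d)) • Measure.count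

/-- `L²(ℝ^d)`. -/
abbrev L2 (d : ℕ) := Lp ℂ 2 (volume : Measure (Euc d))

/-- `ℓ²(hℤ^d)`. -/
abbrev l2h (d : ℕ) (h : ℝ) := Lp ℂ 2 (latMeas d h)

/-- The lattice point `hz ∈ ℝ^d` associated to `z ∈ ℤ^d`. -/
def latPt (d : ℕ) (h : ℝ) (z : Zd d) : Euc d :=
  (EuclideanSpace.equiv (Fin d) ℝ).symm fun j => h * (z j : ℝ)

/-- The vector in `ℝ^d` associated to `n ∈ ℤ^d`. -/
def latVec (d : ℕ) (n : Zd d) : Euc d :=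
  (EuclideanSpace.equiv (Fin d) ℝ).symm fun j => (n j : ℝ)

/-- `P_h : L²(ℝ^d) → ℓ²(hℤ^d)`, `P_h u (z) = h^{−d} ∫ conj(φ(h⁻¹(x−z))) u(x) dx`. -/
def IsProjOp (d : ℕ) (h : ℝ) (φ : SchwartzMap (Euc d) ℂ)
    (Ph : L2 d →L[ℂ] l2h d h) : Prop :=
  ∀ u : L2 d, ∀ z : Zd d,
    (Ph u : Zd d → ℂ) z =
      (h ^ d : ℂ)⁻¹ * ∫ x, conj (φ (h⁻¹ • (x - latPt d h z))) * (u : Euc d → ℂ) x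

/-- The Laplacian `Δu(x) = ∑_j ∂²u/∂x_j²(x)` of a function on `ℝ^d`. -/
def lapl (d : ℕ) (u : Euc d → ℂ) (x : Euc d) : ℂ :=
  ∑ j : Fin d, fderiv ℝ (fun y => fderiv ℝ u y (EuclideanSpace.single j (1 : ℝ))) x
      (EuclideanSpace.single j (1 : ℝ))

/-- `H` is the continuum Schrödinger operator `−Δ + V`:  a self-adjoint operator on
`L²(ℝ^d)` whose action on every smooth compactly supported function is `−Δu + Vu`.
(Under Assumption (V), `−Δ + V` is essentially self-adjoint on `C_c^∞(ℝ^d)`, so these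
conditions uniquely determine `H` as its self-adjoint closure.) -/
def IsSchrodingerOp (d : ℕ) (V : Euc d → ℝ) (H : L2 d →ₗ.[ℂ] L2 d) : Prop :=
  IsSelfAdjoint H ∧
  ∀ (u : Euc d → ℂ) (_ : ContDiff ℝ (⊤ : ℕ∞) u) (_ : HasCompactSupport u)
    (hu2 : MemLp u 2 (volume : Measure (Euc d)))
    (hHu2 : MemLp (fun x => -(lapl d u x) + (V x : ℂ) * u x) 2 (volume : Measure (Euc d))),
    ∃ hdom : hu2.toLp u ∈ H.domain,
      H ⟨hu2.toLp u, hdom⟩ = hHu2.toLp (fun x => -(lapl d u x) + (V x : ℂ) * u x)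

/-- The pointwise action of the discrete Schrödinger operator `H_h = H_{0,h} + V`:
`(H_h v)(hz) = h⁻² ∑_j (2v(hz) − v(hz+he_j) − v(hz−he_j)) + V(hz) v(hz)`. -/
def discAct (d : ℕ) (h : ℝ) (V : Euc d → ℝ) (v : Zd d → ℂ) (z : Zd d) : ℂ :=
  (h ^ 2 : ℂ)⁻¹ * ∑ j : Fin d, (2 * v z - v (z + Pi.single j 1) - v (z - Pi.single j 1))
    + (V (latPt d h z) : ℂ) * v z

/-- `H_h` is the (self-adjoint) discrete Schrödinger operator `H_{0,h} + V` on `ℓ²(hℤ^d)`,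
with its natural (maximal) domain. -/
def IsDiscreteHam (d : ℕ) (h : ℝ) (V : Euc d → ℝ)
    (Hh : l2h d h →ₗ.[ℂ] l2h d h) : Prop :=
  (∀ v : l2h d h,
    MemLp (discAct d h V (v : Zd d → ℂ)) 2 (latMeas d h) → v ∈ Hh.domain) ∧
  (∀ v : Hh.domain, ∀ z : Zd d,
    (Hh v : Zd d → ℂ) z = discAct d h V ((v : l2h d h) : Zd d → ℂ) z)

/-- `R` is the resolvent `(H − μ)⁻¹` of the (possibly unbounded) operator `H`:  a bounded
operator which is a two-sided inverse of `H − μ`. -/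
def IsResolventAt {E : Type*} [NormedAddCommGroup E] [NormedSpace ℂ E]
    (H : E →ₗ.[ℂ] E) (μ : ℂ) (R : E →L[ℂ] E) : Prop :=
  (∀ w : E, ∃ hd : R w ∈ H.domain, H ⟨R w, hd⟩ - μ • R w = w) ∧
  (∀ u : H.domain, R (H u - μ • (u : E)) = u)

section SquareIntegrable

variable {X : Type*} [MeasurableSpace X] {m : Measure X}

lemma integral_sub_sub {E : Type*} [NormedAddCommGroup E] [NormedSpace ℝ E] {f g h : X → E}
    (hf : Integrable f m) (hg : Integrable g m) (hh : Integrable h m) :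
    ∫ x, (f x - g x - h x) ∂m = ∫ x, f x ∂m - ∫ x, g x ∂m - ∫ x, h x ∂m := by
  rw [← integral_sub hf hg]
  exact integral_sub (hf.sub hg) hh

lemma norm_toLp_eq_lpNorm {f : X → ℂ} (hf : MemLp f 2 m) : ‖hf.toLp f‖ = lpNorm f 2 m := by
  rw [Lp.norm_toLp, toReal_eLpNorm hf.1]

lemma lpNorm_coeFn (f : Lp ℂ 2 m) : lpNorm f 2 m = ‖f‖ := by
  rw [Lp.norm_def, toReal_eLpNorm (Lp.aestronglyMeasurable f)]

lemma inner_toLp_toLp {f g : X → ℂ} (hf : MemLp f 2 m) (hg : MemLp g 2 m) :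
    ⟪hf.toLp f, hg.toLp g⟫_ℂ = ∫ x, conj (f x) * g x ∂m := by
  rw [L2.inner_def]
  refine integral_congr_ae ?_
  filter_upwards [hf.coeFn_toLp, hg.coeFn_toLp] with x hx hy
  rw [hx, hy, RCLike.inner_apply, mul_comm]

lemma integrable_conj_mul {f g : X → ℂ} (hf : MemLp f 2 m) (hg : MemLp g 2 m) :
    Integrable (fun x => conj (f x) * g x) m :=
  hf.star.integrable_mul hg

lemma norm_integral_conj_mul_le {f g : X → ℂ} (hf : MemLp f 2 m) (hg : MemLp g 2 m) :
    ‖∫ x, conj (f x) * g x ∂m‖ ≤ lpNorm f 2 m * lpNorm g 2 m := by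
  rw [← inner_toLp_toLp hf hg, ← norm_toLp_eq_lpNorm hf, ← norm_toLp_eq_lpNorm hg]
  exact norm_inner_le_norm _ _

lemma integrable_norm_sq {f : X → ℂ} (hf : MemLp f 2 m) :
    Integrable (fun x => ‖f x‖ ^ 2) m :=
  hf.integrable_norm_pow (by norm_num)

lemma lpNorm_two_sq {f : X → ℂ} (hf : MemLp f 2 m) :
    lpNorm f 2 m ^ 2 = ∫ x, ‖f x‖ ^ 2 ∂m := by
  have h : ((lpNorm f 2 m ^ 2 : ℝ) : ℂ) = ((∫ x, ‖f x‖ ^ 2 ∂m : ℝ) : ℂ) := by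
    rw [← norm_toLp_eq_lpNorm hf, ← integral_complex_ofReal]
    push_cast
    have := inner_self_eq_norm_sq_to_K (𝕜 := ℂ) (hf.toLp f)
    simp only [coe_algebraMap] at this
    rw [← this, inner_toLp_toLp hf hf]
    refine integral_congr_ae (.of_forall fun x => ?_)
    simp only [RCLike.conj_mul]; rfl
  exact_mod_cast h

lemma lpNorm_le_mul_of_norm_le {f g : X → ℂ} (hf : AEStronglyMeasurable f m)
    (hg : MemLp g 2 m) {C : ℝ} (hC : 0 ≤ C) (h : ∀ x, ‖f x‖ ≤ C * ‖g x‖) :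
    MemLp f 2 m ∧ lpNorm f 2 m ≤ C * lpNorm g 2 m := by
  refine ⟨MemLp.of_le_mul hg hf (.of_forall h), ?_⟩
  have h1 : eLpNorm f 2 m ≤ ENNReal.ofReal C * eLpNorm g 2 m :=
    eLpNorm_le_mul_eLpNorm_of_ae_le_mul (.of_forall h) 2
  rw [← toReal_eLpNorm hf, ← toReal_eLpNorm hg.1]
  calc (eLpNorm f 2 m).toReal ≤ (ENNReal.ofReal C * eLpNorm g 2 m).toReal :=
        ENNReal.toReal_mono (ENNReal.mul_ne_top ENNReal.ofReal_ne_top hg.2.ne) h1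
    _ = C * (eLpNorm g 2 m).toReal := by
        rw [ENNReal.toReal_mul, ENNReal.toReal_ofReal hC]

/-- The coercivity estimate behind the second order a priori bounds: testing `A + W w` against
`ω w` with a weight `ω` comparable to `W`. -/
lemma lpNorm_weight_mul_le {ω W : X → ℝ} {w A : X → ℂ} {k K : ℝ} (hω : ∀ x, 0 ≤ ω x)
    (hωW : ∀ x, ω x ≤ k * W x) (hk : 0 ≤ k) (hK : 0 ≤ K) (hw : MemLp w 2 m)
    (hωw : MemLp (fun x => (ω x : ℂ) * w x) 2 m) (hWw : MemLp (fun x => (W x : ℂ) * w x) 2 m)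
    (hA : MemLp A 2 m)
    (hre : -K * ∫ x, ω x * ‖w x‖ ^ 2 ∂m ≤ (∫ x, conj ((ω x : ℂ) * w x) * A x ∂m).re) :
    lpNorm (fun x => (ω x : ℂ) * w x) 2 m ≤
      k * (lpNorm (fun x => A x + W x * w x) 2 m + K * lpNorm w 2 m) := by
  set N := lpNorm (fun x => (ω x : ℂ) * w x) 2 m with hN
  set F := fun x => A x + (W x : ℂ) * w x with hF
  have hFm : MemLp F 2 m := hA.add hWw
  have hN0 : 0 ≤ N := lpNorm_nonneg
  have e1 : (∫ x, ω x * ‖w x‖ ^ 2 ∂m) ≤ N * lpNorm w 2 m := by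
    refine le_trans ?_ (norm_integral_conj_mul_le hωw hw)
    have : ∫ x, conj ((ω x : ℂ) * w x) * w x ∂m = ((∫ x, ω x * ‖w x‖ ^ 2 ∂m : ℝ) : ℂ) := by
      rw [← integral_complex_ofReal]
      refine integral_congr_ae (.of_forall fun x => ?_)
      simp only [map_mul, conj_ofReal, mul_assoc, RCLike.conj_mul]; push_cast; rfl
    rw [this, norm_real]
    exact le_abs_self _
  have e2 : N ^ 2 ≤ k * (∫ x, conj ((ω x : ℂ) * w x) * (W x * w x) ∂m).re := by
    rw [hN, lpNorm_two_sq hωw]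
    have : (∫ x, conj ((ω x : ℂ) * w x) * (W x * w x) ∂m).re =
        ∫ x, (conj ((ω x : ℂ) * w x) * (W x * w x)).re ∂m :=
      (integral_re (integrable_conj_mul hωw hWw)).symm
    rw [this, ← integral_const_mul]
    refine integral_mono (integrable_norm_sq hωw)
      ((integrable_conj_mul hωw hWw).re.const_mul k) fun x => ?_
    have h1 : conj ((ω x : ℂ) * w x) * (W x * w x) = ((ω x * W x * ‖w x‖ ^ 2 : ℝ) : ℂ) := by
      have := RCLike.conj_mul (w x)
      simp only [map_mul, conj_ofReal]
      calc (ω x : ℂ) * conj (w x) * (W x * w x) = ω x * W x * (conj (w x) * w x) := by ring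
        _ = _ := by rw [this]; push_cast; rfl
    simp only [h1, ofReal_re, norm_mul, norm_real, Real.norm_of_nonneg (hω x)]
    have := mul_le_mul_of_nonneg_right (mul_le_mul_of_nonneg_left (hωW x) (hω x))
      (sq_nonneg ‖w x‖)
    nlinarith
  have e3 : (∫ x, conj ((ω x : ℂ) * w x) * (W x * w x) ∂m).re =
      (∫ x, conj ((ω x : ℂ) * w x) * F x ∂m).re -
        (∫ x, conj ((ω x : ℂ) * w x) * A x ∂m).re := by
    rw [← sub_re, ← integral_sub (integrable_conj_mul hωw hFm) (integrable_conj_mul hωw hA)]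
    congr 2; ext x; simp only [hF]; ring
  have e4 : (∫ x, conj ((ω x : ℂ) * w x) * F x ∂m).re ≤ N * lpNorm F 2 m :=
    (re_le_norm _).trans (norm_integral_conj_mul_le hωw hFm)
  have e5 : N * N ≤ N * (k * (lpNorm F 2 m + K * lpNorm w 2 m)) := by
    have : (∫ x, conj ((ω x : ℂ) * w x) * (W x * w x) ∂m).re ≤
        N * lpNorm F 2 m + K * (N * lpNorm w 2 m) := by
      have := mul_le_mul_of_nonneg_left e1 hK
      linarith
    have := mul_le_mul_of_nonneg_left this hk
    nlinarith
  rcases hN0.eq_or_lt with h0 | h0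
  · rw [← h0]
    have : 0 ≤ lpNorm F 2 m := lpNorm_nonneg
    have : 0 ≤ lpNorm w 2 m := lpNorm_nonneg
    positivity
  · exact le_of_mul_le_mul_left e5 h0

end SquareIntegrable

section SecondDifference

variable {G : Type*} [AddCommGroup G] [MeasurableSpace G] [MeasurableAdd G] {m : Measure G}
  [m.IsAddRightInvariant]

lemma MeasureTheory.MemLp.comp_add_right' {f : G → ℂ} (hf : MemLp f 2 m) (e : G) :
    MemLp (fun x => f (x + e)) 2 m :=
  hf.comp_measurePreserving (measurePreserving_add_right m e)

lemma MeasureTheory.MemLp.comp_sub_right' {f : G → ℂ} (hf : MemLp f 2 m) (e : G) :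
    MemLp (fun x => f (x - e)) 2 m := by
  simpa only [sub_eq_add_neg] using hf.comp_add_right' (-e)

lemma integral_conj_secondDiff_mul {a b : G → ℂ} (ha : MemLp a 2 m) (hb : MemLp b 2 m) (e : G) :
    ∫ x, conj (2 * a x - a (x + e) - a (x - e)) * b x ∂m =
      ∫ x, conj (a x) * (2 * b x - b (x + e) - b (x - e)) ∂m := by
  have i0 := (integrable_conj_mul ha hb).const_mul 2
  have i1 := integrable_conj_mul (ha.comp_add_right' e) hb
  have i2 := integrable_conj_mul (ha.comp_sub_right' e) hb
  have i3 := integrable_conj_mul ha (hb.comp_add_right' e)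
  have i4 := integrable_conj_mul ha (hb.comp_sub_right' e)
  have e1 : ∫ x, conj (a (x + e)) * b x ∂m = ∫ x, conj (a x) * b (x - e) ∂m := by
    rw [← integral_add_right_eq_self (fun x => conj (a x) * b (x - e)) e]
    simp
  have e2 : ∫ x, conj (a (x - e)) * b x ∂m = ∫ x, conj (a x) * b (x + e) ∂m := by
    rw [← integral_add_right_eq_self (fun x => conj (a (x - e)) * b x) e]
    simp
  calc _ = ∫ x, (2 * (conj (a x) * b x) - conj (a (x + e)) * b x - conj (a (x - e)) * b x) ∂m := by
        congr 1; ext x; simp only [map_sub, map_mul, map_ofNat]; ring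
    _ = ∫ x, (2 * (conj (a x) * b x) - conj (a x) * b (x + e) - conj (a x) * b (x - e)) ∂m := by
        rw [integral_sub_sub i0 i1 i2, integral_sub_sub i0 i3 i4, e1, e2]
        ring
    _ = _ := by congr 1; ext x; ring

/-- Kato-type inequality for second differences, tested against a weight which is almost
superharmonic. -/
lemma re_integral_weight_secondDiff_ge {ω : G → ℝ} {w : G → ℂ} {e : G} {c K : ℝ}
    (hω : ∀ x, 0 ≤ ω x) (hωm : AEStronglyMeasurable ω m)
    (hw : AEStronglyMeasurable w m) (hi : Integrable (fun x => ω x * ‖w x‖ ^ 2) m)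
    (hc : ∀ x, ω (x + e) ≤ c * ω x) (hc' : ∀ x, ω (x - e) ≤ c * ω x)
    (hK : ∀ x, ω (x + e) + ω (x - e) - 2 * ω x ≤ K * ω x) :
    -(K / 2) * ∫ x, ω x * ‖w x‖ ^ 2 ∂m ≤
      (∫ x, conj ((ω x : ℂ) * w x) * (2 * w x - w (x + e) - w (x - e)) ∂m).re := by
  have mp := measurePreserving_add_right m e
  have mn : MeasurePreserving (fun x => x - e) m m := by
    simpa only [sub_eq_add_neg] using measurePreserving_add_right m (-e)
  have hwp : AEStronglyMeasurable (fun x => w (x + e)) m := hw.comp_measurePreserving mp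
  have hwn : AEStronglyMeasurable (fun x => w (x - e)) m := hw.comp_measurePreserving mn
  have hωp : AEStronglyMeasurable (fun x => ω (x + e)) m := hωm.comp_measurePreserving mp
  have hωn : AEStronglyMeasurable (fun x => ω (x - e)) m := hωm.comp_measurePreserving mn
  have jp : Integrable (fun x => ω (x + e) * ‖w x‖ ^ 2) m := by
    refine (hi.const_mul c).mono' (hωp.mul (hw.norm.pow 2)) (.of_forall fun x => ?_)
    rw [Real.norm_of_nonneg (mul_nonneg (hω _) (sq_nonneg _)), ← mul_assoc]
    exact mul_le_mul_of_nonneg_right (hc x) (sq_nonneg _)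
  have jn : Integrable (fun x => ω (x - e) * ‖w x‖ ^ 2) m := by
    refine (hi.const_mul c).mono' (hωn.mul (hw.norm.pow 2)) (.of_forall fun x => ?_)
    rw [Real.norm_of_nonneg (mul_nonneg (hω _) (sq_nonneg _)), ← mul_assoc]
    exact mul_le_mul_of_nonneg_right (hc' x) (sq_nonneg _)
  have ip : Integrable (fun x => ω x * ‖w (x + e)‖ ^ 2) m := by
    simpa using jn.comp_add_right e
  have in' : Integrable (fun x => ω x * ‖w (x - e)‖ ^ 2) m := by
    simpa using jp.comp_sub_right e
  have ep : ∫ x, ω x * ‖w (x + e)‖ ^ 2 ∂m = ∫ x, ω (x - e) * ‖w x‖ ^ 2 ∂m := by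
    rw [← integral_add_right_eq_self (fun x => ω (x - e) * ‖w x‖ ^ 2) e]; simp
  have en : ∫ x, ω x * ‖w (x - e)‖ ^ 2 ∂m = ∫ x, ω (x + e) * ‖w x‖ ^ 2 ∂m := by
    rw [← integral_add_right_eq_self (fun x => ω x * ‖w (x - e)‖ ^ 2) e]; simp
  have key : ∀ a b : ℂ, ‖conj a * b‖ ≤ ‖a‖ ^ 2 + ‖b‖ ^ 2 := fun a b => by
    rw [norm_mul, RCLike.norm_conj]; nlinarith [sq_nonneg (‖a‖ - ‖b‖), sq_nonneg (‖a‖ + ‖b‖)]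
  have ii : Integrable (fun x => conj ((ω x : ℂ) * w x) * (2 * w x - w (x + e) - w (x - e))) m := by
    have hωc : AEStronglyMeasurable (fun x => (ω x : ℂ)) m :=
      continuous_ofReal.comp_aestronglyMeasurable hωm
    refine (((hi.const_mul 6).add ip).add in').mono'
      ((continuous_conj.comp_aestronglyMeasurable (hωc.mul hw)).mul
        (((hw.const_mul 2).sub hwp).sub hwn)) (.of_forall fun x => ?_)
    have : conj ((ω x : ℂ) * w x) * (2 * w x - w (x + e) - w (x - e)) =
        ω x * (2 * (conj (w x) * w x) - conj (w x) * w (x + e) - conj (w x) * w (x - e)) := by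
      simp only [map_mul, conj_ofReal]; ring
    rw [this, norm_mul, norm_real, Real.norm_of_nonneg (hω x)]
    have h1 := key (w x) (w x)
    have h2 := key (w x) (w (x + e))
    have h3 := key (w x) (w (x - e))
    have h4 := norm_sub_le (2 * (conj (w x) * w x) - conj (w x) * w (x + e))
      (conj (w x) * w (x - e))
    have h5 := norm_sub_le (2 * (conj (w x) * w x)) (conj (w x) * w (x + e))
    have h6 : ‖2 * (conj (w x) * w x)‖ = 2 * ‖conj (w x) * w x‖ := by rw [norm_mul]; norm_num
    have h7 := mul_le_mul_of_nonneg_left (show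
      ‖2 * (conj (w x) * w x) - conj (w x) * w (x + e) - conj (w x) * w (x - e)‖ ≤
      6 * ‖w x‖ ^ 2 + ‖w (x + e)‖ ^ 2 + ‖w (x - e)‖ ^ 2 by linarith) (hω x)
    simp only [Pi.add_apply]
    linarith
  have step : ∫ x, (ω x * ‖w x‖ ^ 2 - (1 / 2) * (ω x * ‖w (x + e)‖ ^ 2)
        - (1 / 2) * (ω x * ‖w (x - e)‖ ^ 2)) ∂m ≤
      (∫ x, conj ((ω x : ℂ) * w x) * (2 * w x - w (x + e) - w (x - e)) ∂m).re := by
    rw [show (∫ x, conj ((ω x : ℂ) * w x) * (2 * w x - w (x + e) - w (x - e)) ∂m).re =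
      ∫ x, (conj ((ω x : ℂ) * w x) * (2 * w x - w (x + e) - w (x - e))).re ∂m from
      (integral_re ii).symm]
    refine integral_mono ((hi.sub (ip.const_mul _)).sub (in'.const_mul _)) ii.re fun x => ?_
    change _ ≤ (conj ((ω x : ℂ) * w x) * (2 * w x - w (x + e) - w (x - e))).re
    have h1 : (conj ((ω x : ℂ) * w x) * (2 * w x - w (x + e) - w (x - e))).re =
        ω x * (2 * ‖w x‖ ^ 2 - (conj (w x) * w (x + e)).re - (conj (w x) * w (x - e)).re) := by
      have : conj ((ω x : ℂ) * w x) * (2 * w x - w (x + e) - w (x - e)) =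
        (ω x : ℂ) * (2 * (conj (w x) * w x) - conj (w x) * w (x + e)
          - conj (w x) * w (x - e)) := by
        simp only [map_mul, conj_ofReal]; ring
      rw [this, re_ofReal_mul, sub_re, sub_re, RCLike.conj_mul]
      have : (2 * ((‖w x‖ : ℝ) : ℂ) ^ 2).re = 2 * ‖w x‖ ^ 2 := by norm_cast
      exact congrArg (fun t => ω x * (t - _ - _)) this
    rw [h1]
    have k2 : ∀ a b : ℂ, (conj a * b).re ≤ (‖a‖ ^ 2 + ‖b‖ ^ 2) / 2 := fun a b => by
      refine (re_le_norm _).trans ?_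
      rw [norm_mul, RCLike.norm_conj]; nlinarith [sq_nonneg (‖a‖ - ‖b‖)]
    have := mul_le_mul_of_nonneg_left (show ‖w x‖ ^ 2 - (1 / 2) * ‖w (x + e)‖ ^ 2
      - (1 / 2) * ‖w (x - e)‖ ^ 2 ≤ 2 * ‖w x‖ ^ 2 - (conj (w x) * w (x + e)).re
        - (conj (w x) * w (x - e)).re by
      linarith [k2 (w x) (w (x + e)), k2 (w x) (w (x - e))]) (hω x)
    linarith
  refine le_trans ?_ step
  rw [integral_sub_sub hi (ip.const_mul _) (in'.const_mul _), integral_const_mul,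
    integral_const_mul, ep, en]
  have : ∫ x, (ω (x + e) * ‖w x‖ ^ 2 + ω (x - e) * ‖w x‖ ^ 2 - 2 * (ω x * ‖w x‖ ^ 2)) ∂m ≤
      ∫ x, K * (ω x * ‖w x‖ ^ 2) ∂m := by
    refine integral_mono ((jp.add jn).sub (hi.const_mul 2)) (hi.const_mul K) fun x => ?_
    have := mul_le_mul_of_nonneg_right (hK x) (sq_nonneg ‖w x‖)
    simp only; linarith
  rw [integral_sub (f := fun x => ω (x + e) * ‖w x‖ ^ 2 + ω (x - e) * ‖w x‖ ^ 2) (jp.add jn)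
    (hi.const_mul 2), integral_add jp jn, integral_const_mul, integral_const_mul] at this
  linarith

end SecondDifference

section SecondDerivative

variable {E F : Type*} [NormedAddCommGroup E] [NormedSpace ℝ E] [NormedAddCommGroup F]
  [NormedSpace ℝ F]

lemma HasCompactSupport.fderiv_apply_const {u : E → F} (hc : HasCompactSupport u) (e : E) :
    HasCompactSupport fun x => fderiv ℝ u x e :=
  (hc.fderiv ℝ).comp_left (g := fun L : E →L[ℝ] F => L e) (by simp)

lemma ContDiff.fderiv_apply_const {u : E → F} (hu : ContDiff ℝ (⊤ : ℕ∞) u) (e : E) :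
    ContDiff ℝ (⊤ : ℕ∞) fun x => fderiv ℝ u x e :=
  (hu.fderiv_right (m := (⊤ : ℕ∞)) (by simp)).clm_apply contDiff_const

lemma hasDerivAt_comp_add_smul {u : E → F} (hu : ContDiff ℝ (⊤ : ℕ∞) u) (x e : E) (s : ℝ) :
    HasDerivAt (fun s : ℝ => u (x + s • e)) (fderiv ℝ u (x + s • e) e) s := by
  have h1 : HasDerivAt (fun s : ℝ => x + s • e) e s := by
    simpa using ((hasDerivAt_id s).smul_const e).const_add x
  have hs := (hu.differentiable (by simp)).differentiableAt.hasFDerivAt (x := x + s • e)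
  exact hs.comp_hasDerivAt
    s h1

lemma hasDerivAt_comp_sub_smul {u : E → F} (hu : ContDiff ℝ (⊤ : ℕ∞) u) (x e : E) (s : ℝ) :
    HasDerivAt (fun s : ℝ => u (x - s • e)) (-fderiv ℝ u (x - s • e) e) s := by
  have := hasDerivAt_comp_add_smul hu x (-e) s
  simpa [smul_neg, ← sub_eq_add_neg] using this

lemma norm_secondDiff_sub_le {u : E → F} (hu : ContDiff ℝ (⊤ : ℕ∞) u) (hc : HasCompactSupport u)
    (e : E) : ∃ K ≥ 0, ∀ t : ℝ, 0 ≤ t → ∀ x,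
      ‖u (x + t • e) + u (x - t • e) - (2 : ℝ) • u x
        - t ^ 2 • fderiv ℝ (fun y => fderiv ℝ u y e) x e‖ ≤ K * t ^ 3 := by
  have hu1 := hu.fderiv_apply_const e
  have hc1 := hc.fderiv_apply_const e
  have hu2 := hu1.fderiv_apply_const e
  have hc2 := hc1.fderiv_apply_const e
  set D := fun y => fderiv ℝ u y e with hD
  set D2 := fun y => fderiv ℝ D y e with hD2
  obtain ⟨L, hL⟩ := hu2.lipschitzWith_of_hasCompactSupport hc2 (by simp)
  refine ⟨2 * L * ‖e‖, by positivity, fun t ht x => ?_⟩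
  have b1 : ∀ s : ℝ, 0 ≤ s → ‖D2 (x + s • e) + D2 (x - s • e) - (2 : ℝ) • D2 x‖ ≤
      2 * L * ‖e‖ * s := by
    intro s hs
    have h1 := hL.dist_le_mul (x + s • e) x
    have h2 := hL.dist_le_mul (x - s • e) x
    rw [dist_eq_norm, dist_eq_norm] at h1 h2
    simp only [add_sub_cancel_left, sub_sub_cancel_left, norm_neg, norm_smul,
      Real.norm_of_nonneg hs] at h1 h2
    calc _ = ‖(D2 (x + s • e) - D2 x) + (D2 (x - s • e) - D2 x)‖ := by congr 1; module
      _ ≤ _ := (norm_add_le _ _).trans (by linarith)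
  have b2 : ∀ s : ℝ, 0 ≤ s → ‖D (x + s • e) - D (x - s • e) - (2 * s) • D2 x‖ ≤
      2 * L * ‖e‖ * s ^ 2 := by
    intro s hs
    have hd : ∀ r ∈ Set.Icc 0 s, HasDerivWithinAt
        (fun r : ℝ => D (x + r • e) - D (x - r • e) - (2 * r) • D2 x)
        (D2 (x + r • e) + D2 (x - r • e) - (2 : ℝ) • D2 x) (Set.Icc 0 s) r := fun r _ => by
      have h3 : HasDerivAt (fun r : ℝ => (2 * r) • D2 x) ((2 : ℝ) • D2 x) r := by
        simpa using ((hasDerivAt_id r).const_mul 2).smul_const (D2 x)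
      have h4 := hasDerivAt_comp_sub_smul hu1 x e r
      have := (((hasDerivAt_comp_add_smul hu1 x e r).sub h4).sub h3)
      simp only [sub_neg_eq_add] at this
      exact this.hasDerivWithinAt
    have := norm_image_sub_le_of_norm_deriv_le_segment' hd (C := 2 * L * ‖e‖ * s)
      (fun r hr => (b1 r hr.1).trans (by gcongr; exact hr.2.le)) s ⟨hs, le_rfl⟩
    simp only [zero_smul, add_zero, sub_zero, mul_zero, sub_self] at this
    exact this.trans (le_of_eq (by ring))
  have hd : ∀ r ∈ Set.Icc 0 t, HasDerivWithinAt
      (fun r : ℝ => u (x + r • e) + u (x - r • e) - r ^ 2 • D2 x)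
      (D (x + r • e) - D (x - r • e) - (2 * r) • D2 x) (Set.Icc 0 t) r := fun r _ => by
    have h3 : HasDerivAt (fun r : ℝ => r ^ 2 • D2 x) ((2 * r) • D2 x) r := by
      simpa using ((hasDerivAt_id r).pow 2).smul_const (D2 x)
    have := (((hasDerivAt_comp_add_smul hu x e r).add (hasDerivAt_comp_sub_smul hu x e r)).sub h3)
    simp only [← sub_eq_add_neg] at this
    exact this.hasDerivWithinAt
  have := norm_image_sub_le_of_norm_deriv_le_segment' hd (C := 2 * L * ‖e‖ * t ^ 2)
    (fun r hr => (b2 r hr.1).trans (by have := hr.1; gcongr; exact hr.2.le)) t ⟨ht, le_rfl⟩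
  simp only [zero_smul, add_zero, sub_zero, ne_eq, OfNat.ofNat_ne_zero, not_false_eq_true,
    zero_pow] at this
  calc _ = ‖u (x + t • e) + u (x - t • e) - t ^ 2 • D2 x - (u x + u x)‖ := by
        congr 1; simp only [two_smul]; abel
    _ ≤ _ := this
    _ = _ := by ring

lemma norm_secondDiff_le {u : E → F} (hu : ContDiff ℝ (⊤ : ℕ∞) u) (hc : HasCompactSupport u)
    (e : E) : ∃ K ≥ 0, ∀ t : ℝ, 0 ≤ t → t ≤ 1 → ∀ x,
      ‖u (x + t • e) + u (x - t • e) - (2 : ℝ) • u x‖ ≤ K * t ^ 2 := by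
  obtain ⟨K, hK, h⟩ := norm_secondDiff_sub_le hu hc e
  have hu2 := (hu.fderiv_apply_const e).fderiv_apply_const e
  have hc2 := (hc.fderiv_apply_const e).fderiv_apply_const e
  obtain ⟨B, hB⟩ := hu2.continuous.bounded_above_of_compact_support hc2
  refine ⟨K + max B 0, by positivity, fun t ht ht1 x => ?_⟩
  have h1 := (norm_sub_norm_le _ _).trans (h t ht x)
  rw [norm_smul, Real.norm_of_nonneg (sq_nonneg t)] at h1
  have h2 := mul_le_mul_of_nonneg_left ((hB x).trans (le_max_left B 0)) (sq_nonneg t)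
  have h3 : K * t ^ 3 ≤ K * t ^ 2 := by
    refine mul_le_mul_of_nonneg_left ?_ hK
    exact pow_le_pow_of_le_one ht ht1 (by norm_num)
  linarith

end SecondDerivative

section Weight

variable {E : Type*} [NormedAddCommGroup E] [InnerProductSpace ℝ E] [FiniteDimensional ℝ E]
  [MeasurableSpace E] [BorelSpace E]

/-- Mollifying a positive weight which varies slowly at unit scale gives a comparable weight whose
second differences are controlled by the weight itself. -/
lemma exists_mollified_weight {ι : Type*} [Fintype ι] (e : ι → E) (he : ∀ j, ‖e j‖ = 1)
    {W : E → ℝ} (hWc : Continuous W)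
    (hW : ∀ x, 0 < W x) {c : ℝ} (hc : ∀ x y, dist x y ≤ 1 → W y ≤ c * W x) :
    ∃ ω : E → ℝ, ∃ k ≥ 0, ∃ K ≥ 0, Continuous ω ∧ (∀ x, 0 ≤ ω x) ∧ (∀ x, W x ≤ k * ω x) ∧
      (∀ x, ω x ≤ k * W x) ∧ ∀ j : ι, ∀ t : ℝ, 0 ≤ t → t ≤ 1 / 2 → ∀ x,
        ω (x + t • e j) ≤ k * ω x ∧ ω (x - t • e j) ≤ k * ω x ∧
        ω (x + t • e j) + ω (x - t • e j) - 2 * ω x ≤ K * t ^ 2 * ω x := by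
  have hc1 : 1 ≤ c := by
    have := hc 0 0 (by simp)
    by_contra! h
    nlinarith [hW 0]
  have hc0 : 0 ≤ c := zero_le_one.trans hc1
  let f : ContDiffBump (0 : E) := ⟨1 / 4, 1 / 2, by norm_num, by norm_num⟩
  set b : E → ℝ := f.normed volume with hb
  have b0 : ∀ x, 0 ≤ b x := f.nonneg_normed
  have bs : ∀ x, 1 / 2 < ‖x‖ → b x = 0 := fun x hx => by
    by_contra h
    have : x ∈ Function.support b := h
    rw [hb, f.support_normed_eq] at this
    have : ‖x‖ < 1 / 2 := mem_ball_zero_iff.1 this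
    linarith
  have bcd : ContDiff ℝ (⊤ : ℕ∞) b := f.contDiff_normed
  have bc : Continuous b := bcd.continuous
  have bcs : HasCompactSupport b := f.hasCompactSupport_normed
  have b1 : ∫ x, b x = 1 := f.integral_normed
  set ω : E → ℝ := fun x => ∫ y, W y * b (x - y) with hω
  have ωc : Continuous ω := by
    have := bcs.continuous_convolution_right (ContinuousLinearMap.mul ℝ ℝ)
      (hWc.locallyIntegrable (μ := (volume : Measure E))) bc
    exact this
  have bi : ∀ x, Integrable fun y => b (x - y) := fun x =>
    (bc.integrable_of_hasCompactSupport bcs).comp_sub_left x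
  have bx : ∀ x, ∫ y, b (x - y) = 1 := fun x => by
    rw [integral_sub_left_eq_self b volume x, b1]
  have iw : ∀ x, Integrable fun y => W y * b (x - y) := fun x => by
    have hcont : Continuous fun y => W y * b (x - y) :=
      hWc.mul (bc.comp (continuous_const.sub continuous_id))
    refine hcont.integrable_of_hasCompactSupport ?_
    exact (bcs.comp_homeomorph (Homeomorph.subLeft x)).mul_left
  have bW : ∀ x y, W y * b (x - y) ≤ c * W x * b (x - y) := fun x y => by
    by_cases h : 1 / 2 < ‖x - y‖
    · rw [bs _ h]; simp
    · exact mul_le_mul_of_nonneg_right (hc x y (by rw [dist_eq_norm]; linarith)) (b0 _)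
  have bW' : ∀ x y, W x * b (x - y) ≤ c * (W y * b (x - y)) := fun x y => by
    by_cases h : 1 / 2 < ‖x - y‖
    · rw [bs _ h]; simp
    · rw [← mul_assoc]
      exact mul_le_mul_of_nonneg_right (hc y x (by rw [dist_comm, dist_eq_norm]; linarith)) (b0 _)
  have h1 : ∀ x, ω x ≤ c * W x := fun x => by
    calc ω x ≤ ∫ y, c * W x * b (x - y) := integral_mono (iw x) ((bi x).const_mul _) (bW x)
      _ = c * W x := by rw [integral_const_mul, bx, mul_one]
  have h2 : ∀ x, W x ≤ c * ω x := fun x => by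
    calc W x = ∫ y, W x * b (x - y) := by rw [integral_const_mul, bx, mul_one]
      _ ≤ ∫ y, c * (W y * b (x - y)) := integral_mono
          ((bi x).const_mul _) ((iw x).const_mul _) (bW' x)
      _ = c * ω x := by rw [integral_const_mul]
  have h3 : ∀ x, 0 ≤ ω x := fun x => integral_nonneg fun y => mul_nonneg (hW y).le (b0 _)
  have h4 : ∀ x y, dist x y ≤ 1 → ω y ≤ c * c * c * ω x := fun x y hxy => by
    calc ω y ≤ c * W y := h1 y
      _ ≤ c * (c * W x) := by gcongr; exact hc x y hxy
      _ ≤ c * (c * (c * ω x)) := by gcongr; exact h2 x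
      _ = _ := by ring
  choose K hK0 hK using fun j => norm_secondDiff_le bcd bcs (e j)
  set K₁ := ∑ j, K j
  have hK1 : ∀ j, K j ≤ K₁ := fun j => Finset.single_le_sum (fun i _ => hK0 i) (Finset.mem_univ j)
  have hK10 : 0 ≤ K₁ := Finset.sum_nonneg fun i _ => hK0 i
  set v := (volume : Measure E).real (Metric.closedBall 0 1)
  have hv : 0 ≤ v := measureReal_nonneg
  have hcc : c ≤ c * c * c := by nlinarith [mul_nonneg hc0 (mul_nonneg hc0 hc0)]
  refine ⟨ω, c * c * c, by positivity, K₁ * v * c * c, by positivity, ωc, h3,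
    fun x => (h2 x).trans (mul_le_mul_of_nonneg_right hcc (h3 x)),
    fun x => (h1 x).trans (mul_le_mul_of_nonneg_right hcc (hW x).le),
    fun j t ht ht2 x => ⟨h4 _ _ ?_, h4 _ _ ?_, ?_⟩⟩
  · simp only [dist_self_add_right, norm_smul, he, Real.norm_of_nonneg ht]; linarith
  · rw [dist_eq_norm]
    simp only [sub_sub_cancel, norm_smul, he, Real.norm_of_nonneg ht]; linarith
  have nte : ‖t • e j‖ ≤ 1 / 2 := by rwa [norm_smul, he, Real.norm_of_nonneg ht, mul_one]
  have e1 : ω (x + t • e j) + ω (x - t • e j) - 2 * ω x =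
      ∫ y, W y * (b (x + t • e j - y) + b (x - t • e j - y) - 2 * b (x - y)) := by
    simp only [hω]
    rw [← integral_const_mul, ← integral_add (iw _) (iw _),
      ← integral_sub (f := fun y => W y * b (x + t • e j - y) + W y * b (x - t • e j - y))
        ((iw _).add (iw _)) ((iw x).const_mul 2)]
    congr 1; ext y; ring
  rw [e1]
  calc _ ≤ ∫ y, (Metric.closedBall x 1).indicator (fun _ => K₁ * t ^ 2 * (c * W x)) y := by
        refine integral_mono ?_ ?_ fun y => ?_
        · refine ((((iw (x + t • e j)).add (iw (x - t • e j))).sub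
            ((iw x).const_mul 2))).congr (.of_forall fun y => ?_)
          simp only [Pi.add_apply, Pi.sub_apply]; ring
        · exact (integrable_indicator_iff Metric.isClosed_closedBall.measurableSet).2
            (integrableOn_const (hs := (isCompact_closedBall x 1).measure_lt_top.ne))
        · by_cases hy : y ∈ Metric.closedBall x 1
          · rw [Set.indicator_of_mem hy]
            have hWy := hc x y (by rwa [dist_comm])
            have := hK j t ht (by linarith) (x - y)
            rw [show x - y + t • e j = x + t • e j - y by abel,
              show x - y - t • e j = x - t • e j - y by abel, smul_eq_mul] at this
            have := (le_abs_self _).trans this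
            calc _ ≤ W y * (K₁ * t ^ 2) := by
                  refine mul_le_mul_of_nonneg_left (this.trans ?_) (hW y).le
                  exact mul_le_mul_of_nonneg_right (hK1 j) (sq_nonneg t)
              _ ≤ (c * W x) * (K₁ * t ^ 2) := by gcongr
              _ = _ := by ring
          · rw [Set.indicator_of_notMem hy]
            have hy' : 1 < ‖x - y‖ := by
              rw [← dist_eq_norm, dist_comm]; simpa using hy
            rw [bs (x - y) (by linarith), bs (x + t • e j - y), bs (x - t • e j - y)]
            · simp
            · have := norm_add_le (x - t • e j - y) (t • e j)
              rw [show x - t • e j - y + t • e j = x - y by abel] at this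
              linarith
            · have := norm_sub_le (x + t • e j - y) (t • e j)
              rw [show x + t • e j - y - t • e j = x - y by abel] at this
              linarith
    _ = v * (K₁ * t ^ 2 * (c * W x)) := by
        rw [integral_indicator_const _ Metric.isClosed_closedBall.measurableSet, smul_eq_mul,
          measureReal_def, Measure.addHaar_closedBall_center]
        rfl
    _ ≤ v * (K₁ * t ^ 2 * (c * (c * ω x))) := by gcongr; exact h2 x
    _ = _ := by ring
end Weight

section APriori

variable {X : Type*} [MeasurableSpace X] {m : Measure X}

lemma lpNorm_sub_le' {f g : X → ℂ} (hf : MemLp f 2 m) :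
    lpNorm (fun x => f x - g x) 2 m ≤ lpNorm f 2 m + lpNorm g 2 m :=
  lpNorm_sub_le hf (by norm_num)

lemma lpNorm_add_le' {f g : X → ℂ} (hf : MemLp f 2 m) :
    lpNorm (fun x => f x + g x) 2 m ≤ lpNorm f 2 m + lpNorm g 2 m :=
  lpNorm_add_le hf (by norm_num)

lemma lpNorm_const_mul' (c : ℂ) (f : X → ℂ) :
    lpNorm (fun x => c * f x) 2 m = ‖c‖ * lpNorm f 2 m := by
  exact lpNorm_const_smul c f m

/-- A formally symmetric operator perturbed by a real potential is bounded below off the real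
axis. -/
lemma abs_im_mul_lpNorm_le {V : X → ℝ} {w A : X → ℂ} {ν : ℂ} (hw : MemLp w 2 m)
    (hA : MemLp A 2 m) (hVw : MemLp (fun x => (V x : ℂ) * w x) 2 m)
    (hsym : (∫ x, conj (w x) * A x ∂m).im = 0) :
    |ν.im| * lpNorm w 2 m ≤ lpNorm (fun x => A x + V x * w x - ν * w x) 2 m := by
  set F := fun x => A x + V x * w x - ν * w x with hF
  have hνw : MemLp (fun x => ν * w x) 2 m := hw.const_mul ν
  have hFm : MemLp F 2 m := (hA.add hVw).sub hνw
  have e1 : (∫ x, conj (w x) * F x ∂m).im = - (ν.im * lpNorm w 2 m ^ 2) := by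
    have i1 := integrable_conj_mul hw hA
    have i2 := integrable_conj_mul hw hVw
    have i3 := integrable_conj_mul hw hνw
    have : ∫ x, conj (w x) * F x ∂m = ∫ x, conj (w x) * A x ∂m +
        ∫ x, conj (w x) * (V x * w x) ∂m - ∫ x, conj (w x) * (ν * w x) ∂m := by
      rw [← integral_add i1 i2, ← integral_sub (f := fun x => conj (w x) * A x +
        conj (w x) * (V x * w x)) (i1.add i2) i3]
      congr 1; ext x; simp only [hF]; ring
    have e2 : ∫ x, conj (w x) * (V x * w x) ∂m = ((∫ x, V x * ‖w x‖ ^ 2 ∂m : ℝ) : ℂ) := by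
      rw [← integral_complex_ofReal]
      congr 1; ext x
      have := RCLike.conj_mul (w x)
      rw [mul_left_comm, this]; push_cast; rfl
    have e3 : ∫ x, conj (w x) * (ν * w x) ∂m = ν * ((lpNorm w 2 m ^ 2 : ℝ) : ℂ) := by
      rw [lpNorm_two_sq hw, ← integral_complex_ofReal, ← integral_const_mul]
      congr 1; ext x
      have := RCLike.conj_mul (w x)
      rw [mul_left_comm, this]; push_cast; rfl
    rw [this, e2, e3, sub_im, add_im, hsym, ofReal_im, im_mul_ofReal]
    ring
  have e2 := (abs_im_le_norm _).trans (norm_integral_conj_mul_le hw hFm)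
  rw [e1, abs_neg, abs_mul, abs_of_nonneg (sq_nonneg (lpNorm w 2 m))] at e2
  rcases (lpNorm_nonneg (f := w) (p := 2) (μ := m)).eq_or_lt with h0 | h0
  · rw [← h0, mul_zero]; exact lpNorm_nonneg
  · refine le_of_mul_le_mul_left ?_ h0
    linarith

/-- Abstract second order a priori bound. -/
lemma lpNorm_le_of_weight {V ω W : X → ℝ} {w A : X → ℂ} {ν : ℂ} {M k K : ℝ}
    (hWV : ∀ x, W x = V x + M) (hW : ∀ x, 0 ≤ W x)
    (hω : ∀ x, 0 ≤ ω x) (hωm : AEStronglyMeasurable ω m) (hWω : ∀ x, W x ≤ k * ω x)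
    (hωW : ∀ x, ω x ≤ k * W x) (hk : 0 ≤ k) (hK : 0 ≤ K) (hν : ν.im ≠ 0)
    (hw : MemLp w 2 m) (hWw : MemLp (fun x => (W x : ℂ) * w x) 2 m) (hA : MemLp A 2 m)
    (hsym : (∫ x, conj (w x) * A x ∂m).im = 0)
    (hre : -K * ∫ x, ω x * ‖w x‖ ^ 2 ∂m ≤ (∫ x, conj ((ω x : ℂ) * w x) * A x ∂m).re) :
    lpNorm (fun x => (W x : ℂ) * w x) 2 m ≤
        (1 + k ^ 2) * (1 + (‖(M : ℂ) + ν‖ + K) * |ν.im|⁻¹) *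
          lpNorm (fun x => A x + V x * w x - ν * w x) 2 m ∧
      lpNorm A 2 m ≤ (1 + k ^ 2) * (1 + (‖(M : ℂ) + ν‖ + K) * |ν.im|⁻¹) *
          lpNorm (fun x => A x + V x * w x - ν * w x) 2 m := by
  have hVw : MemLp (fun x => (V x : ℂ) * w x) 2 m := by
    refine (hWw.sub (hw.const_mul (M : ℂ))).ae_eq (.of_forall fun x => ?_)
    simp only [Pi.sub_apply, hWV]; push_cast; ring
  have h1 := abs_im_mul_lpNorm_le (ν := ν) hw hA hVw hsym
  set N := lpNorm (fun x => A x + V x * w x - ν * w x) 2 m with hN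
  have hF : MemLp (fun x => A x + V x * w x - ν * w x) 2 m := (hA.add hVw).sub (hw.const_mul ν)
  have hN0 : 0 ≤ N := lpNorm_nonneg
  have hν' : 0 < |ν.im| := abs_pos.2 hν
  have h2 : lpNorm w 2 m ≤ |ν.im|⁻¹ * N := by
    rw [inv_mul_eq_div, le_div_iff₀ hν']; linarith
  have hωw := lpNorm_le_mul_of_norm_le (f := fun x => (ω x : ℂ) * w x) (m := m)
    ((continuous_ofReal.comp_aestronglyMeasurable hωm).mul hw.1) hWw hk (fun x => by
      rw [norm_mul, norm_mul, norm_real, norm_real, Real.norm_of_nonneg (hω x),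
        Real.norm_of_nonneg (hW x), ← mul_assoc]
      exact mul_le_mul_of_nonneg_right (hωW x) (norm_nonneg _))
  have h3 := lpNorm_weight_mul_le hω hωW hk hK hw hωw.1 hWw hA hre
  have e1 : lpNorm (fun x => A x + W x * w x) 2 m ≤ N + ‖(M : ℂ) + ν‖ * lpNorm w 2 m := by
    rw [← lpNorm_const_mul']
    refine le_trans (le_of_eq ?_) (lpNorm_add_le' hF)
    congr 1; ext x; rw [hWV]; push_cast; ring
  have h4 : lpNorm (fun x => (W x : ℂ) * w x) 2 m ≤ k * lpNorm (fun x => (ω x : ℂ) * w x) 2 m := by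
    refine (lpNorm_le_mul_of_norm_le hWw.1 hωw.1 hk fun x => ?_).2
    rw [norm_mul, norm_mul, norm_real, norm_real, Real.norm_of_nonneg (hω x),
        Real.norm_of_nonneg (hW x), ← mul_assoc]
    exact mul_le_mul_of_nonneg_right (hWω x) (norm_nonneg _)
  have h5 : lpNorm A 2 m ≤ lpNorm (fun x => A x + W x * w x) 2 m +
      lpNorm (fun x => (W x : ℂ) * w x) 2 m := by
    refine le_trans (le_of_eq ?_) (lpNorm_sub_le' (hA.add hWw))
    congr 1; ext x; simp
  set S := ‖(M : ℂ) + ν‖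
  have hS : 0 ≤ S := norm_nonneg _
  set T := lpNorm w 2 m
  have h6 : S * T ≤ S * |ν.im|⁻¹ * N := by
    rw [mul_assoc]; exact mul_le_mul_of_nonneg_left h2 hS
  have h7 : K * T ≤ K * |ν.im|⁻¹ * N := by
    rw [mul_assoc]; exact mul_le_mul_of_nonneg_left h2 hK
  have h8 : k * lpNorm (fun x => (ω x : ℂ) * w x) 2 m ≤
      k ^ 2 * ((1 + (S + K) * |ν.im|⁻¹) * N) := by
    rw [pow_two, mul_assoc]
    refine mul_le_mul_of_nonneg_left (h3.trans (mul_le_mul_of_nonneg_left ?_ hk)) hk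
    linarith
  have h9 : 0 ≤ (1 + (S + K) * |ν.im|⁻¹) * N := by positivity
  have h10 : 0 ≤ K * |ν.im|⁻¹ * N := by positivity
  constructor
  · nlinarith
  · nlinarith

end APriori

section Lattice

variable {d : ℕ} {h : ℝ}

instance (d : ℕ) : DiscreteMeasurableSpace (Zd d) :=
  MeasurableSingletonClass.toDiscreteMeasurableSpace

lemma latMeas_map_equiv (e : Zd d ≃ Zd d) : (latMeas d h).map e = latMeas d h := by
  ext s hs
  rw [Measure.map_apply .of_discrete hs, latMeas, Measure.smul_apply, Measure.smul_apply,
    Measure.count_apply .of_discrete, Measure.count_apply .of_discrete]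
  congr 1
  rw [← Equiv.image_symm_eq_preimage]
  exact congrArg _ (e.symm.injective.encard_image s)

instance (d : ℕ) (h : ℝ) : (latMeas d h).IsAddRightInvariant :=
  ⟨fun g => latMeas_map_equiv (Equiv.addRight g)⟩

lemma latMeas_singleton (z : Zd d) : latMeas d h {z} = ENNReal.ofReal (h ^ d) := by
  simp [latMeas]

lemma latMeas_singleton_ne_top (z : Zd d) : latMeas d h {z} ≠ ∞ := by
  simp [latMeas_singleton]

lemma latMeas_real_singleton (hh : 0 < h) (z : Zd d) : (latMeas d h).real {z} = h ^ d := by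
  rw [measureReal_def, latMeas_singleton, ENNReal.toReal_ofReal (by positivity)]

lemma ae_latMeas_iff (hh : 0 < h) {p : Zd d → Prop} :
    (∀ᵐ z ∂latMeas d h, p z) ↔ ∀ z, p z := by
  refine ⟨fun H z => ?_, fun H => .of_forall H⟩
  by_contra hz
  have : latMeas d h {z} = 0 := measure_mono_null (by simpa using hz) H
  rw [latMeas_singleton, ENNReal.ofReal_eq_zero] at this
  exact absurd this (not_le.2 (by positivity))

lemma aestronglyMeasurable_latMeas {E : Type*} [TopologicalSpace E]
    [TopologicalSpace.PseudoMetrizableSpace E] [SecondCountableTopology E]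
    (f : Zd d → E) : AEStronglyMeasurable f (latMeas d h) := by
  borelize E
  exact Measurable.aestronglyMeasurable .of_discrete

/-- The kinetic part of the discrete Schrödinger operator. -/
def discLap (d : ℕ) (h : ℝ) (v : Zd d → ℂ) (z : Zd d) : ℂ :=
  (h ^ 2 : ℂ)⁻¹ * ∑ j : Fin d, (2 * v z - v (z + Pi.single j 1) - v (z - Pi.single j 1))

lemma MeasureTheory.MemLp.secondDiff {w : Zd d → ℂ} (hw : MemLp w 2 (latMeas d h)) (e : Zd d) :
    MemLp (fun z => 2 * w z - w (z + e) - w (z - e)) 2 (latMeas d h) :=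
  ((hw.const_mul 2).sub (hw.comp_add_right' _)).sub (hw.comp_sub_right' _)

lemma memLp_discLap {w : Zd d → ℂ} (hw : MemLp w 2 (latMeas d h)) :
    MemLp (discLap d h w) 2 (latMeas d h) := by
  have := memLp_finsetSum Finset.univ fun (j : Fin d) _ => hw.secondDiff (Pi.single j 1)
  exact this.const_mul _

lemma integral_conj_mul_discLap {a w : Zd d → ℂ} (ha : MemLp a 2 (latMeas d h))
    (hw : MemLp w 2 (latMeas d h)) :
    ∫ z, conj (a z) * discLap d h w z ∂latMeas d h = ((h ^ 2 : ℝ) : ℂ)⁻¹ *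
      ∑ j : Fin d, ∫ z, conj (a z) *
        (2 * w z - w (z + Pi.single j 1) - w (z - Pi.single j 1)) ∂latMeas d h := by
  rw [← integral_finsetSum _ fun j _ => integrable_conj_mul ha (hw.secondDiff _),
    ← integral_const_mul]
  congr 1; ext z
  rw [discLap, ← Finset.mul_sum]; push_cast; ring

lemma integral_conj_discLap_mul {a w : Zd d → ℂ} (ha : MemLp a 2 (latMeas d h))
    (hw : MemLp w 2 (latMeas d h)) :
    ∫ z, conj (discLap d h a z) * w z ∂latMeas d h =
      ∫ z, conj (a z) * discLap d h w z ∂latMeas d h := by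
  have e : ∀ b c : Zd d → ℂ, ∫ z, conj (b z) * c z ∂latMeas d h =
      conj (∫ z, conj (c z) * b z ∂latMeas d h) := fun b c => by
    rw [← integral_conj]
    congr 1; ext z; simp [mul_comm]
  rw [e, integral_conj_mul_discLap hw ha, integral_conj_mul_discLap ha hw, map_mul, map_sum]
  congr 1
  · simp
  · refine Finset.sum_congr rfl fun j _ => ?_
    rw [← e, integral_conj_secondDiff_mul ha hw]

lemma latPt_add_single (z : Zd d) (j : Fin d) :
    latPt d h (z + Pi.single j 1) = latPt d h z + h • EuclideanSpace.single j (1 : ℝ) := by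
  ext i
  by_cases hi : i = j
  · subst hi; simp [latPt]; ring
  · simp [latPt, hi]

lemma latPt_sub_single (z : Zd d) (j : Fin d) :
    latPt d h (z - Pi.single j 1) = latPt d h z - h • EuclideanSpace.single j (1 : ℝ) := by
  ext i
  by_cases hi : i = j
  · subst hi; simp [latPt]; ring
  · simp [latPt, hi]

/-- Second order a priori bound for the discrete Schrödinger operators, uniform in the mesh. -/
lemma exists_discrete_apriori {V : Euc d → ℝ} (hVc : Continuous V) {M c : ℝ}
    (hW : ∀ x, 0 < V x + M) (hc : ∀ x y, dist x y ≤ 1 → V y + M ≤ c * (V x + M))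
    {ν : ℂ} (hν : ν.im ≠ 0) :
    ∃ C ≥ 0, ∀ h : ℝ, 0 < h → h ≤ 1 / 2 → ∀ w v : Zd d → ℂ, MemLp w 2 (latMeas d h) →
      MemLp v 2 (latMeas d h) → (∀ z, discAct d h V w z - ν * w z = v z) →
      MemLp (fun z => ((V (latPt d h z) + M : ℝ) : ℂ) * w z) 2 (latMeas d h) ∧
      lpNorm (fun z => ((V (latPt d h z) + M : ℝ) : ℂ) * w z) 2 (latMeas d h) ≤
        C * lpNorm v 2 (latMeas d h) ∧
      lpNorm (discLap d h w) 2 (latMeas d h) ≤ C * lpNorm v 2 (latMeas d h) := by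
  obtain ⟨ω, k, hk, K, hK, -, hω0, hWω, hωW, hω⟩ :=
    exists_mollified_weight (fun j : Fin d => EuclideanSpace.single j (1 : ℝ)) (by simp)
      (hVc.add continuous_const) hW hc
  refine ⟨(1 + k ^ 2) * (1 + (‖(M : ℂ) + ν‖ + d * K / 2) * |ν.im|⁻¹), by positivity,
    fun h hh hh2 w v hw hv hwv => ?_⟩
  have hL := memLp_discLap hw
  have hVw : MemLp (fun z => (V (latPt d h z) : ℂ) * w z) 2 (latMeas d h) := by
    refine ((hv.add (hw.const_mul ν)).sub hL).ae_eq (.of_forall fun z => ?_)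
    simp only [Pi.sub_apply, Pi.add_apply, ← hwv z, discAct, discLap]
    ring
  have hWw : MemLp (fun z => ((V (latPt d h z) + M : ℝ) : ℂ) * w z) 2 (latMeas d h) := by
    refine (hVw.add (hw.const_mul (M : ℂ))).ae_eq (.of_forall fun z => ?_)
    simp only [Pi.add_apply]; push_cast; ring
  have hωw : MemLp (fun z => (ω (latPt d h z) : ℂ) * w z) 2 (latMeas d h) := by
    refine (lpNorm_le_mul_of_norm_le (aestronglyMeasurable_latMeas _) hWw hk fun z => ?_).1
    rw [norm_mul, norm_mul, norm_real, norm_real, Real.norm_of_nonneg (hω0 _),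
        Real.norm_of_nonneg (hW _).le, ← mul_assoc]
    exact mul_le_mul_of_nonneg_right (hωW _) (norm_nonneg _)
  have hi : Integrable (fun z => ω (latPt d h z) * ‖w z‖ ^ 2) (latMeas d h) := by
    refine (integrable_conj_mul hωw hw).norm.congr (.of_forall fun z => ?_)
    simp only [norm_mul, RCLike.norm_conj, norm_real, Real.norm_of_nonneg (hω0 _)]
    ring
  have hF : v = fun z => discLap d h w z + (V (latPt d h z)) * w z - ν * w z := by
    ext z; rw [← hwv z]; rfl
  refine ⟨hWw, ?_⟩
  rw [hF]
  refine lpNorm_le_of_weight (V := fun z => V (latPt d h z)) (ω := fun z => ω (latPt d h z))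
    (W := fun z => V (latPt d h z) + M) (fun _ => rfl) (fun z => (hW _).le) (fun z => hω0 _)
    (aestronglyMeasurable_latMeas _) (fun z => hWω _) (fun z => hωW _) hk (by positivity) hν
    hw hWw hL ?_ ?_
  · have : conj (∫ z, conj (w z) * discLap d h w z ∂latMeas d h) =
        ∫ z, conj (w z) * discLap d h w z ∂latMeas d h := by
      rw [← integral_conj, ← integral_conj_discLap_mul hw hw]
      congr 1; ext z; simp [mul_comm]
    exact conj_eq_iff_im.1 this
  · rw [integral_conj_mul_discLap hωw hw, ← ofReal_inv, re_ofReal_mul, re_sum]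
    have key : ∀ j : Fin d, -(K * h ^ 2 / 2) * ∫ z, ω (latPt d h z) * ‖w z‖ ^ 2 ∂latMeas d h ≤
        (∫ z, conj ((ω (latPt d h z) : ℂ) * w z) * (2 * w z - w (z + Pi.single j 1) -
          w (z - Pi.single j 1)) ∂latMeas d h).re := fun j => by
      refine re_integral_weight_secondDiff_ge (ω := fun z => ω (latPt d h z)) (c := k)
        (fun z => hω0 _) (aestronglyMeasurable_latMeas _) hw.1 hi (fun z => ?_) (fun z => ?_)
        (fun z => ?_)
      · rw [latPt_add_single]; exact (hω j h hh.le hh2 _).1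
      · rw [latPt_sub_single]; exact (hω j h hh.le hh2 _).2.1
      · rw [latPt_add_single, latPt_sub_single]; exact (hω j h hh.le hh2 _).2.2
    have := Finset.sum_le_sum fun j (_ : j ∈ Finset.univ) => key j
    rw [Finset.sum_const, Finset.card_univ, Fintype.card_fin, nsmul_eq_mul] at this
    refine le_trans (le_of_eq ?_) (mul_le_mul_of_nonneg_left this (by positivity))
    field_simp

/-- The adjoint of the resolvent of the discrete Schrödinger operator solves the conjugate
equation pointwise. -/
lemma discAct_adjoint_resolvent (hh : 0 < h) {V : Euc d → ℝ} {Hh : l2h d h →ₗ.[ℂ] l2h d h}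
    (hHh : IsDiscreteHam d h V Hh) {μ : ℂ} {Rh : l2h d h →L[ℂ] l2h d h}
    (hRh : IsResolventAt Hh μ Rh) (v : l2h d h) (z : Zd d) :
    discAct d h V (ContinuousLinearMap.adjoint Rh v : l2h d h) z -
      conj μ * (ContinuousLinearMap.adjoint Rh v : l2h d h) z = v z := by
  set w : l2h d h := ContinuousLinearMap.adjoint Rh v with hw
  set δ : l2h d h := indicatorConstLp 2 (measurableSet_singleton z)
    (latMeas_singleton_ne_top z) (1 : ℂ) with hδ
  have δe : ∀ y, δ y = ({z} : Set (Zd d)).indicator (fun _ => (1 : ℂ)) y :=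
    (ae_latMeas_iff hh).1 indicatorConstLp_coeFn
  have δm : MemLp (δ : Zd d → ℂ) 2 (latMeas d h) := Lp.memLp δ
  have wm : MemLp (w : Zd d → ℂ) 2 (latMeas d h) := Lp.memLp w
  have eA : discAct d h V δ = fun y => discLap d h δ y + V (latPt d h z) * δ y := by
    ext y
    rw [discAct, discLap]
    by_cases hy : y = z
    · rw [hy]
    · simp [δe, hy]
  have hmem : MemLp (discAct d h V δ) 2 (latMeas d h) := by
    rw [eA]; exact (memLp_discLap δm).add (δm.const_mul _)
  have hdom := hHh.1 δ hmem
  have hval := hHh.2 ⟨δ, hdom⟩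
  have hR : Rh (Hh ⟨δ, hdom⟩ - μ • δ) = δ := hRh.2 ⟨δ, hdom⟩
  have i1 : ⟪δ, v⟫_ℂ = ⟪Hh ⟨δ, hdom⟩ - μ • δ, w⟫_ℂ := by
    conv_lhs => rw [← hR]
    rw [hw, ContinuousLinearMap.adjoint_inner_right]
  have hs : ∀ f : Zd d → ℂ, ∫ y, conj (δ y) * f y ∂latMeas d h = (h ^ d : ℝ) * f z := fun f => by
    have : ∀ y, conj (δ y) * f y = ({z} : Set (Zd d)).indicator f y := fun y => by
      by_cases hy : y = z
      · simp [δe, hy]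
      · simp [δe, hy]
    simp_rw [this]
    rw [integral_indicator (measurableSet_singleton z), integral_singleton,
      latMeas_real_singleton hh]
    simp
  rw [L2.inner_def, L2.inner_def] at i1
  have i2 : ∫ y, conj (δ y) * v y ∂latMeas d h =
      ∫ y, conj (discLap d h δ y + V (latPt d h z) * δ y - μ * δ y) * w y ∂latMeas d h := by
    refine Eq.trans ?_ (i1.trans ?_)
    · congr 1; ext y; rw [RCLike.inner_apply, mul_comm]
    · refine integral_congr_ae ?_
      filter_upwards [Lp.coeFn_sub (Hh ⟨δ, hdom⟩) (μ • δ), Lp.coeFn_smul μ δ] with y h1 h2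
      rw [RCLike.inner_apply, mul_comm, h1, Pi.sub_apply, h2, hval y]
      simp only [eA, Pi.smul_apply, smul_eq_mul]
  have i3 : ∫ y, conj (discLap d h δ y + V (latPt d h z) * δ y - μ * δ y) * w y ∂latMeas d h =
      ∫ y, conj (δ y) * (discLap d h w y + V (latPt d h z) * w y - conj μ * w y) ∂latMeas d h := by
    have j1 := integrable_conj_mul (memLp_discLap δm) wm
    have j2 := integrable_conj_mul δm (memLp_discLap wm)
    have j3 : Integrable (fun y => conj (δ y) * (V (latPt d h z) * w y - conj μ * w y))
        (latMeas d h) := integrable_conj_mul δm ((wm.const_mul (V (latPt d h z) : ℂ)).sub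
      (wm.const_mul (conj μ)))
    calc _ = ∫ y, (conj (discLap d h δ y) * w y +
          conj (δ y) * (V (latPt d h z) * w y - conj μ * w y)) ∂latMeas d h := by
          congr 1; ext y; simp only [map_add, map_sub, map_mul, conj_ofReal]; ring
      _ = ∫ y, (conj (δ y) * discLap d h w y +
          conj (δ y) * (V (latPt d h z) * w y - conj μ * w y)) ∂latMeas d h := by
          rw [integral_add j1 j3, integral_add j2 j3, integral_conj_discLap_mul δm wm]
      _ = _ := by congr 1; ext y; ring
  rw [hs, i3, hs] at i2
  have hne : ((h ^ d : ℝ) : ℂ) ≠ 0 := by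
    rw [ofReal_ne_zero]; positivity
  exact (mul_left_cancel₀ hne i2).symm

end Lattice

section Continuum

variable {d : ℕ}

lemma contDiff_lapl {u : Euc d → ℂ} (hu : ContDiff ℝ (⊤ : ℕ∞) u) :
    ContDiff ℝ (⊤ : ℕ∞) (lapl d u) :=
  ContDiff.sum fun _ _ => (hu.fderiv_apply_const _).fderiv_apply_const _

lemma hasCompactSupport_lapl {u : Euc d → ℂ} (hc : HasCompactSupport u) :
    HasCompactSupport (lapl d u) := by
  refine HasCompactSupport.intro hc fun x hx => ?_
  refine Finset.sum_eq_zero fun j _ => ?_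
  refine image_eq_zero_of_notMem_tsupport (f := fun x => fderiv ℝ (fun y => fderiv ℝ u y
    (EuclideanSpace.single j (1 : ℝ))) x (EuclideanSpace.single j (1 : ℝ))) fun h => hx ?_
  have h1 : tsupport (fun y => fderiv ℝ u y (EuclideanSpace.single j (1 : ℝ))) ⊆ tsupport u :=
    tsupport_fderiv_apply_subset ℝ _
  have h2 := tsupport_fderiv_apply_subset ℝ (f := fun y => fderiv ℝ u y
    (EuclideanSpace.single j (1 : ℝ))) (EuclideanSpace.single j (1 : ℝ))
  exact h1 (h2 h)

lemma tendsto_integral_secondDiff_quotient {u g : Euc d → ℂ} (hu : ContDiff ℝ (⊤ : ℕ∞) u)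
    (hc : HasCompactSupport u) (hg : Continuous g) (hgc : HasCompactSupport g) (e : Euc d) :
    Filter.Tendsto (fun t : ℝ => ((t ^ 2)⁻¹ : ℝ) *
        ∫ x, conj (g x) * (2 * u x - u (x + t • e) - u (x - t • e))) (nhdsWithin 0 (Set.Ioi 0))
      (nhds (∫ x, conj (g x) * -(fderiv ℝ (fun y => fderiv ℝ u y e) x e))) := by
  obtain ⟨K, hK, h⟩ := norm_secondDiff_sub_le hu hc e
  set D2 := fun x => fderiv ℝ (fun y => fderiv ℝ u y e) x e with hD2
  have hD2c : Continuous D2 := ((hu.fderiv_apply_const e).fderiv_apply_const e).continuous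
  have hgi := (hg.integrable_of_hasCompactSupport hgc (μ := volume)).norm
  have hcg : HasCompactSupport fun x => conj (g x) := hgc.comp_left (map_zero _)
  rw [tendsto_iff_norm_sub_tendsto_zero]
  have hlim : Filter.Tendsto (fun t : ℝ => t * (K * ∫ x, ‖g x‖)) (nhdsWithin 0 (Set.Ioi 0))
      (nhds 0) := by
    have : Filter.Tendsto (fun t : ℝ => t * (K * ∫ x, ‖g x‖)) (nhds 0)
      (nhds (0 * (K * ∫ x, ‖g x‖))) := Filter.tendsto_id.mul_const _
    rw [zero_mul] at this
    exact this.mono_left nhdsWithin_le_nhds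
  refine squeeze_zero' (.of_forall fun _ => norm_nonneg _) ?_ hlim
  filter_upwards [self_mem_nhdsWithin] with t ht
  have ht0 : (0 : ℝ) < t := ht
  have i1 : Integrable fun x => conj (g x) * (2 * u x - u (x + t • e) - u (x - t • e)) := by
    refine Continuous.integrable_of_hasCompactSupport ?_ hcg.mul_right
    have := hu.continuous
    fun_prop
  have i2 : Integrable fun x => conj (g x) * -(D2 x) := by
    refine Continuous.integrable_of_hasCompactSupport ?_ hcg.mul_right
    fun_prop
  have ht2 : (t : ℂ) ≠ 0 := by exact_mod_cast ht0.ne'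
  rw [← integral_const_mul, ← integral_sub (i1.const_mul _) i2]
  calc _ ≤ ∫ x, t * K * ‖g x‖ := by
        refine norm_integral_le_of_norm_le (hgi.const_mul _) (.of_forall fun x => ?_)
        have e1 : ((t ^ 2)⁻¹ : ℝ) * (conj (g x) * (2 * u x - u (x + t • e) - u (x - t • e))) -
            conj (g x) * -(D2 x) = -(((t ^ 2)⁻¹ : ℝ) * (conj (g x) *
              (u (x + t • e) + u (x - t • e) - (2 : ℝ) • u x - t ^ 2 • D2 x))) := by
          simp only [real_smul]
          push_cast
          field_simp
          ring
        rw [e1, norm_neg, norm_mul, norm_mul, norm_real, RCLike.norm_conj,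
          Real.norm_of_nonneg (by positivity)]
        calc _ ≤ (t ^ 2)⁻¹ * (‖g x‖ * (K * t ^ 3)) := by gcongr; exact h t ht0.le x
          _ = _ := by field_simp
    _ = _ := by rw [integral_const_mul, mul_assoc]

lemma integral_conj_mul_neg_lapl {u g : Euc d → ℂ} (hu : ContDiff ℝ (⊤ : ℕ∞) u)
    (hg : Continuous g) (hgc : HasCompactSupport g) :
    ∫ x, conj (g x) * -(lapl d u x) = ∑ j : Fin d, ∫ x, conj (g x) *
      -(fderiv ℝ (fun y => fderiv ℝ u y (EuclideanSpace.single j (1 : ℝ))) x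
        (EuclideanSpace.single j (1 : ℝ))) := by
  rw [← integral_finsetSum]
  · congr 1; ext x
    rw [lapl, ← Finset.mul_sum, Finset.sum_neg_distrib]
  · intro j _
    have hcg : HasCompactSupport fun x => conj (g x) := hgc.comp_left (map_zero _)
    refine Continuous.integrable_of_hasCompactSupport ?_ hcg.mul_right
    have := ((hu.fderiv_apply_const (EuclideanSpace.single j (1 : ℝ))).fderiv_apply_const
      (EuclideanSpace.single j (1 : ℝ))).continuous
    fun_prop

/-- Second order a priori bound for Schrödinger operators on test functions. -/
lemma exists_continuum_apriori {V : Euc d → ℝ} (hVc : Continuous V) {M c : ℝ}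
    (hW : ∀ x, 0 < V x + M) (hc : ∀ x y, dist x y ≤ 1 → V y + M ≤ c * (V x + M))
    {ν : ℂ} (hν : ν.im ≠ 0) :
    ∃ C ≥ 0, ∀ u : Euc d → ℂ, ContDiff ℝ (⊤ : ℕ∞) u → HasCompactSupport u →
      lpNorm (fun x => ((V x + M : ℝ) : ℂ) * u x) 2 volume ≤
        C * lpNorm (fun x => -(lapl d u x) + V x * u x - ν * u x) 2 volume ∧
      lpNorm (lapl d u) 2 volume ≤
        C * lpNorm (fun x => -(lapl d u x) + V x * u x - ν * u x) 2 volume := by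
  obtain ⟨ω, k, hk, K, hK, hωc, hω0, hWω, hωW, hω⟩ :=
    exists_mollified_weight (fun j : Fin d => EuclideanSpace.single j (1 : ℝ)) (by simp)
      (hVc.add continuous_const) hW hc
  refine ⟨(1 + k ^ 2) * (1 + (‖(M : ℂ) + ν‖ + d * K / 2) * |ν.im|⁻¹), by positivity,
    fun u hu hcu => ?_⟩
  have huc := hu.continuous
  have hum : MemLp u 2 volume := huc.memLp_of_hasCompactSupport hcu
  have hLm : MemLp (fun x => -(lapl d u x)) 2 volume :=
    ((contDiff_lapl hu).continuous.memLp_of_hasCompactSupport (hasCompactSupport_lapl hcu)).neg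
  have hWm : MemLp (fun x => ((V x + M : ℝ) : ℂ) * u x) 2 volume :=
    Continuous.memLp_of_hasCompactSupport (by fun_prop) hcu.mul_left
  have hωm : MemLp (fun x => (ω x : ℂ) * u x) 2 volume :=
    Continuous.memLp_of_hasCompactSupport (by fun_prop) hcu.mul_left
  have hωu : HasCompactSupport fun x => (ω x : ℂ) * u x := hcu.mul_left
  have hωuc : Continuous fun x => (ω x : ℂ) * u x := by fun_prop
  have hi : Integrable (fun x => ω x * ‖u x‖ ^ 2) := by
    refine (integrable_conj_mul hωm hum).norm.congr (.of_forall fun z => ?_)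
    simp only [norm_mul, RCLike.norm_conj, norm_real, Real.norm_of_nonneg (hω0 _)]
    ring
  have h12 : ∀ᶠ t : ℝ in nhdsWithin 0 (Set.Ioi 0), 0 < t ∧ t ≤ 1 / 2 := by
    filter_upwards [self_mem_nhdsWithin, nhdsWithin_le_nhds (Iic_mem_nhds
      (show (0 : ℝ) < 1 / 2 by norm_num))] with t h1 h2 using ⟨h1, h2⟩
  have main := lpNorm_le_of_weight (m := volume) (A := fun x => -(lapl d u x)) (V := V)
    (W := fun x => V x + M) (ω := ω) (K := d * K / 2) (k := k) (ν := ν) (fun _ => rfl)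
    (fun x => (hW x).le) hω0 hωc.aestronglyMeasurable hWω hωW hk (by positivity) hν hum hWm hLm
    ?_ ?_
  · refine ⟨main.1, le_trans (le_of_eq ?_) main.2⟩
    exact (lpNorm_neg (lapl d u) 2 volume).symm
  · rw [integral_conj_mul_neg_lapl hu huc hcu, im_sum]
    refine Finset.sum_eq_zero fun j _ => ?_
    have := tendsto_integral_secondDiff_quotient hu hcu huc hcu (EuclideanSpace.single j (1 : ℝ))
    refine tendsto_nhds_unique ((continuous_im.tendsto _).comp this)
      (tendsto_const_nhds.congr fun t => ?_)
    simp only [Function.comp_apply, im_ofReal_mul]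
    refine (mul_eq_zero_of_right _ (conj_eq_iff_im.1 ?_)).symm
    rw [← integral_conj, ← integral_conj_secondDiff_mul hum hum]
    congr 1; ext z; simp [mul_comm]
  · rw [integral_conj_mul_neg_lapl hu hωuc hωu, re_sum]
    have key : ∀ j : Fin d, -(K / 2) * ∫ x, ω x * ‖u x‖ ^ 2 ≤
        (∫ x, conj ((ω x : ℂ) * u x) * -(fderiv ℝ (fun y => fderiv ℝ u y
          (EuclideanSpace.single j (1 : ℝ))) x (EuclideanSpace.single j (1 : ℝ)))).re := fun j => by
      have := tendsto_integral_secondDiff_quotient hu hcu hωuc hωu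
        (EuclideanSpace.single j (1 : ℝ))
      refine ge_of_tendsto ((continuous_re.tendsto _).comp this) ?_
      filter_upwards [h12] with t ht
      simp only [Function.comp_apply, re_ofReal_mul]
      have := re_integral_weight_secondDiff_ge (c := k) (K := K * t ^ 2) hω0
        hωc.aestronglyMeasurable huc.aestronglyMeasurable hi
        (fun x => (hω j t ht.1.le ht.2 x).1) (fun x => (hω j t ht.1.le ht.2 x).2.1)
        (fun x => (hω j t ht.1.le ht.2 x).2.2)
      have ht2 : t ≠ 0 := ht.1.ne'
      refine le_trans (le_of_eq ?_) (mul_le_mul_of_nonneg_left this (by positivity))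
      field_simp
    have := Finset.sum_le_sum fun j (_ : j ∈ Finset.univ) => key j
    rw [Finset.sum_const, Finset.card_univ, Fintype.card_fin, nsmul_eq_mul] at this
    refine le_trans (le_of_eq ?_) this
    ring

end Continuum

section FourierSide

variable {d : ℕ}

open scoped LineDeriv SchwartzMap

lemma integral_conj_schwartz_mul (ψ : 𝓢(Euc d, ℂ)) {f : Euc d → ℂ} (hf : MemLp f 2 volume) :
    ∫ x, conj (ψ x) * f x = ∫ ξ, conj (𝓕 ψ ξ) * (𝓕 (hf.toLp f) : L2 d) ξ := by
  have h1 := Lp.inner_fourier_eq (ψ.toLp 2 volume) (hf.toLp f)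
  rw [SchwartzMap.toLp_fourier_eq, L2.inner_def, L2.inner_def] at h1
  have h2 : ∫ x, conj (ψ x) * f x = ∫ x, ⟪(ψ.toLp 2 volume : L2 d) x, hf.toLp f x⟫_ℂ := by
    refine integral_congr_ae ?_
    filter_upwards [hf.coeFn_toLp, ψ.coeFn_toLp 2 volume] with x hx hy
    rw [hx, hy, RCLike.inner_apply, mul_comm]
  rw [h2, ← h1]
  refine integral_congr_ae ?_
  filter_upwards [(𝓕 ψ).coeFn_toLp 2 volume] with x hy
  rw [hy, RCLike.inner_apply, mul_comm]

/-- The partial derivative `∂ψ/∂x_j` as a Schwartz function. -/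
def schwartzPartial (j : Fin d) (ψ : 𝓢(Euc d, ℂ)) : 𝓢(Euc d, ℂ) :=
  ∂_{EuclideanSpace.single j (1 : ℝ)} ψ

lemma fourier_lineDeriv_apply (ψ : 𝓢(Euc d, ℂ)) (j : Fin d) (ξ : Euc d) :
    𝓕 (schwartzPartial j ψ) ξ = 2 * π * I * ξ j * 𝓕 ψ ξ := by
  have ht : (fun x : Euc d => inner ℝ x (EuclideanSpace.single j (1 : ℝ))).HasTemperateGrowth :=
    ((innerSL ℝ).flip (EuclideanSpace.single j (1 : ℝ))).hasTemperateGrowth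
  rw [schwartzPartial, SchwartzMap.fourier_lineDerivOp_eq, smul_apply,
    SchwartzMap.smulLeftCLM_apply_apply ht]
  simp [EuclideanSpace.inner_single_right, mul_assoc]

/-- Fourier side of a second order equation in divergence form tested against Schwartz
functions. -/
lemma fourier_eq_of_weak_eq {G F : Euc d → ℂ} {B : Fin d → Euc d → ℂ} (hG : MemLp G 2 volume)
    (hF : MemLp F 2 volume) (hB : ∀ j, MemLp (B j) 2 volume)
    (h : ∀ ψ : 𝓢(Euc d, ℂ), ∑ j, ∫ x, conj (-(schwartzPartial j (schwartzPartial j ψ)) x) * G x =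
      (∑ j, ∫ x, conj (schwartzPartial j ψ x) * B j x) + ∫ x, conj (ψ x) * F x) :
    ∀ᵐ ξ : Euc d, ((∑ j, (2 * π * ξ j) ^ 2 : ℝ) : ℂ) * (𝓕 (hG.toLp G) : L2 d) ξ =
      ∑ j, (-(2 * π * I * ξ j)) * (𝓕 ((hB j).toLp (B j)) : L2 d) ξ +
        (𝓕 (hF.toLp F) : L2 d) ξ := by
  have hloc : ∀ f : L2 d, LocallyIntegrable (f : Euc d → ℂ) volume := fun f =>
    (Lp.memLp f).locallyIntegrable (by norm_num)
  have hlm : ∀ (a : Euc d → ℂ) (_ : Continuous a) (f : L2 d),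
      LocallyIntegrable (fun ξ => a ξ * f ξ) volume := fun a ha f =>
    (hloc f).continuous_smul ha
  have hc1 : Continuous fun ξ : Euc d => ((∑ j, (2 * π * ξ j) ^ 2 : ℝ) : ℂ) := by fun_prop
  have hc2 : ∀ j, Continuous fun ξ : Euc d => (-(2 * π * I * ξ j) : ℂ) := fun j => by fun_prop
  have l1 := hlm _ hc1 (𝓕 (hG.toLp G))
  have l2 : ∀ j, LocallyIntegrable (fun ξ : Euc d =>
    (-(2 * π * I * ξ j)) * (𝓕 ((hB j).toLp (B j)) : L2 d) ξ) volume := fun j => hlm _ (hc2 j) _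
  have l3 := hloc (𝓕 (hF.toLp F))
  have l4 : LocallyIntegrable (fun ξ : Euc d => ∑ j,
    (-(2 * π * I * ξ j)) * (𝓕 ((hB j).toLp (B j)) : L2 d) ξ) volume := by
    exact locallyIntegrable_finsetSum _ fun j _ => l2 j
  have key := ae_eq_zero_of_integral_contDiff_smul_eq_zero (l1.sub (l4.add l3)) (fun g hg hgc => ?_)
  · filter_upwards [key] with ξ hξ
    exact sub_eq_zero.1 hξ
  · have hgc' : HasCompactSupport (fun x => (g x : ℂ)) := hgc.comp_left ofReal_zero
    have hg' : ContDiff ℝ (⊤ : ℕ∞) (fun x => (g x : ℂ)) := ofRealCLM.contDiff.comp hg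
    set p : 𝓢(Euc d, ℂ) := hgc'.toSchwartzMap hg' with hp
    set ψ : 𝓢(Euc d, ℂ) := 𝓕⁻ p with hψ
    have hψp : 𝓕 ψ = p := FourierTransform.fourier_fourierInv_eq p
    have hpx : ∀ ξ, p ξ = g ξ := fun ξ => rfl
    have h1 := h ψ
    have hneg : ∀ j x,
        conj (-(schwartzPartial j (schwartzPartial j ψ)) x) * G x =
        -(conj ((schwartzPartial j (schwartzPartial j ψ)) x) * G x) := fun j x => by
      rw [map_neg, neg_mul]
    simp_rw [hneg] at h1
    simp_rw [integral_neg] at h1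
    have hBj : ∀ j, ∫ x, conj (schwartzPartial j ψ x) * B j x = ∫ ξ : Euc d,
        conj (2 * π * I * ξ j * (g ξ : ℂ)) * (𝓕 ((hB j).toLp (B j)) : L2 d) ξ := fun j => by
      rw [integral_conj_schwartz_mul _ (hB j)]
      simp_rw [fourier_lineDeriv_apply, hψp, hpx]
    simp_rw [integral_conj_schwartz_mul _ hG, integral_conj_schwartz_mul _ hF] at h1
    simp_rw [hBj,
      fourier_lineDeriv_apply, hψp, hpx] at h1
    have hgi : ∀ {f : Euc d → ℂ}, LocallyIntegrable f volume →
        Integrable (fun x => g x • f x) volume := fun hf =>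
      hf.integrable_smul_left_of_hasCompactSupport hg.continuous hgc
    have e1 : ∫ x, g x • (((∑ j, (2 * π * x j) ^ 2 : ℝ) : ℂ) * (𝓕 (hG.toLp G) : L2 d) x) =
        ∑ j, -∫ x : Euc d, conj (2 * π * I * x j * (2 * π * I * x j * (g x : ℂ))) *
          (𝓕 (hG.toLp G) : L2 d) x := by
      simp_rw [← integral_neg]
      rw [← integral_finsetSum]
      · refine integral_congr_ae (.of_forall fun x => ?_)
        simp only [real_smul, map_mul, conj_ofReal, conj_I, map_ofNat]
        push_cast
        rw [Finset.sum_mul, Finset.mul_sum]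
        refine Finset.sum_congr rfl fun j _ => ?_
        linear_combination 4 * (π:ℂ) ^ 2 * (x j : ℂ) ^ 2 * g x * (𝓕 (hG.toLp G) : L2 d) x * I_sq
      · intro j _
        have hc : Continuous fun ξ : Euc d => ((2 * π * ξ j) ^ 2 : ℂ) := by fun_prop
        refine (hgi (hlm _ hc (𝓕 (hG.toLp G)))).congr (.of_forall fun x => ?_)
        simp only [real_smul, map_mul, conj_ofReal, conj_I, map_ofNat]
        linear_combination 4 * (π:ℂ) ^ 2 * (x j : ℂ) ^ 2 * g x * (𝓕 (hG.toLp G) : L2 d) x * I_sq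
    have e2 : ∀ j, ∫ x : Euc d,
        conj (2 * π * I * x j * (g x : ℂ)) * (𝓕 ((hB j).toLp (B j)) : L2 d) x =
        ∫ x, g x • ((-(2 * π * I * x j)) * (𝓕 ((hB j).toLp (B j)) : L2 d) x) := fun j => by
      refine integral_congr_ae (.of_forall fun x => ?_)
      simp only [real_smul, map_mul, conj_ofReal, conj_I, map_ofNat]
      ring
    have e3 : ∫ x : Euc d, conj (g x : ℂ) * (𝓕 (hF.toLp F) : L2 d) x =
        ∫ x, g x • ((𝓕 (hF.toLp F) : L2 d) x) := by
      refine integral_congr_ae (.of_forall fun x => ?_)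
      simp only [real_smul, conj_ofReal]
    rw [← e1] at h1
    simp_rw [e2] at h1
    rw [e3, ← integral_finsetSum _ (fun j _ => hgi (l2 j))] at h1
    have e4 : ∫ x, g x • (((fun ξ : Euc d => ((∑ j, (2 * π * ξ j) ^ 2 : ℝ) : ℂ) *
        (𝓕 (hG.toLp G) : L2 d) ξ) -
        ((fun ξ : Euc d => ∑ j, (-(2 * π * I * ξ j)) * (𝓕 ((hB j).toLp (B j)) : L2 d) ξ) +
          (𝓕 (hF.toLp F) : L2 d))) x) =
        (∫ x, g x • (((∑ j, (2 * π * x j) ^ 2 : ℝ) : ℂ) * (𝓕 (hG.toLp G) : L2 d) x)) -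
        ((∫ x, ∑ j, g x • ((-(2 * π * I * x j)) * (𝓕 ((hB j).toLp (B j)) : L2 d) x)) +
         ∫ x, g x • ((𝓕 (hF.toLp F) : L2 d) x)) := by
      have i4 : Integrable (fun x : Euc d => ∑ j, g x • ((-(2 * π * I * x j)) *
        (𝓕 ((hB j).toLp (B j)) : L2 d) x)) volume :=
        integrable_finsetSum _ (fun j _ => hgi (l2 j))
      have i43 : Integrable (fun x : Euc d => ∑ j, g x • ((-(2 * π * I * x j)) *
        (𝓕 ((hB j).toLp (B j)) : L2 d) x) + g x • ((𝓕 (hF.toLp F) : L2 d) x)) volume :=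
        i4.add (hgi l3)
      rw [← integral_add i4 (hgi l3), ← integral_sub (hgi l1) i43]
      refine integral_congr_ae (.of_forall fun x => ?_)
      simp only [Pi.sub_apply, Pi.add_apply, smul_sub, smul_add, Finset.smul_sum]
    rw [e4, h1, sub_self]

end FourierSide

section EnergyEstimate

variable {d : ℕ}

open scoped SchwartzMap

lemma lpNorm_fourier_toLp {f : Euc d → ℂ} (hf : MemLp f 2 volume) :
    lpNorm (𝓕 (hf.toLp f) : L2 d) 2 volume = lpNorm f 2 volume := by
  rw [lpNorm_coeFn, Lp.norm_fourier_eq, norm_toLp_eq_lpNorm]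

lemma integral_conj_fourier_mul {f g : Euc d → ℂ} (hf : MemLp f 2 volume) (hg : MemLp g 2 volume) :
    ∫ ξ, conj ((𝓕 (hf.toLp f) : L2 d) ξ) * (𝓕 (hg.toLp g) : L2 d) ξ =
      ∫ x, conj (f x) * g x := by
  rw [← inner_toLp_toLp hf hg, ← Lp.inner_fourier_eq, L2.inner_def]
  refine integral_congr_ae (.of_forall fun x => ?_)
  simp only [RCLike.inner_apply, mul_comm]

lemma exists_energy_identity {G F : Euc d → ℂ} {B : Fin d → Euc d → ℂ} (hG : MemLp G 2 volume)
    (hF : MemLp F 2 volume) (hB : ∀ j, MemLp (B j) 2 volume)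
    (h : ∀ ψ : 𝓢(Euc d, ℂ), ∑ j, ∫ x, conj (-(schwartzPartial j (schwartzPartial j ψ)) x) * G x =
      (∑ j, ∫ x, conj (schwartzPartial j ψ x) * B j x) + ∫ x, conj (ψ x) * F x) :
    ∃ E ≥ 0, ∃ s : ℂ, ‖s‖ ≤ E * ∑ j, lpNorm (B j) 2 volume ∧
      ((E ^ 2 : ℝ) : ℂ) = s + ∫ x, conj (G x) * F x := by
  have key := fourier_eq_of_weak_eq hG hF hB h
  set g : L2 d := 𝓕 (hG.toLp G) with hg
  set f : L2 d := 𝓕 (hF.toLp F) with hf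
  set b : Fin d → L2 d := fun j => 𝓕 ((hB j).toLp (B j)) with hb
  set ω : Euc d → ℝ := fun ξ => √(∑ j, (2 * π * ξ j) ^ 2) with hω
  have hω0 : ∀ ξ, 0 ≤ ω ξ := fun ξ => Real.sqrt_nonneg _
  have hω2 : ∀ ξ, ω ξ ^ 2 = ∑ j, (2 * π * ξ j) ^ 2 := fun ξ =>
    Real.sq_sqrt (Finset.sum_nonneg fun _ _ => sq_nonneg _)
  have hωj : ∀ ξ j, |2 * π * ξ j| ≤ ω ξ := fun ξ j => by
    refine abs_le_of_sq_le_sq ?_ (hω0 ξ)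
    rw [hω2]
    exact Finset.single_le_sum (f := fun j => (2 * π * ξ j) ^ 2) (fun _ _ => sq_nonneg _)
      (Finset.mem_univ j)
  have hωc : Continuous ω := by fun_prop
  have hT : ∀ ξ j, ‖(2 * π * I * ξ j : ℂ)‖ ≤ ω ξ := fun ξ j => by
    refine le_trans (le_of_eq ?_) (hωj ξ j)
    rw [show (2 * π * I * ξ j : ℂ) = ((2 * π * ξ j : ℝ) : ℂ) * I by push_cast; ring, norm_mul,
      norm_I, mul_one, norm_real, Real.norm_eq_abs]
  set S : Euc d → ℂ := fun ξ => (ω ξ : ℂ) * g ξ with hS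
  have hSa : AEStronglyMeasurable S volume :=
    (continuous_ofReal.comp hωc).aestronglyMeasurable.mul (Lp.aestronglyMeasurable g)
  have hSm : MemLp S 2 volume := by
    have hm : MemLp (fun ξ => ‖g ξ‖ + (∑ j, ‖b j ξ‖ + ‖f ξ‖)) 2 volume :=
      (Lp.memLp g).norm.add ((memLp_finsetSum _ fun j _ => (Lp.memLp (b j)).norm).add
        (Lp.memLp f).norm)
    refine hm.mono' hSa ?_
    filter_upwards [key] with ξ hξ
    have h1 : ω ξ ^ 2 * ‖g ξ‖ ≤ ω ξ * ∑ j, ‖b j ξ‖ + ‖f ξ‖ := by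
      calc ω ξ ^ 2 * ‖g ξ‖ = ‖((∑ j, (2 * π * ξ j) ^ 2 : ℝ) : ℂ) * g ξ‖ := by
            rw [norm_mul, ← hω2, norm_real, Real.norm_of_nonneg (sq_nonneg _)]
        _ ≤ _ := by
            rw [hξ]
            refine (norm_add_le _ _).trans (add_le_add_left ((norm_sum_le _ _).trans ?_) _)
            rw [Finset.mul_sum]
            refine Finset.sum_le_sum fun j _ => ?_
            rw [norm_mul, norm_neg]
            exact mul_le_mul_of_nonneg_right (hT ξ j) (norm_nonneg _)
    have hb0 : 0 ≤ ∑ j, ‖b j ξ‖ := Finset.sum_nonneg fun _ _ => norm_nonneg _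
    rw [hS, norm_mul, norm_real, Real.norm_of_nonneg (hω0 ξ)]
    have := norm_nonneg (g ξ)
    have := norm_nonneg (f ξ)
    rcases le_total (ω ξ) 1 with h2 | h2
    · nlinarith [hω0 ξ]
    · have h3 : ω ξ * (ω ξ * ‖g ξ‖) ≤ ω ξ * (∑ j, ‖b j ξ‖ + ‖f ξ‖) := by nlinarith
      have := le_of_mul_le_mul_left h3 (by linarith)
      linarith
  set T : Fin d → Euc d → ℂ := fun j ξ => (2 * π * I * ξ j : ℂ) * g ξ with hTdef
  have hTm : ∀ j, MemLp (T j) 2 volume ∧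
      lpNorm (T j) 2 volume ≤ 1 * lpNorm S 2 volume := fun j => by
    have hc : Continuous fun ξ : Euc d => (2 * π * I * ξ j : ℂ) := by fun_prop
    refine lpNorm_le_mul_of_norm_le (hc.aestronglyMeasurable.mul (Lp.aestronglyMeasurable g)) hSm
      zero_le_one fun ξ => ?_
    have h1 : ‖S ξ‖ = ω ξ * ‖g ξ‖ := by
      rw [hS, norm_mul, norm_real, Real.norm_of_nonneg (hω0 ξ)]
    rw [one_mul, h1, Pi.mul_apply, norm_mul]
    exact mul_le_mul_of_nonneg_right (hT ξ j) (norm_nonneg _)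
  refine ⟨lpNorm S 2 volume, lpNorm_nonneg, ∑ j, ∫ ξ, conj (T j ξ) * b j ξ, ?_, ?_⟩
  · refine (norm_sum_le _ _).trans ?_
    rw [Finset.mul_sum]
    refine Finset.sum_le_sum fun j _ => ?_
    refine (norm_integral_conj_mul_le (hTm j).1 (Lp.memLp (b j))).trans ?_
    rw [hb, lpNorm_fourier_toLp]
    exact mul_le_mul_of_nonneg_right (by simpa using (hTm j).2) lpNorm_nonneg
  · rw [lpNorm_two_sq hSm, ← integral_conj_fourier_mul hG hF, ← integral_complex_ofReal,
      ← integral_finsetSum _ (fun j _ => integrable_conj_mul (hTm j).1 (Lp.memLp (b j)))]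
    have i1 : Integrable (fun ξ => ∑ j, conj (T j ξ) * b j ξ) volume :=
      integrable_finsetSum _ (fun j _ => integrable_conj_mul (hTm j).1 (Lp.memLp (b j)))
    rw [← integral_add i1 (integrable_conj_mul (Lp.memLp g) (Lp.memLp f))]
    refine integral_congr_ae ?_
    filter_upwards [key] with ξ hξ
    have h1 : ((‖S ξ‖ ^ 2 : ℝ) : ℂ) = conj (g ξ) * (((∑ j, (2 * π * ξ j) ^ 2 : ℝ) : ℂ) * g ξ) := by
      rw [← hω2, hS, norm_mul, mul_pow, norm_real, Real.norm_of_nonneg (hω0 ξ)]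
      push_cast
      rw [← Complex.conj_mul']
      ring
    rw [h1, hξ, mul_add, Finset.mul_sum]
    congr 1
    refine Finset.sum_congr rfl fun j _ => ?_
    simp only [hTdef, map_mul, conj_ofReal, conj_I, map_ofNat]
    ring

end EnergyEstimate

section Cutoff

variable {d : ℕ}

open scoped SchwartzMap

lemma fderiv_mul_apply_const {a b : Euc d → ℂ} (ha : Differentiable ℝ a) (hb : Differentiable ℝ b)
    (x e : Euc d) : fderiv ℝ (fun y => a y * b y) x e =
      a x * fderiv ℝ b x e + b x * fderiv ℝ a x e := by
  rw [fderiv_fun_mul (ha x) (hb x)]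
  simp

lemma lapl_mul {a b : Euc d → ℂ} (ha : ContDiff ℝ (⊤ : ℕ∞) a) (hb : ContDiff ℝ (⊤ : ℕ∞) b)
    (x : Euc d) : lapl d (fun y => a y * b y) x = a x * lapl d b x + b x * lapl d a x +
      2 * ∑ j, fderiv ℝ a x (EuclideanSpace.single j (1 : ℝ)) *
        fderiv ℝ b x (EuclideanSpace.single j (1 : ℝ)) := by
  have hd : ∀ {f : Euc d → ℂ}, ContDiff ℝ (⊤ : ℕ∞) f → Differentiable ℝ f := fun hf =>
    hf.differentiable (by simp)
  have hda : ∀ e, Differentiable ℝ fun y => fderiv ℝ a y e := fun e => hd (ha.fderiv_apply_const e)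
  have hdb : ∀ e, Differentiable ℝ fun y => fderiv ℝ b y e := fun e => hd (hb.fderiv_apply_const e)
  simp only [lapl, Finset.mul_sum, ← Finset.sum_add_distrib]
  refine Finset.sum_congr rfl fun j _ => ?_
  simp_rw [fderiv_mul_apply_const (hd ha) (hd hb)]
  set e : Euc d := EuclideanSpace.single j (1 : ℝ)
  rw [fderiv_fun_add (f := fun y => a y * fderiv ℝ b y e) (g := fun y => b y * fderiv ℝ a y e)
    (((hd ha).mul (hdb e)) x) (((hd hb).mul (hda e)) x), add_apply,
    fderiv_mul_apply_const (hd ha) (hdb _),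
    fderiv_mul_apply_const (hd hb) (hda _)]
  ring

lemma exists_cutoff (d : ℕ) : ∃ K ≥ 0, ∀ R : ℝ, 1 ≤ R → ∃ χ : Euc d → ℂ, ContDiff ℝ (⊤ : ℕ∞) χ ∧
    HasCompactSupport χ ∧ (∀ x, ‖χ x‖ ≤ 1) ∧ (∀ x, ‖x‖ ≤ R → χ x = 1) ∧
    (∀ j x, ‖fderiv ℝ χ x (EuclideanSpace.single j (1 : ℝ))‖ ≤ K * R⁻¹) ∧
    ∀ x, ‖lapl d χ x‖ ≤ K * R⁻¹ := by
  let f : ContDiffBump (0 : Euc d) := ⟨1, 2, by norm_num, by norm_num⟩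
  set χ₀ : Euc d → ℂ := fun x => (f x : ℂ) with hχ₀
  have hs : ContDiff ℝ (⊤ : ℕ∞) χ₀ := ofRealCLM.contDiff.comp f.contDiff
  have hc : HasCompactSupport χ₀ := f.hasCompactSupport.comp_left ofReal_zero
  have hb : ∀ {g : Euc d → ℂ}, ContDiff ℝ (⊤ : ℕ∞) g → HasCompactSupport g →
      ∃ C, ∀ x, ‖g x‖ ≤ C := fun hg hgc => hg.continuous.bounded_above_of_compact_support hgc
  choose K₁ hK₁ using fun j : Fin d => hb (hs.fderiv_apply_const (EuclideanSpace.single j (1 : ℝ)))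
    (hc.fderiv_apply_const (EuclideanSpace.single j (1 : ℝ)))
  obtain ⟨K₂, hK₂⟩ := hb (contDiff_lapl hs) (hasCompactSupport_lapl hc)
  have hK₁0 : ∀ j, 0 ≤ K₁ j := fun j => (norm_nonneg _).trans (hK₁ j 0)
  have hK₂0 : 0 ≤ K₂ := (norm_nonneg _).trans (hK₂ 0)
  refine ⟨∑ j, K₁ j + K₂, add_nonneg (Finset.sum_nonneg fun j _ => hK₁0 j) hK₂0, fun R hR => ?_⟩
  have hR0 : 0 < R := by linarith
  have hRi : 0 < R⁻¹ := inv_pos.2 hR0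
  have hRi1 : R⁻¹ ≤ 1 := inv_le_one_of_one_le₀ hR
  have hfd : ∀ (g : Euc d → ℂ) (x e : Euc d), fderiv ℝ (fun y => g (R⁻¹ • y)) x e =
      R⁻¹ * fderiv ℝ g (R⁻¹ • x) e := fun g x e => by
    rw [fderiv_comp_smul]
    simp
  have hd : ∀ {f : Euc d → ℂ}, ContDiff ℝ (⊤ : ℕ∞) f → Differentiable ℝ f := fun hf =>
    hf.differentiable (by simp)
  refine ⟨fun x => χ₀ (R⁻¹ • x), hs.comp (contDiff_const_smul _), ?_, fun x => ?_, fun x hx => ?_,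
    fun j x => ?_, fun x => ?_⟩
  · exact hc.comp_homeomorph (Homeomorph.smulOfNeZero R⁻¹ hRi.ne')
  · rw [hχ₀, norm_real, Real.norm_of_nonneg f.nonneg]
    exact f.le_one
  · have : f (R⁻¹ • x) = 1 := f.one_of_mem_closedBall (by
      rw [mem_closedBall_zero_iff, norm_smul, Real.norm_of_nonneg hRi.le, inv_mul_le_iff₀ hR0]
      simpa [f] using hx)
    simp [hχ₀, this]
  · rw [hfd, norm_mul, mul_comm, norm_real, Real.norm_of_nonneg hRi.le]
    refine mul_le_mul_of_nonneg_right ((hK₁ j _).trans ?_) hRi.le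
    have := Finset.single_le_sum (fun j _ => hK₁0 j) (Finset.mem_univ j)
    linarith
  · have h1 : lapl d (fun x => χ₀ (R⁻¹ • x)) x = (R : ℂ)⁻¹ * ((R : ℂ)⁻¹ * lapl d χ₀ (R⁻¹ • x)) := by
      simp only [lapl, Finset.mul_sum]
      refine Finset.sum_congr rfl fun j _ => ?_
      simp_rw [hfd]
      rw [fderiv_const_mul (a := fun y => fderiv ℝ χ₀ (R⁻¹ • y) (EuclideanSpace.single j (1 : ℝ)))
        ((hd ((hs.fderiv_apply_const _).comp (contDiff_const_smul R⁻¹))) x), smul_apply,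
        hfd (fun y => fderiv ℝ χ₀ y (EuclideanSpace.single j (1 : ℝ)))]
      simp
    have : ‖((R:ℂ)⁻¹)‖ = R⁻¹ := by rw [norm_inv, norm_real, Real.norm_of_nonneg hR0.le]
    rw [h1, norm_mul, norm_mul, this, mul_comm]
    refine mul_le_mul_of_nonneg_right ?_ hRi.le
    have h2 := hK₂ (R⁻¹ • x)
    have h3 : 0 ≤ ∑ j, K₁ j := Finset.sum_nonneg fun j _ => hK₁0 j
    nlinarith [norm_nonneg (lapl d χ₀ (R⁻¹ • x))]

end Cutoff

section Uniqueness

variable {d : ℕ}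

open scoped SchwartzMap

lemma MeasureTheory.MemLp.compactSupport_mul {a g : Euc d → ℂ} (hg : MemLp g 2 volume)
    (ha : Continuous a) (hc : HasCompactSupport a) : MemLp (fun x => a x * g x) 2 volume := by
  obtain ⟨C, hC⟩ := ha.bounded_above_of_compact_support hc
  refine MemLp.of_le_mul (c := C) hg (ha.aestronglyMeasurable.mul hg.1) (.of_forall fun x => ?_)
  rw [norm_mul]
  exact mul_le_mul_of_nonneg_right (hC x) (norm_nonneg _)

/-- A weak solution localised by a cutoff solves a weak equation with compactly supported data. -/
lemma weak_eq_cutoff {V : Euc d → ℝ} (hV : Continuous V) {μ : ℂ} {g : Euc d → ℂ}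
    (hg : MemLp g 2 volume)
    (h : ∀ u : Euc d → ℂ, ContDiff ℝ (⊤ : ℕ∞) u → HasCompactSupport u →
      ∫ x, conj (-(lapl d u x) + V x * u x - μ * u x) * g x = 0)
    {χ : Euc d → ℂ} (hχ : ContDiff ℝ (⊤ : ℕ∞) χ) (hc : HasCompactSupport χ) (ψ : 𝓢(Euc d, ℂ)) :
    ∑ j, ∫ x, conj (-(schwartzPartial j (schwartzPartial j ψ)) x) * (conj (χ x) * g x) =
      (∑ j, ∫ x, conj (schwartzPartial j ψ x) *
        (2 * conj (fderiv ℝ χ x (EuclideanSpace.single j (1 : ℝ))) * g x)) +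
      ∫ x, conj (ψ x) * (conj (lapl d χ x) * g x -
        (V x - conj μ) * (conj (χ x) * g x)) := by
  have hψ : ContDiff ℝ (⊤ : ℕ∞) ψ := ψ.smooth _
  have h1 := h (fun x => χ x * ψ x) (hχ.mul hψ) hc.mul_right
  have hi : ∀ (f a : Euc d → ℂ), Continuous f → Continuous a → HasCompactSupport a →
      Integrable (fun x => f x * (a x * g x)) volume := fun f a hf ha hac => by
    have h2 : Integrable (fun x => conj (conj (f x * a x)) * g x) volume := by
      refine integrable_conj_mul (f := fun x => conj (f x * a x)) ?_ hg
      exact (continuous_conj.comp (hf.mul ha)).memLp_of_hasCompactSupport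
        (hac.mul_left.comp_left (map_zero _))
    refine h2.congr (.of_forall fun x => ?_)
    simp only [conj_conj]; ring
  have hcχ : HasCompactSupport fun x => conj (χ x) := hc.comp_left (map_zero _)
  have i1 : ∀ j : Fin d, Integrable (fun x => conj (-(schwartzPartial j (schwartzPartial j ψ)) x) *
      (conj (χ x) * g x)) volume := fun j => hi _ _
        (continuous_conj.comp (schwartzPartial j (schwartzPartial j ψ)).continuous.neg)
        (continuous_conj.comp hχ.continuous) hcχ
  have i2 : ∀ j : Fin d, Integrable (fun x => conj (schwartzPartial j ψ x) *
      (2 * conj (fderiv ℝ χ x (EuclideanSpace.single j (1 : ℝ))) * g x)) volume := fun j =>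
    hi _ (fun x => 2 * conj (fderiv ℝ χ x (EuclideanSpace.single j (1 : ℝ))))
      (continuous_conj.comp (schwartzPartial j ψ).continuous)
      (continuous_const.mul (continuous_conj.comp (hχ.fderiv_apply_const _).continuous))
      ((hc.fderiv_apply_const _).comp_left (g := fun w => 2 * conj w) (by simp))
  have i3 : Integrable (fun x => conj (ψ x) * (conj (lapl d χ x) * g x -
        (V x - conj μ) * (conj (χ x) * g x))) volume := by
    refine (hi _ (fun x => conj (lapl d χ x) - (V x - conj μ) * conj (χ x))
      (continuous_conj.comp ψ.continuous) ?_ ?_).congr (.of_forall fun x => ?_)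
    · exact (continuous_conj.comp (contDiff_lapl hχ).continuous).sub
        (((continuous_ofReal.comp hV).sub continuous_const).mul
          (continuous_conj.comp hχ.continuous))
    · exact ((hasCompactSupport_lapl hc).comp_left (map_zero _)).sub hcχ.mul_left
    · simp only [Function.comp_apply]; ring
  have i12 := integrable_finsetSum Finset.univ fun j _ => i1 j
  have i22 := integrable_finsetSum Finset.univ fun j _ => i2 j
  rw [← integral_finsetSum _ fun j _ => i1 j, ← integral_finsetSum _ fun j _ => i2 j,
    ← integral_add i22 i3, ← sub_eq_zero]
  have i4 : Integrable (fun x => (∑ j, conj (schwartzPartial j ψ x) *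
      (2 * conj (fderiv ℝ χ x (EuclideanSpace.single j (1 : ℝ))) * g x)) +
        conj (ψ x) * (conj (lapl d χ x) * g x - (V x - conj μ) * (conj (χ x) * g x))) volume :=
    i22.add i3
  rw [← integral_sub i12 i4, ← h1]
  refine integral_congr_ae (.of_forall fun x => ?_)
  have e1 : lapl d ψ x = ∑ j, schwartzPartial j (schwartzPartial j ψ) x := rfl
  have e2 : ∀ j, fderiv ℝ ψ x (EuclideanSpace.single j (1 : ℝ)) = schwartzPartial j ψ x :=
    fun j => rfl
  simp only [lapl_mul hχ hψ, e1, e2, map_add, map_sub, map_neg, map_mul, map_sum, conj_ofReal,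
    map_ofNat, neg_mul, Finset.sum_neg_distrib]
  have s1 : ∑ j, conj (schwartzPartial j (schwartzPartial j ψ) x) * (conj (χ x) * g x) =
      (∑ j, conj (schwartzPartial j (schwartzPartial j ψ) x)) * (conj (χ x) * g x) := by
    rw [Finset.sum_mul]
  have s2 : ∑ j, conj (schwartzPartial j ψ x) *
      (2 * conj (fderiv ℝ χ x (EuclideanSpace.single j (1 : ℝ))) * g x) =
      2 * (∑ j, conj (fderiv ℝ χ x (EuclideanSpace.single j (1 : ℝ))) *
        conj (schwartzPartial j ψ x)) * g x := by
    rw [Finset.mul_sum, Finset.sum_mul]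
    exact Finset.sum_congr rfl fun j _ => by ring
  rw [s1, s2]
  ring

lemma le_of_sq_le_mul_add_sq {E N a b : ℝ} (hE : 0 ≤ E) (hN : 0 ≤ N) (ha : 0 ≤ a) (hb : 0 ≤ b)
    (h : E ^ 2 ≤ a * (E * N) + b * N ^ 2) : E ≤ (a + b + 1) * N := by
  by_contra! hlt
  have h1 : N ≤ E := by nlinarith [mul_nonneg ha hN, mul_nonneg hb hN]
  have h2 : b * N ^ 2 ≤ b * (E * N) := by
    rw [sq]; gcongr
  have h3 : E * ((a + b + 1) * N) ≤ E * E := mul_le_mul_of_nonneg_left hlt.le hE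
  have h4 : 0 < E := lt_of_le_of_lt (by positivity) hlt
  have h5 : E * ((a + b + 1) * N) < E * E := mul_lt_mul_of_pos_left hlt h4
  nlinarith [mul_nonneg hE hN]

lemma eq_zero_of_weak_eq {V : Euc d → ℝ} (hV : Continuous V) {m : ℝ} (hm : ∀ x, 0 ≤ V x + m)
    {μ : ℂ} (hμ : μ.im ≠ 0) {g : Euc d → ℂ} (hg : MemLp g 2 volume)
    (h : ∀ u : Euc d → ℂ, ContDiff ℝ (⊤ : ℕ∞) u → HasCompactSupport u →
      ∫ x, conj (-(lapl d u x) + V x * u x - μ * u x) * g x = 0) :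
    lpNorm g 2 volume = 0 := by
  obtain ⟨K, hK, hcut⟩ := exists_cutoff d
  set N := lpNorm g 2 volume with hN
  have hN0 : 0 ≤ N := lpNorm_nonneg
  set A : ℝ := 2 * d * K + (K + |m| + ‖μ‖) + 1 with hA
  have hbound : ∀ R : ℝ, 1 ≤ R → ∃ χ : Euc d → ℂ, Continuous χ ∧ (∀ x, ‖χ x‖ ≤ 1) ∧
      (∀ x, ‖x‖ ≤ R → χ x = 1) ∧
      |μ.im| * ∫ x, ‖conj (χ x) * g x‖ ^ 2 ≤ R⁻¹ * (K * (2 * d * A + 1) * N ^ 2) := by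
    intro R hR
    obtain ⟨χ, hχ, hc, h1, hR1, hD, hL⟩ := hcut R hR
    refine ⟨χ, hχ.continuous, h1, hR1, ?_⟩
    have hRi : R⁻¹ ≤ 1 := inv_le_one_of_one_le₀ hR
    have hRi0 : 0 ≤ R⁻¹ := by positivity
    set ε := K * R⁻¹ with hε
    have hε0 : 0 ≤ ε := by positivity
    have hεK : ε ≤ K := by nlinarith
    set G : Euc d → ℂ := fun x => conj (χ x) * g x with hG
    set B : Fin d → Euc d → ℂ := fun j x =>
      2 * conj (fderiv ℝ χ x (EuclideanSpace.single j (1 : ℝ))) * g x with hB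
    set F₁ : Euc d → ℂ := fun x => conj (lapl d χ x) * g x with hF₁
    have hcχ : HasCompactSupport fun x => conj (χ x) := hc.comp_left (map_zero _)
    have mG : MemLp G 2 volume := hg.compactSupport_mul (continuous_conj.comp hχ.continuous) hcχ
    have mB : ∀ j, MemLp (B j) 2 volume ∧ lpNorm (B j) 2 volume ≤ (2 * ε) * N := fun j => by
      have hcc : Continuous fun x => 2 * conj (fderiv ℝ χ x (EuclideanSpace.single j (1 : ℝ))) :=
        continuous_const.mul (continuous_conj.comp (hχ.fderiv_apply_const _).continuous)
      refine lpNorm_le_mul_of_norm_le (hcc.aestronglyMeasurable.mul hg.1) hg (by positivity)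
        fun x => ?_
      simp only [Pi.mul_apply, norm_mul, RCLike.norm_conj, RCLike.norm_ofNat]
      gcongr
      exact hD j x
    have mF₁ : MemLp F₁ 2 volume ∧ lpNorm F₁ 2 volume ≤ ε * N := by
      refine lpNorm_le_mul_of_norm_le ((continuous_conj.comp
        (contDiff_lapl hχ).continuous).aestronglyMeasurable.mul hg.1) hg hε0 fun x => ?_
      simp only [Pi.mul_apply, Function.comp_apply, norm_mul, RCLike.norm_conj]
      gcongr
      exact hL x
    have mGN : lpNorm G 2 volume ≤ 1 * N := by
      refine (lpNorm_le_mul_of_norm_le mG.1 hg zero_le_one fun x => ?_).2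
      rw [hG, norm_mul, RCLike.norm_conj]
      gcongr
      exact h1 x
    have mVG : MemLp (fun x => (V x : ℂ) * G x) 2 volume := by
      have := hg.compactSupport_mul ((continuous_ofReal.comp hV).mul
        (continuous_conj.comp hχ.continuous)) hcχ.mul_left
      refine this.ae_eq (.of_forall fun x => ?_)
      simp only [hG, Pi.mul_apply, Function.comp_apply]; ring
    have mF : MemLp (fun x => F₁ x - (V x - conj μ) * G x) 2 volume := by
      refine ((mF₁.1.sub mVG).add (mG.const_mul (conj μ))).ae_eq (.of_forall fun x => ?_)
      simp only [Pi.add_apply, Pi.sub_apply]; ring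
    obtain ⟨E, hE, s, hs, hEs⟩ := exists_energy_identity mG mF (fun j => (mB j).1)
      (weak_eq_cutoff hV hg h hχ hc)
    set Q := ∫ x, ‖G x‖ ^ 2 with hQ
    set P := ∫ x, V x * ‖G x‖ ^ 2 with hP
    set Z := ∫ x, conj (G x) * F₁ x with hZ
    have iG := integrable_norm_sq mG
    have iVG : Integrable (fun x => V x * ‖G x‖ ^ 2) volume := by
      have := (integrable_conj_mul mG mVG).re
      refine this.congr (.of_forall fun x => ?_)
      have e : conj (G x) * ((V x : ℂ) * G x) = ((V x * ‖G x‖ ^ 2 : ℝ) : ℂ) := by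
        push_cast
        rw [← Complex.conj_mul']; ring
      simp only [e]
      exact ofReal_re _
    have hsplit : ∫ x, conj (G x) * (F₁ x - (V x - conj μ) * G x) =
        Z - (P : ℂ) + conj μ * (Q : ℂ) := by
      have i1 := integrable_conj_mul mG mF₁.1
      have i2 : Integrable (fun x => ((V x * ‖G x‖ ^ 2 : ℝ) : ℂ)) volume := iVG.ofReal
      have i3 : Integrable (fun x => conj μ * ((‖G x‖ ^ 2 : ℝ) : ℂ)) volume :=
        (iG.ofReal (𝕜 := ℂ)).const_mul _
      have i12 : Integrable (fun x => conj (G x) * F₁ x - ((V x * ‖G x‖ ^ 2 : ℝ) : ℂ)) volume :=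
        i1.sub i2
      rw [hP, hQ, ← integral_complex_ofReal, ← integral_complex_ofReal, hZ,
        ← integral_const_mul, ← integral_sub i1 i2, ← integral_add i12 i3]
      refine integral_congr_ae (.of_forall fun x => ?_)
      simp only
      push_cast
      rw [← Complex.conj_mul']
      ring
    rw [hsplit] at hEs
    have hZn : ‖Z‖ ≤ ε * N ^ 2 := by
      refine (norm_integral_conj_mul_le mG mF₁.1).trans ?_
      nlinarith [mF₁.2, lpNorm_nonneg (f := G) (p := 2) (μ := (volume : Measure (Euc d))),
        lpNorm_nonneg (f := F₁) (p := 2) (μ := (volume : Measure (Euc d)))]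
    have hQN : Q ≤ N ^ 2 := by
      rw [hQ, ← lpNorm_two_sq mG]
      exact pow_le_pow_left₀ lpNorm_nonneg (by linarith) 2
    have hQ0 : 0 ≤ Q := integral_nonneg fun x => sq_nonneg _
    have hPm : -(|m| * N ^ 2) ≤ P := by
      have h2 : 0 ≤ ∫ x, (V x * ‖G x‖ ^ 2 + m * ‖G x‖ ^ 2) := integral_nonneg fun x => by
        have := mul_nonneg (hm x) (sq_nonneg ‖G x‖)
        simp only [Pi.zero_apply]; linarith
      rw [integral_add iVG (iG.const_mul m), integral_const_mul] at h2
      have h3 : m * Q ≤ |m| * N ^ 2 :=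
        (mul_le_mul_of_nonneg_right (le_abs_self m) hQ0).trans
          (mul_le_mul_of_nonneg_left hQN (abs_nonneg m))
      linarith
    have hsum : ∑ j, lpNorm (B j) 2 volume ≤ d * ((2 * ε) * N) := by
      refine (Finset.sum_le_sum fun j _ => (mB j).2).trans ?_
      simp
    have hsE : ‖s‖ ≤ E * (d * ((2 * ε) * N)) := hs.trans (mul_le_mul_of_nonneg_left hsum hE)
    have hre := congrArg Complex.re hEs
    have him := congrArg Complex.im hEs
    simp only [ofReal_re, ofReal_im, add_re, add_im, sub_re, sub_im, mul_re, mul_im, conj_re,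
      conj_im] at hre him
    have hsre := abs_re_le_norm s
    have hsim := abs_im_le_norm s
    have hZre := abs_re_le_norm Z
    have hZim := abs_im_le_norm Z
    have hμre := abs_re_le_norm μ
    have hdK : (0 : ℝ) ≤ d * K := by positivity
    have hA1 : 0 ≤ K + |m| + ‖μ‖ := by positivity
    have hEA : E ≤ A * N := by
      have h2 : E ^ 2 ≤ (2 * d * K) * (E * N) + (K + |m| + ‖μ‖) * N ^ 2 := by
        have e1 : E * (d * ((2 * ε) * N)) ≤ (2 * d * K) * (E * N) := by
          have : E * (d * ((2 * ε) * N)) = (2 * d * ε) * (E * N) := by ring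
          rw [this]
          gcongr
        have e2 : μ.re * Q ≤ ‖μ‖ * N ^ 2 :=
          (mul_le_mul_of_nonneg_right ((le_abs_self _).trans hμre) hQ0).trans
            (mul_le_mul_of_nonneg_left hQN (norm_nonneg _))
        have e3 : ε * N ^ 2 ≤ K * N ^ 2 := by gcongr
        have := le_abs_self s.re
        have := le_abs_self Z.re
        have := le_abs_self P
        linarith
      exact le_of_sq_le_mul_add_sq hE hN0 (by positivity) hA1 h2
    have hfin : |μ.im| * Q ≤ ‖s‖ + ‖Z‖ := by
      have : |μ.im| * Q = |s.im + Z.im| := by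
        have : s.im + Z.im = μ.im * Q := by linarith
        rw [this, abs_mul, abs_of_nonneg hQ0]
      rw [this]
      exact (abs_add_le _ _).trans (add_le_add hsim hZim)
    calc |μ.im| * Q ≤ E * (d * ((2 * ε) * N)) + ε * N ^ 2 := hfin.trans (add_le_add hsE hZn)
      _ ≤ (A * N) * (d * ((2 * ε) * N)) + ε * N ^ 2 := by gcongr
      _ = R⁻¹ * (K * (2 * d * A + 1) * N ^ 2) := by rw [hε]; ring
  choose χ hχc hχ1 hχR hχb using fun n : ℕ => hbound (n + 1) (by linarith [n.cast_nonneg (α := ℝ)])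
  have hlim : Filter.Tendsto (fun n => ∫ x, ‖conj (χ n x) * g x‖ ^ 2) Filter.atTop
      (nhds (∫ x, ‖g x‖ ^ 2)) := by
    refine tendsto_integral_of_dominated_convergence (fun x => ‖g x‖ ^ 2) (fun n => ?_)
      (integrable_norm_sq hg) (fun n => .of_forall fun x => ?_) (.of_forall fun x => ?_)
    · exact (((continuous_conj.comp (hχc n)).aestronglyMeasurable.mul hg.1).norm.pow 2)
    · rw [norm_pow, norm_norm, norm_mul, RCLike.norm_conj]
      have := mul_le_mul_of_nonneg_right (hχ1 n x) (norm_nonneg (g x))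
      exact pow_le_pow_left₀ (by positivity) (by linarith) 2
    · refine tendsto_const_nhds.congr' ?_
      obtain ⟨n, hn⟩ := exists_nat_ge ‖x‖
      filter_upwards [Filter.eventually_ge_atTop n] with k hk
      have : (n : ℝ) ≤ k := Nat.cast_le.2 hk
      rw [hχR k x (by linarith)]
      simp
  have hlim2 : Filter.Tendsto (fun n : ℕ => ((n : ℝ) + 1)⁻¹ * (K * (2 * d * A + 1) * N ^ 2))
      Filter.atTop (nhds (0 * (K * (2 * d * A + 1) * N ^ 2))) := by
    refine Filter.Tendsto.mul_const _ ?_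
    simpa only [one_div] using tendsto_one_div_add_atTop_nhds_zero_nat (𝕜 := ℝ)
  have hle := le_of_tendsto_of_tendsto' (hlim.const_mul |μ.im|) hlim2 hχb
  rw [← lpNorm_two_sq hg, zero_mul] at hle
  have hμ0 : 0 < |μ.im| := abs_pos.2 hμ
  have : N ^ 2 ≤ 0 := nonpos_of_mul_nonpos_right hle hμ0
  exact pow_eq_zero_iff (two_ne_zero) |>.1 (le_antisymm this (sq_nonneg N))

end Uniqueness

section Density

variable {d : ℕ}

lemma lapl_add {a b : Euc d → ℂ} (ha : ContDiff ℝ (⊤ : ℕ∞) a) (hb : ContDiff ℝ (⊤ : ℕ∞) b)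
    (x : Euc d) : lapl d (fun y => a y + b y) x = lapl d a x + lapl d b x := by
  have hd : ∀ {f : Euc d → ℂ}, ContDiff ℝ (⊤ : ℕ∞) f → Differentiable ℝ f := fun hf =>
    hf.differentiable (by simp)
  simp only [lapl, ← Finset.sum_add_distrib]
  refine Finset.sum_congr rfl fun j _ => ?_
  set e : Euc d := EuclideanSpace.single j (1 : ℝ)
  have h1 : ∀ y, fderiv ℝ (fun y => a y + b y) y e = fderiv ℝ a y e + fderiv ℝ b y e := fun y => by
    rw [fderiv_fun_add (hd ha y) (hd hb y), add_apply]
  simp_rw [h1]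
  rw [fderiv_fun_add (hd (ha.fderiv_apply_const e) x) (hd (hb.fderiv_apply_const e) x), add_apply]

lemma lapl_const_mul (c : ℂ) {b : Euc d → ℂ} (hb : ContDiff ℝ (⊤ : ℕ∞) b) (x : Euc d) :
    lapl d (fun y => c * b y) x = c * lapl d b x := by
  rw [lapl_mul contDiff_const hb]
  simp [lapl]

lemma memLp_neg_lapl_add {V : Euc d → ℝ} (hV : Continuous V) (μ : ℂ) {u : Euc d → ℂ}
    (hu : ContDiff ℝ (⊤ : ℕ∞) u) (hc : HasCompactSupport u) :
    MemLp (fun x => -(lapl d u x) + V x * u x - μ * u x) 2 (volume : Measure (Euc d)) := by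
  have m1 : MemLp (lapl d u) 2 volume :=
    (contDiff_lapl hu).continuous.memLp_of_hasCompactSupport (hasCompactSupport_lapl hc)
  have m2 : MemLp (fun x => (V x : ℂ) * u x) 2 volume :=
    ((continuous_ofReal.comp hV).mul hu.continuous).memLp_of_hasCompactSupport hc.mul_left
  exact (m1.neg.add m2).sub ((hu.continuous.memLp_of_hasCompactSupport hc).const_mul μ)

/-- The range of `-Δ + V - μ` on smooth compactly supported functions. -/
def schrodingerRange (d : ℕ) (V : Euc d → ℝ) (μ : ℂ) : Submodule ℂ (L2 d) where
  carrier := {f | ∃ u : Euc d → ℂ, ContDiff ℝ (⊤ : ℕ∞) u ∧ HasCompactSupport u ∧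
    f =ᵐ[volume] fun x => -(lapl d u x) + V x * u x - μ * u x}
  add_mem' := by
    rintro f g ⟨u, hu, huc, hf⟩ ⟨v, hv, hvc, hg⟩
    refine ⟨fun x => u x + v x, hu.add hv, huc.add hvc, ?_⟩
    filter_upwards [hf, hg, Lp.coeFn_add f g] with x h1 h2 h3
    rw [h3, Pi.add_apply, h1, h2, lapl_add hu hv]
    ring
  zero_mem' := by
    refine ⟨fun _ => 0, contDiff_const, HasCompactSupport.zero, ?_⟩
    filter_upwards [Lp.coeFn_zero ℂ 2 (volume : Measure (Euc d))] with x h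
    rw [h]
    simp [lapl]
  smul_mem' := by
    rintro c f ⟨u, hu, huc, hf⟩
    refine ⟨fun x => c * u x, contDiff_const.mul hu, huc.mul_left, ?_⟩
    filter_upwards [hf, Lp.coeFn_smul c f] with x h1 h2
    rw [h2, Pi.smul_apply, h1, lapl_const_mul c hu, smul_eq_mul]
    ring

lemma topologicalClosure_schrodingerRange {V : Euc d → ℝ} (hV : Continuous V) {m : ℝ}
    (hm : ∀ x, 0 ≤ V x + m) {μ : ℂ} (hμ : μ.im ≠ 0) :
    (schrodingerRange d V μ).topologicalClosure = ⊤ := by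
  rw [Submodule.topologicalClosure_eq_top_iff, Submodule.eq_bot_iff]
  intro g hg
  rw [← norm_eq_zero, ← lpNorm_coeFn]
  refine eq_zero_of_weak_eq hV hm hμ (Lp.memLp g) fun u hu hc => ?_
  have hf := memLp_neg_lapl_add hV μ hu hc
  have h1 := (Submodule.mem_orthogonal _ _).1 hg (hf.toLp _) ⟨u, hu, hc, hf.coeFn_toLp⟩
  have h2 := inner_toLp_toLp hf (Lp.memLp g)
  rw [Lp.toLp_coeFn, h1] at h2
  exact h2.symm

lemma opNorm_le_of_schrodingerRange {E : Type*} [NormedAddCommGroup E] [NormedSpace ℂ E]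
    {V : Euc d → ℝ} (hV : Continuous V) {m : ℝ}
    (hm : ∀ x, 0 ≤ V x + m) {μ : ℂ} (hμ : μ.im ≠ 0) {T : L2 d →L[ℂ] E} {C : ℝ} (hC : 0 ≤ C)
    (h : ∀ u : Euc d → ℂ, ContDiff ℝ (⊤ : ℕ∞) u → HasCompactSupport u →
      ∀ hf : MemLp (fun x => -(lapl d u x) + V x * u x - μ * u x) 2 (volume : Measure (Euc d)),
      ‖T (hf.toLp _)‖ ≤ C * ‖hf.toLp _‖) : ‖T‖ ≤ C := by
  refine T.opNorm_le_bound hC fun f => ?_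
  have hcl : IsClosed {f : L2 d | ‖T f‖ ≤ C * ‖f‖} :=
    isClosed_le (by fun_prop) (by fun_prop)
  have hsub : ((schrodingerRange d V μ : Submodule ℂ (L2 d)) : Set (L2 d)) ⊆
      {f : L2 d | ‖T f‖ ≤ C * ‖f‖} := by
    rintro f ⟨u, hu, hc, hfu⟩
    have hf := memLp_neg_lapl_add hV μ hu hc
    have e : f = hf.toLp _ := Lp.ext (hfu.trans hf.coeFn_toLp.symm)
    rw [Set.mem_ofPred_eq, e]
    exact h u hu hc hf
  have : f ∈ (schrodingerRange d V μ).topologicalClosure := by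
    rw [topologicalClosure_schrodingerRange hV hm hμ]; trivial
  exact closure_minimal hsub hcl this

end Density

section Parseval

local instance unitAddCircleMeasureSpace : MeasureSpace UnitAddCircle := ⟨AddCircle.haarAddCircle⟩

/-- The half-open unit cube centred at the origin. -/
def unitBox (d : ℕ) : Set (Euc d) := {x | ∀ i, x i ∈ Set.Ioc (-(1 / 2) : ℝ) (1 / 2)}

/-- The character `x ↦ exp (2πi z·x)`. -/
def latChar (d : ℕ) (z : Zd d) (x : Euc d) : ℂ :=
  cexp (2 * π * I * ∑ j, (z j : ℂ) * (x j : ℂ))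

lemma measurableSet_unitBox (d : ℕ) : MeasurableSet (unitBox d) := by
  have : unitBox d = ⋂ i, (fun x : Euc d => x i) ⁻¹' Set.Ioc (-(1 / 2) : ℝ) (1 / 2) := by
    ext x; simp [unitBox]
  rw [this]
  exact MeasurableSet.iInter fun i => (by fun_prop : Measurable fun x : Euc d => x i)
    measurableSet_Ioc

lemma exists_torus_to_unitBox (d : ℕ) :
    ∃ E : UnitAddTorus (Fin d) → Euc d, MeasurableEmbedding E ∧
      MeasurePreserving E volume (volume.restrict (unitBox d)) ∧
      ∀ t i, (((E t) i : ℝ) : UnitAddCircle) = t i := by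
  let a : Fin d → ℝ := fun _ => -(1 / 2)
  have h1 := UnitAddTorus.measurePreserving_equivPiIoc a
  have hs : MeasurableSet {x : Fin d → ℝ | ∀ i, x i ∈ Set.Ioc (a i) (a i + 1)} :=
    MeasurableSet.univ_pi' fun i => measurableSet_Ioc
  have h2 : MeasurePreserving _ _ _ :=
    measurePreserving_subtype_coe (μa := (volume : Measure (Fin d → ℝ))) hs
  have h3 := PiLp.volume_preserving_toLp (Fin d)
  have h4 := h3.restrict_preimage (measurableSet_unitBox d)
  have e : (WithLp.toLp 2 : (Fin d → ℝ) → Euc d) ⁻¹' unitBox d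
      = {x : Fin d → ℝ | ∀ i, x i ∈ Set.Ioc (a i) (a i + 1)} := by
    ext x
    have : (-(1/2) + 1 : ℝ) = 1 / 2 := by norm_num
    simp only [unitBox, a, Set.mem_preimage, Set.mem_ofPred_eq, this]
  rw [e] at h4
  refine ⟨_, ?_, h4.comp (h2.comp h1), ?_⟩
  · exact (MeasurableEquiv.toLp 2 (Fin d → ℝ)).measurableEmbedding.comp
      ((MeasurableEmbedding.subtype_coe hs).comp
        (UnitAddTorus.measurableEquivPiIoc a).measurableEmbedding)
  · intro t i
    simp

/-- **Parseval's identity** on the unit cube. -/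
lemma hasSum_sq_integral_unitBox {d : ℕ} {g : Euc d → ℂ}
    (hg : MemLp g 2 (volume.restrict (unitBox d))) :
    HasSum (fun z : Zd d => ‖∫ x in unitBox d, latChar d z x * g x‖ ^ 2)
      (∫ x in unitBox d, ‖g x‖ ^ 2) := by
  obtain ⟨E, hE1, hE2, hE3⟩ := exists_torus_to_unitBox d
  have hG : MemLp (g ∘ E) 2 volume := hg.comp_measurePreserving hE2
  have h := UnitAddTorus.hasSum_sq_mFourierCoeff (hG.toLp (g ∘ E))
  have hl : ∫ t, ‖(hG.toLp (g ∘ E)) t‖ ^ 2 = ∫ x in unitBox d, ‖g x‖ ^ 2 := by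
    rw [← hE2.integral_comp hE1 (fun x => ‖g x‖ ^ 2)]
    apply integral_congr_ae
    filter_upwards [hG.coeFn_toLp] with t ht
    rw [ht, Function.comp_apply]
  have hc (z : Zd d) : UnitAddTorus.mFourierCoeff (hG.toLp (g ∘ E)) (-z)
      = ∫ x in unitBox d, latChar d z x * g x := by
    rw [← hE2.integral_comp hE1 (fun x => latChar d z x * g x)]
    apply integral_congr_ae
    filter_upwards [hG.coeFn_toLp] with t ht
    rw [ht, Function.comp_apply, smul_eq_mul, neg_neg]
    congr 1
    simp only [UnitAddTorus.mFourier, ContinuousMap.coe_mk, latChar]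
    rw [Finset.mul_sum, Complex.exp_sum]
    refine Finset.prod_congr rfl fun i _ => ?_
    rw [← hE3 t i, fourier_coe_apply]
    congr 1
    simp
    ring
  have h' := (Equiv.neg (Zd d)).hasSum_iff.mpr h
  refine (hl ▸ h').congr_fun fun z => ?_
  simp only [Function.comp_apply, Equiv.neg_apply, hc]

end Parseval

@[simp] lemma latVec_apply (d : ℕ) (n : Zd d) (j : Fin d) : latVec d n j = n j := rfl

@[simp] lemma latPt_apply (d : ℕ) (h : ℝ) (n : Zd d) (j : Fin d) : latPt d h n j = h * n j := rfl

/-- Translates of the unit cube by lattice vectors. -/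
def shiftBox (d : ℕ) (n : Zd d) : Set (Euc d) := (fun x => x - latVec d n) ⁻¹' unitBox d

/-- The lattice points with all coordinates in `{-1, 0, 1}`. -/
def nearLat (d : ℕ) : Finset (Zd d) := Fintype.piFinset fun _ => Finset.Icc (-1) 1

lemma measurableSet_shiftBox (d : ℕ) (n : Zd d) : MeasurableSet (shiftBox d n) :=
  (by fun_prop : Measurable fun x : Euc d => x - latVec d n) (measurableSet_unitBox d)

lemma pairwise_disjoint_shiftBox (d : ℕ) : Pairwise (Function.onFun Disjoint (shiftBox d)) := by
  intro n m hnm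
  refine Set.disjoint_left.mpr fun x hx hy => hnm (funext fun j => ?_)
  have h1 := hx j
  have h2 := hy j
  simp only [PiLp.sub_apply, latVec_apply, Set.mem_Ioc] at h1 h2
  have a1 : (n j : ℝ) < m j + 1 := by linarith
  have a2 : (m j : ℝ) < n j + 1 := by linarith
  norm_cast at a1 a2
  omega

lemma setIntegral_shiftBox {d : ℕ} {E : Type*} [NormedAddCommGroup E] [NormedSpace ℝ E]
    (f : Euc d → E) (n : Zd d) :
    ∫ x in shiftBox d n, f x = ∫ x in unitBox d, f (x + latVec d n) := by
  have h := (measurePreserving_add_right (volume : Measure (Euc d)) (latVec d n)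
    ).setIntegral_preimage_emb (MeasurableEquiv.addRight (latVec d n)).measurableEmbedding f
      (shiftBox d n)
  rw [← h]
  congr 2
  ext x
  simp [shiftBox]

lemma integral_unitBox_sum {d : ℕ} {E : Type*} [NormedAddCommGroup E] [NormedSpace ℝ E]
    {f : Euc d → E} (hf : Integrable f) (S : Finset (Zd d)) :
    ∫ x in unitBox d, ∑ n ∈ S, f (x + latVec d n) = ∫ x in ⋃ n ∈ S, shiftBox d n, f x := by
  rw [integral_biUnion_finset S (fun n _ => measurableSet_shiftBox d n)
    (fun n _ m _ h => pairwise_disjoint_shiftBox d h) (fun n _ => hf.integrableOn),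
    integral_finsetSum S fun n _ => (hf.comp_add_right (latVec d n)).integrableOn]
  exact Finset.sum_congr rfl fun n _ => (setIntegral_shiftBox f n).symm

lemma mem_biUnion_shiftBox {d : ℕ} {x : Euc d} (hx : ∀ j, |x j| ≤ 1) :
    x ∈ ⋃ n ∈ nearLat d, shiftBox d n := by
  have (j : Fin d) : ∃ k : ℤ, k ∈ Finset.Icc (-1 : ℤ) 1 ∧
      x j - k ∈ Set.Ioc (-(1 / 2) : ℝ) (1 / 2) := by
    have h := abs_le.mp (hx j)
    rcases le_or_gt (x j) (-(1/2)) with h1 | h1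
    · exact ⟨-1, by simp, by push_cast; constructor <;> linarith⟩
    rcases le_or_gt (x j) (1/2) with h2 | h2
    · exact ⟨0, by simp, by push_cast; constructor <;> linarith⟩
    · exact ⟨1, by simp, by push_cast; constructor <;> linarith⟩
  choose k hk1 hk2 using this
  simp only [Set.mem_iUnion]
  exact ⟨k, Fintype.mem_piFinset.mpr hk1, hk2⟩

lemma integral_eq_unitBox_sum {d : ℕ} {E : Type*} [NormedAddCommGroup E] [NormedSpace ℝ E]
    {f : Euc d → E} (hf : Integrable f) (hs : ∀ x, f x ≠ 0 → ∀ j, |x j| ≤ 1) :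
    ∫ x, f x = ∫ x in unitBox d, ∑ n ∈ nearLat d, f (x + latVec d n) := by
  rw [integral_unitBox_sum hf, setIntegral_eq_integral_of_forall_compl_eq_zero]
  intro x hx
  by_contra h
  exact hx (mem_biUnion_shiftBox (hs x h))

lemma latChar_add_latVec (d : ℕ) (z n : Zd d) (x : Euc d) :
    latChar d z (x + latVec d n) = latChar d z x := by
  simp only [latChar]
  rw [Complex.exp_eq_exp_iff_exists_int]
  refine ⟨∑ j, z j * n j, ?_⟩
  simp only [PiLp.add_apply, latVec_apply]
  push_cast
  simp only [mul_add, Finset.sum_add_distrib]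
  ring

lemma norm_latChar (d : ℕ) (z : Zd d) (x : Euc d) : ‖latChar d z x‖ = 1 := by
  have : 2 * π * I * ∑ j, (z j : ℂ) * (x j : ℂ) = ((2 * π * ∑ j, z j * x j : ℝ) : ℂ) * I := by
    push_cast; ring
  rw [latChar, this, Complex.norm_exp_ofReal_mul_I]

lemma continuous_latChar (d : ℕ) (z : Zd d) : Continuous (latChar d z) := by
  unfold latChar; fun_prop

/-- Parseval's identity for samples of the Fourier transform of a function supported in the cube
`[-1,1]^d`. -/
lemma hasSum_sq_integral_latChar {d : ℕ} {f : Euc d → ℂ} (hf : Integrable f) (hf2 : MemLp f 2)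
    (hs : ∀ x, f x ≠ 0 → ∀ j, |x j| ≤ 1) :
    HasSum (fun z : Zd d => ‖∫ x, latChar d z x * f x‖ ^ 2)
      (∫ x in unitBox d, ‖∑ n ∈ nearLat d, f (x + latVec d n)‖ ^ 2) := by
  have hg : MemLp (fun x => ∑ n ∈ nearLat d, f (x + latVec d n)) 2
      (volume.restrict (unitBox d)) :=
    memLp_finsetSum _ fun n _ =>
      (hf2.comp_measurePreserving (measurePreserving_add_right volume (latVec d n))).restrict _
  refine (hasSum_sq_integral_unitBox hg).congr_fun fun z => ?_
  rw [integral_eq_unitBox_sum]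
  · simp only [latChar_add_latVec, Finset.mul_sum]
  · exact hf.bdd_mul (c := 1) (continuous_latChar d z).aestronglyMeasurable
      (.of_forall fun x => (norm_latChar d z x).le)
  · intro x hx
    exact hs x (right_ne_zero_of_mul hx)

section Projection

variable {d : ℕ}

open scoped SchwartzMap

/-- The samples `h^{-d} ∫ conj φ(h⁻¹(x - hz)) u(x) dx` of a function `u`. -/
def projFun (φ : 𝓢(Euc d, ℂ)) (h : ℝ) (u : Euc d → ℂ) (z : Zd d) : ℂ :=
  (h ^ d : ℂ)⁻¹ * ∫ x, conj (φ (h⁻¹ • (x - latPt d h z))) * u x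

lemma exists_schwartz_scaled (φ : 𝓢(Euc d, ℂ)) {h : ℝ} (hh : 0 < h) (y : Euc d) :
    ∃ ψ : 𝓢(Euc d, ℂ), ∀ x, ψ x = φ (h⁻¹ • (x - y)) :=
  ⟨(SchwartzMap.compCLMOfContinuousLinearEquiv ℂ (ContinuousLinearEquiv.smulLeft
    (Units.mk0 h⁻¹ (inv_ne_zero hh.ne'))) φ).compSubConstCLM ℂ y, fun _ => rfl⟩

lemma fourier_scaled (φ ψ : 𝓢(Euc d, ℂ)) {h : ℝ} (hh : 0 < h) (z : Zd d)
    (hψ : ∀ x, ψ x = φ (h⁻¹ • (x - latPt d h z))) (ξ : Euc d) :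
    𝓕 ψ ξ = h ^ d * conj (latChar d z (h • ξ)) * 𝓕 φ (h • ξ) := by
  have e (χ : 𝓢(Euc d, ℂ)) (η : Euc d) : 𝓕 χ η = ∫ v, cexp (↑(-2 * π * ⟪v, η⟫_ℝ) * I) * χ v := by
    rw [SchwartzMap.fourier_coe, Real.fourier_eq']; rfl
  rw [e, e]
  have h1 := integral_sub_right_eq_self (μ := (volume : Measure (Euc d)))
    (fun x => cexp (↑(-2 * π * ⟪x + latPt d h z, ξ⟫_ℝ) * I) * φ (h⁻¹ • x)) (latPt d h z)
  have h2 := Measure.integral_comp_inv_smul_of_nonneg (volume : Measure (Euc d))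
    (fun x => cexp (↑(-2 * π * ⟪h • x + latPt d h z, ξ⟫_ℝ) * I) * φ x) hh.le
  simp only [sub_add_cancel, ← hψ] at h1
  simp only [smul_inv_smul₀ hh.ne'] at h2
  rw [h1, h2, mul_assoc, ← integral_const_mul]
  simp only [finrank_euclideanSpace, Fintype.card_fin, Complex.real_smul, Complex.ofReal_pow]
  congr 1
  refine integral_congr_ae (.of_forall fun x => ?_)
  simp only [← mul_assoc]
  congr 1
  rw [latChar, ← Complex.exp_conj, ← Complex.exp_add]
  congr 1
  have e2 : ⟪latPt d h z, ξ⟫_ℝ = h * ∑ j, z j * ξ j := by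
    rw [PiLp.inner_apply, Finset.mul_sum]
    refine Finset.sum_congr rfl fun j _ => ?_
    rw [latPt_apply, RCLike.inner_apply]
    simp; ring
  have e3 : ∑ j, (z j : ℂ) * (((h • ξ) j : ℝ) : ℂ) = ((h * ∑ j, z j * ξ j : ℝ) : ℂ) := by
    push_cast
    rw [Finset.mul_sum]
    refine Finset.sum_congr rfl fun j _ => ?_
    simp; ring
  rw [inner_add_left, inner_smul_left, inner_smul_right, e2, e3]
  simp only [map_mul, Complex.conj_I, Complex.conj_ofReal, map_ofNat]
  simp
  ring

lemma MemLp.comp_inv_smul {f : Euc d → ℂ} (hf : MemLp f 2 volume) {h : ℝ} (hh : 0 < h) :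
    MemLp (fun x => f (h⁻¹ • x)) 2 volume := by
  have h1 := Measure.map_addHaar_smul (volume : Measure (Euc d)) (inv_ne_zero hh.ne')
  have h2 : MemLp f 2 (Measure.map (fun x : Euc d => h⁻¹ • x) volume) := by
    have := hf.smul_measure (c := ENNReal.ofReal |((h⁻¹) ^ Module.finrank ℝ (Euc d))⁻¹|)
      ENNReal.ofReal_ne_top
    rw [← h1] at this
    exact this
  exact (memLp_map_measure_iff h2.1 (by fun_prop)).mp h2

lemma lpNorm_comp_inv_smul_sq {f : Euc d → ℂ} (hf : MemLp f 2 volume) {h : ℝ} (hh : 0 < h) :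
    lpNorm (fun x => f (h⁻¹ • x)) 2 volume ^ 2 = h ^ d * lpNorm f 2 volume ^ 2 := by
  rw [lpNorm_two_sq hf, lpNorm_two_sq (MemLp.comp_inv_smul hf hh),
    Measure.integral_comp_inv_smul_of_nonneg (volume : Measure (Euc d))
    (fun x => ‖f x‖ ^ 2) hh.le]
  simp

lemma projFun_eq (φ : 𝓢(Euc d, ℂ)) {h : ℝ} (hh : 0 < h) {u g : Euc d → ℂ} (hu : MemLp u 2 volume)
    (hg : (𝓕 (hu.toLp u) : L2 d) =ᵐ[volume] g) (z : Zd d) : projFun φ h u z = (h ^ d : ℂ)⁻¹ *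
      ∫ η, latChar d z η * (conj (𝓕 φ η) * g (h⁻¹ • η)) := by
  obtain ⟨ψ, hψ⟩ := exists_schwartz_scaled φ hh (latPt d h z)
  have h0 : (h : ℂ) ≠ 0 := by exact_mod_cast hh.ne'
  rw [projFun]
  simp only [← hψ]
  have h1 : ∫ x, conj (ψ x) * u x = ∫ η, conj (𝓕 ψ η) * g η := by
    rw [integral_conj_schwartz_mul ψ hu]
    refine integral_congr_ae ?_
    filter_upwards [hg] with ξ hξ
    rw [hξ]
  have h2 := Measure.integral_comp_inv_smul_of_nonneg (volume : Measure (Euc d))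
    (fun η => conj (𝓕 ψ η) * g η) hh.le
  have h3 : ∫ η, conj (𝓕 ψ η) * g η = (h ^ d : ℂ)⁻¹ *
      ∫ x, conj (𝓕 ψ (h⁻¹ • x)) * g (h⁻¹ • x) := by
    rw [h2]
    simp [h0]
  rw [h1, h3, ← integral_const_mul]
  congr 1
  refine integral_congr_ae (.of_forall fun x => ?_)
  simp only [fourier_scaled φ ψ hh z hψ, smul_inv_smul₀ hh.ne', map_mul, map_pow,
    Complex.conj_ofReal, Complex.conj_conj]
  field_simp

lemma memLp_latMeas_of_summable {h : ℝ} {v : Zd d → ℂ} (hv : Summable fun z => ‖v z‖ ^ 2) :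
    MemLp v 2 (latMeas d h) := by
  have : MemLp v 2 Measure.count := by
    rw [memLp_two_iff_integrable_sq_norm (by fun_prop), integrable_count_iff]
    simpa using hv
  exact this.smul_measure ENNReal.ofReal_ne_top

lemma lpNorm_latMeas_sq {h : ℝ} (hh : 0 < h) {v : Zd d → ℂ} (hv : MemLp v 2 (latMeas d h)) :
    HasSum (fun z => ‖v z‖ ^ 2) ((h ^ d)⁻¹ * lpNorm v 2 (latMeas d h) ^ 2) := by
  have hi := integrable_norm_sq hv
  have h0 : h ^ d ≠ 0 := by positivity
  have hc : Integrable (fun z => ‖v z‖ ^ 2) (Measure.count : Measure (Zd d)) := by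
    have := hi.smul_measure (c := (ENNReal.ofReal (h ^ d))⁻¹) (by simp; positivity)
    rwa [latMeas, smul_smul, ENNReal.inv_mul_cancel (by simp; positivity) ENNReal.ofReal_ne_top,
      one_smul] at this
  have hs : Summable fun z => ‖v z‖ ^ 2 := by
    rw [integrable_count_iff] at hc
    simpa using hc
  rw [lpNorm_two_sq hv, integral_countable hi]
  simp only [latMeas_real_singleton hh, smul_eq_mul, tsum_mul_left]
  rw [inv_mul_cancel_left₀ h0]
  exact hs.hasSum

end Projection

lemma lpNorm_congr_ae' {X : Type*} [MeasurableSpace X] {m : Measure X} {f g : X → ℂ}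
    (hf : AEStronglyMeasurable f m) (h : f =ᵐ[m] g) : lpNorm f 2 m = lpNorm g 2 m := by
  rw [← toReal_eLpNorm hf, ← toReal_eLpNorm (hf.congr h), eLpNorm_congr_ae h]

section Projection

variable {d : ℕ}

open scoped SchwartzMap

lemma exists_support_gap {K : Set (Euc d)} (hK : IsClosed K)
    (hs : K ⊆ {ξ : Euc d | ∀ j, ξ j ∈ Set.Ioo (-1 : ℝ) 1}) :
    ∃ δ : ℝ, 0 < δ ∧ δ ≤ 1 / 2 ∧ ∀ ξ ∈ K, ∀ j, |ξ j| ≤ 1 - δ := by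
  have hb : IsCompact K := by
    refine Metric.isCompact_of_isClosed_isBounded hK
      (Metric.isBounded_closedBall (x := (0 : Euc d)) (r := √d) |>.subset fun ξ hξ => ?_)
    rw [mem_closedBall_zero_iff, EuclideanSpace.norm_eq]
    apply Real.sqrt_le_sqrt
    calc ∑ i, ‖ξ i‖ ^ 2 ≤ ∑ _i : Fin d, (1 : ℝ) := Finset.sum_le_sum fun i _ => by
          have := abs_lt.mpr (hs hξ i)
          rw [Real.norm_eq_abs]
          nlinarith [abs_nonneg (ξ i)]
      _ = d := by simp
  have ho : IsOpen {ξ : Euc d | ∀ j, ξ j ∈ Set.Ioo (-1 : ℝ) 1} := by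
    simp only [Set.ofPred_forall]
    exact isOpen_iInter_of_finite fun j =>
      isOpen_Ioo.preimage (by fun_prop : Continuous fun ξ : Euc d => ξ j)
  obtain ⟨δ, hδ, h⟩ := hb.exists_cthickening_subset_open ho hs
  refine ⟨min δ (1 / 2), by positivity, min_le_right _ _, fun ξ hξ j => ?_⟩
  have key (t : ℝ) (ht : |t| = δ) : ξ j + t ∈ Set.Ioo (-1 : ℝ) 1 := by
    have : ξ + EuclideanSpace.single j t ∈ Metric.cthickening δ K :=
      Metric.mem_cthickening_of_dist_le _ ξ _ _ hξ (by simp [dist_eq_norm, ht])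
    simpa using h this j
  have h1 := key δ (abs_of_pos hδ)
  have h2 := key (-δ) (by rw [abs_neg, abs_of_pos hδ])
  have h3 := min_le_left δ (1 / 2)
  rw [abs_le]
  constructor <;> linarith [h1.1, h1.2, h2.1, h2.2]

section Norms

variable {φ : 𝓢(Euc d, ℂ)} {δ : ℝ}

lemma summable_fourier_shift
    (hφ : ∀ ξ : Euc d, ∑' n : Zd d, ‖𝓕 φ (ξ + latVec d n)‖ ^ 2 = 1)
    (ξ : Euc d) : Summable fun n : Zd d => ‖𝓕 φ (ξ + latVec d n)‖ ^ 2 := by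
  by_contra h
  have := hφ ξ
  rw [tsum_eq_zero_of_not_summable h] at this
  exact zero_ne_one this

lemma norm_fourier_le_one
    (hφ : ∀ ξ : Euc d, ∑' n : Zd d, ‖𝓕 φ (ξ + latVec d n)‖ ^ 2 = 1)
    (ξ : Euc d) : ‖𝓕 φ ξ‖ ≤ 1 := by
  have h := (summable_fourier_shift hφ ξ).le_tsum 0 fun n _ => by positivity
  rw [hφ] at h
  have e : ξ + latVec d 0 = ξ := by ext j; simp
  rw [e] at h
  nlinarith [norm_nonneg (𝓕 φ ξ)]

lemma norm_fourier_eq_one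
    (hφ : ∀ ξ : Euc d, ∑' n : Zd d, ‖𝓕 φ (ξ + latVec d n)‖ ^ 2 = 1)
    (hδ : ∀ ξ, 𝓕 φ ξ ≠ 0 → ∀ j, |ξ j| ≤ 1 - δ)
    {ξ : Euc d} (hξ : ∀ j, |ξ j| < δ) : ‖𝓕 φ ξ‖ = 1 := by
  have e : ξ + latVec d 0 = ξ := by ext j; simp
  have h := hφ ξ
  rw [tsum_eq_single 0, e] at h
  · nlinarith [norm_nonneg (𝓕 φ ξ)]
  intro n hn
  by_contra h0
  obtain ⟨j, hj⟩ := Function.ne_iff.mp hn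
  have h1 := hδ (ξ + latVec d n) (by simpa using h0) j
  have h2 : (1 : ℝ) ≤ |(n j : ℝ)| := by exact_mod_cast Int.one_le_abs hj
  have h3 := abs_sub_abs_le_abs_sub (n j : ℝ) (-ξ j)
  rw [abs_neg, sub_neg_eq_add, add_comm (n j : ℝ)] at h3
  simp only [PiLp.add_apply, latVec_apply] at h1
  linarith [hξ j]

lemma lpNorm_projFun_sq
    (hφ : ∀ ξ : Euc d, ∑' n : Zd d, ‖𝓕 φ (ξ + latVec d n)‖ ^ 2 = 1)
    (hδ : ∀ ξ, 𝓕 φ ξ ≠ 0 → ∀ j, |ξ j| ≤ 1 - δ) (hδ0 : 0 < δ)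
    {h : ℝ} (hh : 0 < h) {u g : Euc d → ℂ} (hu : MemLp u 2 volume)
    (hg : (𝓕 (hu.toLp u) : L2 d) =ᵐ[volume] g) :
    MemLp (projFun φ h u) 2 (latMeas d h) ∧
    lpNorm (projFun φ h u) 2 (latMeas d h) ^ 2 = (h ^ d)⁻¹ *
      ∫ x in unitBox d, ‖∑ n ∈ nearLat d, conj (𝓕 φ (x + latVec d n)) *
        g (h⁻¹ • (x + latVec d n))‖ ^ 2 := by
  have hg2 : MemLp g 2 volume := (memLp_congr_ae hg).mp (Lp.memLp _)
  have hg3 := MemLp.comp_inv_smul hg2 hh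
  have hp2 : MemLp (⇑(𝓕 φ : 𝓢(Euc d, ℂ))) 2 volume := (𝓕 φ).memLp 2 volume
  have hF1 := integrable_conj_mul hp2 hg3
  have hF2 : MemLp (fun η => conj (𝓕 φ η) * g (h⁻¹ • η)) 2 volume :=
    (lpNorm_le_mul_of_norm_le hF1.1 hg3 zero_le_one fun η => by
      rw [norm_mul, RCLike.norm_conj]
      gcongr
      exact norm_fourier_le_one hφ η).1
  have hs := hasSum_sq_integral_latChar hF1 hF2 (fun x hx j => by
    have := hδ x (fun h0 => hx (by simp [h0])) j
    linarith)
  have hs2 := hs.mul_left (((h ^ d) ^ 2)⁻¹)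
  have hs3 : HasSum (fun z => ‖projFun φ h u z‖ ^ 2) _ := hs2.congr_fun fun z => by
    rw [projFun_eq φ hh hu hg, norm_mul, mul_pow]
    simp [abs_of_pos hh]
  have hm := memLp_latMeas_of_summable (h := h) hs3.summable
  refine ⟨hm, ?_⟩
  have := (lpNorm_latMeas_sq hh hm).unique hs3
  have h0 : h ^ d ≠ 0 := by positivity
  field_simp at this ⊢
  linarith

lemma lpNorm_projFun_le
    (hφ : ∀ ξ : Euc d, ∑' n : Zd d, ‖𝓕 φ (ξ + latVec d n)‖ ^ 2 = 1)
    (hδ : ∀ ξ, 𝓕 φ ξ ≠ 0 → ∀ j, |ξ j| ≤ 1 - δ) (hδ0 : 0 < δ)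
    {h : ℝ} (hh : 0 < h) {u : Euc d → ℂ} (hu : MemLp u 2 volume) :
    lpNorm (projFun φ h u) 2 (latMeas d h) ≤ lpNorm u 2 volume := by
  set g := ⇑(𝓕 (hu.toLp u) : L2 d) with hgdef
  have hg2 : MemLp g 2 volume := Lp.memLp _
  have hg3 := MemLp.comp_inv_smul hg2 hh
  have h1 := (lpNorm_projFun_sq hφ hδ hδ0 hh hu (g := g) (by rfl)).2
  have hi : Integrable fun x => ‖g (h⁻¹ • x)‖ ^ 2 := integrable_norm_sq hg3
  have h2 : ∫ x in unitBox d, ‖∑ n ∈ nearLat d, conj (𝓕 φ (x + latVec d n)) *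
        g (h⁻¹ • (x + latVec d n))‖ ^ 2 ≤ ∫ x, ‖g (h⁻¹ • x)‖ ^ 2 := by
    calc _ ≤ ∫ x in unitBox d, ∑ n ∈ nearLat d, ‖g (h⁻¹ • (x + latVec d n))‖ ^ 2 := by
          refine integral_mono_of_nonneg (.of_forall fun x => by positivity) ?_
            (.of_forall fun x => ?_)
          · exact (integrable_finsetSum _ fun n _ => hi.comp_add_right _).integrableOn
          · dsimp only
            calc _ ≤ (∑ n ∈ nearLat d, ‖𝓕 φ (x + latVec d n)‖ *
                    ‖g (h⁻¹ • (x + latVec d n))‖) ^ 2 := by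
                  gcongr
                  refine (norm_sum_le _ _).trans_eq ?_
                  simp
              _ ≤ (∑ n ∈ nearLat d, ‖𝓕 φ (x + latVec d n)‖ ^ 2) *
                    ∑ n ∈ nearLat d, ‖g (h⁻¹ • (x + latVec d n))‖ ^ 2 :=
                  Finset.sum_mul_sq_le_sq_mul_sq _ _ _
              _ ≤ 1 * ∑ n ∈ nearLat d, ‖g (h⁻¹ • (x + latVec d n))‖ ^ 2 := by
                  gcongr
                  rw [← hφ x]
                  exact (summable_fourier_shift hφ x).sum_le_tsum _ fun n _ => by positivity
              _ = _ := one_mul _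
      _ = ∫ x in ⋃ n ∈ nearLat d, shiftBox d n, ‖g (h⁻¹ • x)‖ ^ 2 := integral_unitBox_sum hi _
      _ ≤ ∫ x, ‖g (h⁻¹ • x)‖ ^ 2 := setIntegral_le_integral hi (.of_forall fun x => by positivity)
  rw [← lpNorm_two_sq hg3, lpNorm_comp_inv_smul_sq hg2 hh, hgdef, lpNorm_fourier_toLp hu] at h2
  refine (pow_le_pow_iff_left₀ lpNorm_nonneg lpNorm_nonneg two_ne_zero).mp ?_
  rw [h1]
  have h0 : 0 < h ^ d := by positivity
  rwa [inv_mul_le_iff₀ h0]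

lemma lpNorm_projFun_eq
    (hφ : ∀ ξ : Euc d, ∑' n : Zd d, ‖𝓕 φ (ξ + latVec d n)‖ ^ 2 = 1)
    (hδ : ∀ ξ, 𝓕 φ ξ ≠ 0 → ∀ j, |ξ j| ≤ 1 - δ) (hδ0 : 0 < δ)
    {h : ℝ} (hh : 0 < h) {u : Euc d → ℂ} (hu : MemLp u 2 volume)
    (hδ2 : δ ≤ 1 / 2)
    (hlow : ∀ᵐ ξ, (𝓕 (hu.toLp u) : L2 d) ξ ≠ 0 → ∀ j, |(h • ξ) j| < δ) :
    lpNorm (projFun φ h u) 2 (latMeas d h) = lpNorm u 2 volume := by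
  classical
  let g : Euc d → ℂ := {ξ : Euc d | ∀ j, |(h • ξ) j| < δ}.indicator (𝓕 (hu.toLp u) : L2 d)
  have hg : (𝓕 (hu.toLp u) : L2 d) =ᵐ[volume] g := by
    filter_upwards [hlow] with ξ hξ
    by_cases h0 : ∀ j, |(h • ξ) j| < δ
    · exact (Set.indicator_of_mem (s := {ξ : Euc d | ∀ j, |(h • ξ) j| < δ}) h0 _).symm
    · rw [show g ξ = 0 from
        Set.indicator_of_notMem (s := {ξ : Euc d | ∀ j, |(h • ξ) j| < δ}) h0 _]
      by_contra h1
      exact h0 (hξ h1)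
  have hgs (η : Euc d) (hη : g (h⁻¹ • η) ≠ 0) (j : Fin d) : |η j| < δ := by
    have : h⁻¹ • η ∈ {ξ : Euc d | ∀ j, |(h • ξ) j| < δ} := by
      by_contra h1
      exact hη (Set.indicator_of_notMem h1 _)
    simpa [smul_inv_smul₀ hh.ne', mul_inv_cancel_left₀ hh.ne'] using this j
  have hg2 : MemLp g 2 volume := (memLp_congr_ae hg).mp (Lp.memLp _)
  have hg3 := MemLp.comp_inv_smul hg2 hh
  have h1 := (lpNorm_projFun_sq hφ hδ hδ0 hh hu hg).2
  have h2 : ∫ x in unitBox d, ‖∑ n ∈ nearLat d, conj (𝓕 φ (x + latVec d n)) *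
        g (h⁻¹ • (x + latVec d n))‖ ^ 2 = ∫ x, ‖g (h⁻¹ • x)‖ ^ 2 := by
    have hz : ∫ x in unitBox d, ‖g (h⁻¹ • x)‖ ^ 2 = ∫ x, ‖g (h⁻¹ • x)‖ ^ 2 := by
      refine setIntegral_eq_integral_of_forall_compl_eq_zero fun x hx => ?_
      by_contra h3
      refine hx fun j => ?_
      have := abs_lt.mp (hgs x (by simpa using h3) j)
      constructor <;> linarith
    rw [← hz]
    refine setIntegral_congr_fun (measurableSet_unitBox d) fun x hx => ?_
    have e : x + latVec d 0 = x := by ext j; simp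
    rw [Finset.sum_eq_single 0, e, norm_mul, RCLike.norm_conj]
    · by_cases h3 : g (h⁻¹ • x) = 0
      · simp [h3]
      · rw [norm_fourier_eq_one hφ hδ (hgs x h3), one_mul]
    · intro n _ hn
      rw [mul_eq_zero]
      right
      by_contra h3
      apply hn
      ext j
      have h4 := abs_lt.mp (hgs _ h3 j)
      have h5 := hx j
      simp only [PiLp.add_apply, latVec_apply] at h4
      have a1 : (n j : ℝ) < 1 := by linarith [h5.1]
      have a2 : (-1 : ℝ) < n j := by linarith [h5.2]
      norm_cast at a1
      have a3 : (-1 : ℤ) < n j := by exact_mod_cast a2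
      simp only [Pi.zero_apply]
      omega
    · intro h3
      exact absurd (Fintype.mem_piFinset.mpr fun _ => by simp) h3
  have hgn : lpNorm g 2 volume = lpNorm u 2 volume := by
    rw [← lpNorm_fourier_toLp hu]
    exact (lpNorm_congr_ae' (Lp.aestronglyMeasurable _) hg).symm
  rw [← lpNorm_two_sq hg3, lpNorm_comp_inv_smul_sq hg2 hh, hgn] at h2
  refine (pow_left_inj₀ lpNorm_nonneg lpNorm_nonneg two_ne_zero).mp ?_
  rw [h1, h2, inv_mul_cancel_left₀ (by positivity)]

end Norms

end Projection

lemma adjoint_apply_self_of_norm_eq {E F : Type*} [NormedAddCommGroup E] [InnerProductSpace ℂ E]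
    [CompleteSpace E] [NormedAddCommGroup F] [InnerProductSpace ℂ F] [CompleteSpace F]
    {T : E →L[ℂ] F} (hT : ‖T‖ ≤ 1) {x : E} (hx : ‖T x‖ = ‖x‖) :
    ContinuousLinearMap.adjoint T (T x) = x := by
  have h1 : ‖ContinuousLinearMap.adjoint T (T x)‖ ≤ ‖x‖ := by
    refine (ContinuousLinearMap.le_opNorm _ _).trans ?_
    rw [LinearIsometryEquiv.norm_map, hx]
    exact mul_le_of_le_one_left (norm_nonneg _) hT
  have h2 := norm_sub_sq (𝕜 := ℂ) (ContinuousLinearMap.adjoint T (T x)) x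
  rw [ContinuousLinearMap.adjoint_inner_left, inner_self_eq_norm_sq, hx] at h2
  have h3 : ‖ContinuousLinearMap.adjoint T (T x) - x‖ ^ 2 ≤ 0 := by
    rw [h2]
    nlinarith [norm_nonneg (ContinuousLinearMap.adjoint T (T x))]
  rw [← sub_eq_zero, ← norm_eq_zero]
  exact pow_eq_zero_iff two_ne_zero |>.mp (le_antisymm h3 (by positivity))

section Multiplier

variable {d : ℕ}

open scoped SchwartzMap

lemma exists_fourier_eq {g : Euc d → ℂ} (hg : MemLp g 2 volume) :
    ∃ v : L2 d, (𝓕 v : L2 d) =ᵐ[volume] g ∧ ‖v‖ = lpNorm g 2 volume := by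
  refine ⟨𝓕⁻ (hg.toLp g), ?_, ?_⟩
  · rw [FourierTransform.fourier_fourierInv_eq]
    exact hg.coeFn_toLp
  · rw [← norm_toLp_eq_lpNorm hg, ← Lp.norm_fourier_eq, FourierTransform.fourier_fourierInv_eq]

lemma memLp_lapl {u : Euc d → ℂ} (hu : ContDiff ℝ (⊤ : ℕ∞) u) (hc : HasCompactSupport u) :
    MemLp (lapl d u) 2 volume :=
  (contDiff_lapl hu).continuous.memLp_of_hasCompactSupport (hasCompactSupport_lapl hc)

lemma fourier_lapl {u : Euc d → ℂ} (hu : ContDiff ℝ (⊤ : ℕ∞) u) (hc : HasCompactSupport u)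
    (hu2 : MemLp u 2 volume) (hl : MemLp (lapl d u) 2 volume) :
    (𝓕 (hl.toLp (lapl d u)) : L2 d) =ᵐ[volume]
      fun ξ => -((4 * π ^ 2 * ‖ξ‖ ^ 2 : ℝ) : ℂ) * (𝓕 (hu2.toLp u) : L2 d) ξ := by
  let ψ : 𝓢(Euc d, ℂ) := hc.toSchwartzMap hu
  let χ : 𝓢(Euc d, ℂ) := ∑ j, schwartzPartial j (schwartzPartial j ψ)
  have e1 : hu2.toLp u = ψ.toLp 2 volume := by
    ext1
    filter_upwards [hu2.coeFn_toLp, ψ.coeFn_toLp 2 volume] with x h1 h2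
    rw [h1, h2]; rfl
  have e2 : hl.toLp (lapl d u) = χ.toLp 2 volume := by
    ext1
    filter_upwards [hl.coeFn_toLp, χ.coeFn_toLp 2 volume] with x h1 h2
    rw [h1, h2, sum_apply]; rfl
  rw [e1, e2, SchwartzMap.toLp_fourier_eq, SchwartzMap.toLp_fourier_eq]
  filter_upwards [(𝓕 ψ).coeFn_toLp 2 volume, (𝓕 χ).coeFn_toLp 2 volume] with ξ h1 h2
  rw [h1, h2]
  have : 𝓕 χ = ∑ j, 𝓕 (schwartzPartial j (schwartzPartial j ψ)) :=
    map_sum (FourierTransform.fourierCLM ℂ 𝓢(Euc d, ℂ)) _ _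
  rw [this, sum_apply]
  simp only [fourier_lineDeriv_apply, EuclideanSpace.norm_sq_eq, Real.norm_eq_abs, sq_abs]
  push_cast
  simp only [Finset.mul_sum, Finset.sum_mul, ← Finset.sum_neg_distrib]
  refine Finset.sum_congr rfl fun j _ => ?_
  linear_combination (4 * π ^ 2 * (ξ j : ℂ) ^ 2 * 𝓕 ψ ξ) * Complex.I_sq

lemma norm_lapl_fourier {u : Euc d → ℂ} (hu : ContDiff ℝ (⊤ : ℕ∞) u) (hc : HasCompactSupport u)
    (hu2 : MemLp u 2 volume) :
    MemLp (fun ξ => ((‖ξ‖ ^ 2 : ℝ) : ℂ) * (𝓕 (hu2.toLp u) : L2 d) ξ) 2 volume ∧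
    lpNorm (fun ξ => ((‖ξ‖ ^ 2 : ℝ) : ℂ) * (𝓕 (hu2.toLp u) : L2 d) ξ) 2 volume =
      (4 * π ^ 2)⁻¹ * lpNorm (lapl d u) 2 volume := by
  have hl := memLp_lapl hu hc
  have h1 := fourier_lapl hu hc hu2 hl
  have h2 : (fun ξ => (-(4 * π ^ 2 : ℝ) : ℂ)⁻¹ * (𝓕 (hl.toLp (lapl d u)) : L2 d) ξ) =ᵐ[volume]
      fun ξ => ((‖ξ‖ ^ 2 : ℝ) : ℂ) * (𝓕 (hu2.toLp u) : L2 d) ξ := by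
    filter_upwards [h1] with ξ hξ
    have : (π : ℂ) ≠ 0 := by exact_mod_cast Real.pi_ne_zero
    rw [hξ]
    push_cast
    field_simp
  have h3 : MemLp (fun ξ => (-(4 * π ^ 2 : ℝ) : ℂ)⁻¹ * (𝓕 (hl.toLp (lapl d u)) : L2 d) ξ) 2
    volume := (Lp.memLp (𝓕 (hl.toLp (lapl d u)) : L2 d)).const_mul _
  refine ⟨(memLp_congr_ae h2).mp h3, ?_⟩
  rw [← lpNorm_congr_ae' h3.1 h2, lpNorm_const_mul', lpNorm_fourier_toLp hl, norm_inv, norm_neg,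
    Complex.norm_real, Real.norm_of_nonneg (by positivity)]

end Multiplier

lemma fourier_sub_indicator {d : ℕ} {f v : L2 d} {s : Set (Euc d)}
    (hv : (𝓕 v : L2 d) =ᵐ[volume] s.indicator (𝓕 f : L2 d)) :
    (𝓕 (f - v) : L2 d) =ᵐ[volume] sᶜ.indicator (𝓕 f : L2 d) := by
  have h : (𝓕 (f - v) : L2 d) = 𝓕 f - 𝓕 v :=
    map_sub (AddMonoidHom.mk' (𝓕 : L2 d → L2 d) FourierTransform.fourier_add) f v
  rw [h]
  filter_upwards [Lp.coeFn_sub (𝓕 f : L2 d) (𝓕 v : L2 d), hv] with ξ e1 e2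
  rw [e1, Pi.sub_apply, e2, Set.indicator_compl, Pi.sub_apply]

lemma norm_adjoint_comp_self_sub_le {E F : Type*} [NormedAddCommGroup E] [InnerProductSpace ℂ E]
    [CompleteSpace E] [NormedAddCommGroup F] [InnerProductSpace ℂ F] [CompleteSpace F]
    {T : E →L[ℂ] F} (hT : ‖T‖ ≤ 1) {v : E} (hv : ContinuousLinearMap.adjoint T (T v) = v) (f : E) :
    ‖ContinuousLinearMap.adjoint T (T f) - f‖ ≤ ‖f - v‖ + ‖f - v‖ := by
  have h3 : ContinuousLinearMap.adjoint T (T f) - f =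
      ContinuousLinearMap.adjoint T (T (f - v)) - (f - v) := by
    rw [map_sub, map_sub, hv]; abel
  rw [h3]
  refine (norm_sub_le _ _).trans ?_
  gcongr
  refine (ContinuousLinearMap.le_opNorm _ _).trans ?_
  rw [LinearIsometryEquiv.norm_map]
  exact (mul_le_of_le_one_left (norm_nonneg _) hT).trans
    ((T.le_opNorm _).trans (mul_le_of_le_one_left (norm_nonneg _) hT))

section ProjectionError

variable {d : ℕ}

open scoped SchwartzMap

variable {φ : 𝓢(Euc d, ℂ)} {δ : ℝ}

lemma IsProjOp.coe_eq {h : ℝ} {Ph : L2 d →L[ℂ] l2h d h} (hP : IsProjOp d h φ Ph)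
    (u : L2 d) : (Ph u : Zd d → ℂ) = projFun φ h u := funext fun z => hP u z

lemma IsProjOp.opNorm_le
    (hφ : ∀ ξ : Euc d, ∑' n : Zd d, ‖𝓕 φ (ξ + latVec d n)‖ ^ 2 = 1)
    (hδ : ∀ ξ, 𝓕 φ ξ ≠ 0 → ∀ j, |ξ j| ≤ 1 - δ) (hδ0 : 0 < δ)
    {h : ℝ} (hh : 0 < h) {Ph : L2 d →L[ℂ] l2h d h}
    (hP : IsProjOp d h φ Ph) : ‖Ph‖ ≤ 1 := by
  refine ContinuousLinearMap.opNorm_le_bound _ zero_le_one fun u => ?_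
  rw [one_mul, ← lpNorm_coeFn, ← lpNorm_coeFn, hP.coe_eq]
  exact lpNorm_projFun_le hφ hδ hδ0 hh (Lp.memLp u)

lemma IsProjOp.adjoint_apply_self
    (hφ : ∀ ξ : Euc d, ∑' n : Zd d, ‖𝓕 φ (ξ + latVec d n)‖ ^ 2 = 1)
    (hδ : ∀ ξ, 𝓕 φ ξ ≠ 0 → ∀ j, |ξ j| ≤ 1 - δ) (hδ0 : 0 < δ)
    {h : ℝ} (hh : 0 < h) {Ph : L2 d →L[ℂ] l2h d h}
    (hP : IsProjOp d h φ Ph) (hδ2 : δ ≤ 1 / 2) {u : L2 d}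
    (hlow : ∀ᵐ ξ, (𝓕 u : L2 d) ξ ≠ 0 → ∀ j, |(h • ξ) j| < δ) :
    ContinuousLinearMap.adjoint Ph (Ph u) = u := by
  refine adjoint_apply_self_of_norm_eq (hP.opNorm_le hφ hδ hδ0 hh) ?_
  rw [← lpNorm_coeFn, ← lpNorm_coeFn, hP.coe_eq]
  exact lpNorm_projFun_eq hφ hδ hδ0 hh (Lp.memLp u) hδ2 (by rwa [Lp.toLp_coeFn])

lemma IsProjOp.norm_adjoint_apply_sub_le
    (hφ : ∀ ξ : Euc d, ∑' n : Zd d, ‖𝓕 φ (ξ + latVec d n)‖ ^ 2 = 1)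
    (hδ : ∀ ξ, 𝓕 φ ξ ≠ 0 → ∀ j, |ξ j| ≤ 1 - δ) (hδ0 : 0 < δ)
    {h : ℝ} (hh : 0 < h) {Ph : L2 d →L[ℂ] l2h d h}
    (hP : IsProjOp d h φ Ph) (hδ2 : δ ≤ 1 / 2) {u : Euc d → ℂ} (hu : ContDiff ℝ (⊤ : ℕ∞) u)
    (hc : HasCompactSupport u) (hu2 : MemLp u 2 volume) :
    ‖ContinuousLinearMap.adjoint Ph (Ph (hu2.toLp u)) - hu2.toLp u‖ ≤
      (2 * π ^ 2 * δ ^ 2)⁻¹ * h ^ 2 * lpNorm (lapl d u) 2 volume := by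
  set f := hu2.toLp u with hf
  let s : Set (Euc d) := {ξ | ∀ j, |(h • ξ) j| < δ}
  have hs : MeasurableSet s := by
    have : s = ⋂ j, (fun ξ : Euc d => |(h • ξ) j|) ⁻¹' Set.Iio δ := by
      ext x; simp [s]
    rw [this]
    exact MeasurableSet.iInter fun j =>
      (by fun_prop : Measurable fun ξ : Euc d => |(h • ξ) j|) measurableSet_Iio
  have hg : MemLp (s.indicator (𝓕 f : L2 d)) 2 volume := (Lp.memLp _).indicator hs
  obtain ⟨v, hv, -⟩ := exists_fourier_eq hg
  have h1 : ContinuousLinearMap.adjoint Ph (Ph v) = v := by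
    refine hP.adjoint_apply_self hφ hδ hδ0 hh hδ2 ?_
    filter_upwards [hv] with ξ hξ hne
    rw [hξ] at hne
    exact Set.mem_of_indicator_ne_zero hne
  obtain ⟨hl, hl2⟩ := norm_lapl_fourier hu hc hu2
  have h2 : ‖f - v‖ ≤ (h / δ) ^ 2 * ((4 * π ^ 2)⁻¹ * lpNorm (lapl d u) 2 volume) := by
    rw [← hl2, ← Lp.norm_fourier_eq, ← lpNorm_coeFn]
    have e := fourier_sub_indicator hv
    rw [lpNorm_congr_ae' (Lp.aestronglyMeasurable _) e]
    have e3 : AEStronglyMeasurable (sᶜ.indicator (𝓕 f : L2 d)) volume :=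
      (Lp.aestronglyMeasurable (𝓕 f : L2 d)).indicator hs.compl
    refine (lpNorm_le_mul_of_norm_le e3 hl (by positivity) fun ξ => ?_).2
    by_cases hξ : ξ ∈ s
    · rw [Set.indicator_of_notMem (by simpa using hξ), norm_zero]
      positivity
    rw [Set.indicator_of_mem (by simpa using hξ), norm_mul, Complex.norm_real,
      Real.norm_of_nonneg (by positivity), ← mul_assoc]
    refine le_mul_of_one_le_left (norm_nonneg _) ?_
    obtain ⟨j, hj⟩ := not_forall.mp (show ¬ ∀ j, |(h • ξ) j| < δ from hξ)
    rw [not_lt] at hj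
    have h3 : |ξ j| ≤ ‖ξ‖ := by simpa using PiLp.norm_apply_le ξ j
    have h4 : δ ≤ h * ‖ξ‖ := by
      refine hj.trans ?_
      rw [PiLp.smul_apply, smul_eq_mul, abs_mul, abs_of_pos hh]
      gcongr
    rw [← mul_pow, div_mul_eq_mul_div]
    exact one_le_pow₀ ((one_le_div hδ0).mpr h4)
  have hP1 := hP.opNorm_le hφ hδ hδ0 hh
  calc _ ≤ ‖f - v‖ + ‖f - v‖ := norm_adjoint_comp_self_sub_le hP1 h1 f
    _ ≤ (h / δ) ^ 2 * ((4 * π ^ 2)⁻¹ * lpNorm (lapl d u) 2 volume) +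
        (h / δ) ^ 2 * ((4 * π ^ 2)⁻¹ * lpNorm (lapl d u) 2 volume) := add_le_add h2 h2
    _ = _ := by
        have := Real.pi_ne_zero
        field_simp
        ring

end ProjectionError

section Kinetic

variable {d : ℕ}

open scoped SchwartzMap

/-- The symbol of the discrete Laplacian. -/
def latSymbol (d : ℕ) (x : Euc d) : ℝ := ∑ j, 4 * Real.sin (π * x j) ^ 2

lemma continuous_latSymbol : Continuous (latSymbol d) := by
  unfold latSymbol
  fun_prop

lemma latChar_second_diff (z : Zd d) (x : Euc d) (j : Fin d) :
    2 * latChar d z x - latChar d (z + Pi.single j 1) x - latChar d (z - Pi.single j 1) x =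
      latChar d z x * ((4 * Real.sin (π * x j) ^ 2 : ℝ) : ℂ) := by
  have e1 : ∑ i, (((Pi.single j 1 : Zd d) i : ℤ) : ℂ) * (x i : ℂ) = x j := by
    rw [Finset.sum_eq_single j] <;> simp +contextual
  have e2 : latChar d (z + Pi.single j 1) x = latChar d z x * cexp (2 * π * I * x j) := by
    rw [latChar, latChar, ← Complex.exp_add, ← e1]
    simp only [Pi.add_apply, Int.cast_add, add_mul, Finset.sum_add_distrib, mul_add]
  have e3 : latChar d (z - Pi.single j 1) x = latChar d z x * cexp (-(2 * π * I * x j)) := by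
    rw [latChar, latChar, ← Complex.exp_add, ← e1]
    simp only [Pi.sub_apply, Int.cast_sub, sub_mul, Finset.sum_sub_distrib, mul_sub]
    rw [← sub_eq_add_neg]
  have e4 : cexp (2 * π * I * x j) =
      Complex.cos (2 * (π * x j)) + Complex.sin (2 * (π * x j)) * I := by
    rw [← Complex.exp_mul_I]; ring_nf
  have e5 : cexp (-(2 * π * I * x j)) =
      Complex.cos (2 * (π * x j)) - Complex.sin (2 * (π * x j)) * I := by
    have := Complex.exp_mul_I (-(2 * (π * x j)))
    rw [Complex.cos_neg, Complex.sin_neg, neg_mul (Complex.sin _), ← sub_eq_add_neg] at this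
    rw [← this]; ring_nf
  rw [e2, e3, e4, e5, Complex.cos_two_mul]
  push_cast
  have := Complex.sin_sq_add_cos_sq (π * x j)
  linear_combination (-4 * latChar d z x) * this

lemma discLap_integral_latChar (h : ℝ) (a : ℂ) {G : Euc d → ℂ} (hG : Integrable G) (z : Zd d) :
    discLap d h (fun z => a * ∫ x, latChar d z x * G x) z =
      a * ∫ x, latChar d z x * ((h ^ 2 : ℂ)⁻¹ * latSymbol d x * G x) := by
  have hi (w : Zd d) : Integrable fun x => latChar d w x * G x :=
    hG.bdd_mul (continuous_latChar d w).aestronglyMeasurable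
      (.of_forall fun x => (norm_latChar d w x).le)
  have e (j : Fin d) : 2 * (a * ∫ x, latChar d z x * G x) -
      (a * ∫ x, latChar d (z + Pi.single j 1) x * G x) -
      (a * ∫ x, latChar d (z - Pi.single j 1) x * G x) =
      a * ∫ x, latChar d z x * (((4 * Real.sin (π * x j) ^ 2 : ℝ) : ℂ) * G x) := by
    have := integral_sub_sub ((hi z).const_mul 2) (hi (z + Pi.single j 1)) (hi (z - Pi.single j 1))
    rw [integral_const_mul] at this
    rw [mul_left_comm, ← mul_sub, ← mul_sub, ← this]
    congr 1
    refine integral_congr_ae (.of_forall fun x => ?_)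
    simp only
    rw [← mul_assoc (latChar d z x), ← latChar_second_diff]
    ring
  have hi2 (j : Fin d) : Integrable fun x =>
      latChar d z x * (((4 * Real.sin (π * x j) ^ 2 : ℝ) : ℂ) * G x) := by
    have := (((hi z).const_mul 2).sub (hi (z + Pi.single j 1))).sub (hi (z - Pi.single j 1))
    refine this.congr (.of_forall fun x => ?_)
    simp only [Pi.sub_apply]
    rw [← mul_assoc (latChar d z x), ← latChar_second_diff]
    ring
  rw [discLap]
  simp only [e]
  rw [← Finset.mul_sum, ← integral_finsetSum _ fun j _ => hi2 j, mul_left_comm,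
    ← integral_const_mul]
  congr 1
  refine integral_congr_ae (.of_forall fun x => ?_)
  simp only [latSymbol]
  rw [← Finset.mul_sum, ← Finset.sum_mul]
  push_cast
  ring

lemma two_mul_abs_le_abs_sin {δ t : ℝ} (hδ0 : 0 < δ) (hδ2 : δ ≤ 1 / 2) (ht : |t| ≤ 1 - δ) :
    2 * δ * |t| ≤ |Real.sin (π * t)| := by
  have key : ∀ s, 0 ≤ s → s ≤ 1 - δ → 2 * δ * s ≤ Real.sin (π * s) := by
    intro s hs0 hs
    rcases le_total s (1 / 2) with h | h
    · have := Real.mul_le_sin (x := π * s) (by positivity) (by nlinarith [Real.pi_pos])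
      have e : 2 / π * (π * s) = 2 * s := by field_simp
      rw [e] at this
      nlinarith
    · have := Real.mul_le_sin (x := π * (1 - s)) (by
        have := Real.pi_pos
        apply mul_nonneg this.le; linarith) (by nlinarith [Real.pi_pos])
      have e : 2 / π * (π * (1 - s)) = 2 * (1 - s) := by field_simp
      have e2 : Real.sin (π * (1 - s)) = Real.sin (π * s) := by
        rw [mul_sub, mul_one, Real.sin_pi_sub]
      rw [e, e2] at this
      nlinarith
  have h1 := key |t| (abs_nonneg t) ht
  rcases abs_cases t with ⟨h, -⟩ | ⟨h, -⟩
  · rw [h] at h1 ⊢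
    exact h1.trans (le_abs_self _)
  · rw [h] at h1 ⊢
    rw [mul_neg π, Real.sin_neg] at h1
    exact h1.trans (neg_le_abs _)

lemma sq_sub_sin_sq_le (y : ℝ) : 0 ≤ y ^ 2 - Real.sin y ^ 2 ∧ y ^ 2 - Real.sin y ^ 2 ≤ y ^ 4 := by
  have h1 : Real.sin y ^ 2 ≤ y ^ 2 := Real.sin_sq_le_sq
  refine ⟨by linarith, ?_⟩
  rcases le_or_gt 1 |y| with h | h
  · have h2 : 1 ≤ y ^ 2 := by rw [← sq_abs]; exact one_le_pow₀ h
    nlinarith [sq_nonneg (Real.sin y)]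
  rcases eq_or_ne y 0 with rfl | h0
  · simp
  have h2 := Real.sin_gt_sub_cube (abs_pos.mpr h0)
  have h3 : 0 ≤ |y| - |y| ^ 3 / 6 := by
    nlinarith [abs_nonneg y, mul_nonneg (abs_nonneg y) (abs_nonneg y)]
  have h4 := pow_le_pow_left₀ h3 h2.le 2
  have h5 : Real.sin |y| ^ 2 = Real.sin y ^ 2 := by
    rcases abs_choice y with h | h <;> simp [h]
  have h6 : (|y| - |y| ^ 3 / 6) ^ 2 = y ^ 2 - y ^ 4 / 3 + (y ^ 3 / 6) ^ 2 := by
    have e2 : |y| ^ 2 = y ^ 2 := sq_abs y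
    have : (|y| - |y| ^ 3 / 6) ^ 2 = |y| ^ 2 - (|y| ^ 2) ^ 2 / 3 + (|y| ^ 2) ^ 3 / 36 := by ring
    rw [this, e2]; ring
  nlinarith [sq_nonneg (y ^ 2), sq_nonneg (y ^ 3 / 6)]

lemma norm_sq_sub_latSymbol (x : Euc d) : 0 ≤ 4 * π ^ 2 * ‖x‖ ^ 2 - latSymbol d x ∧
    4 * π ^ 2 * ‖x‖ ^ 2 - latSymbol d x ≤ 4 * π ^ 4 * (‖x‖ ^ 2) ^ 2 := by
  have e : 4 * π ^ 2 * ‖x‖ ^ 2 - latSymbol d x =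
      ∑ j, 4 * ((π * x j) ^ 2 - Real.sin (π * x j) ^ 2) := by
    rw [EuclideanSpace.norm_sq_eq, latSymbol, Finset.mul_sum, ← Finset.sum_sub_distrib]
    refine Finset.sum_congr rfl fun j _ => ?_
    rw [Real.norm_eq_abs, sq_abs]; ring
  rw [e]
  refine ⟨Finset.sum_nonneg fun j _ => by linarith [(sq_sub_sin_sq_le (π * x j)).1], ?_⟩
  calc _ ≤ ∑ j, 4 * π ^ 4 * (‖x j‖ ^ 2 * ‖x‖ ^ 2) := by
        refine Finset.sum_le_sum fun j _ => ?_
        have h1 := (sq_sub_sin_sq_le (π * x j)).2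
        have h2 : ‖x j‖ ^ 2 ≤ ‖x‖ ^ 2 := by gcongr; exact PiLp.norm_apply_le x j
        have h3 : ‖x j‖ ^ 2 * ‖x j‖ ^ 2 ≤ ‖x j‖ ^ 2 * ‖x‖ ^ 2 := by gcongr
        have h4 : (π * x j) ^ 4 = π ^ 4 * (‖x j‖ ^ 2 * ‖x j‖ ^ 2) := by
          rw [Real.norm_eq_abs, sq_abs]; ring
        have h5 : 0 < π ^ 4 := by positivity
        rw [h4] at h1
        nlinarith
    _ = _ := by
        rw [← Finset.mul_sum, ← Finset.sum_mul, ← EuclideanSpace.norm_sq_eq]; ring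

lemma le_latSymbol {δ : ℝ} (hδ0 : 0 < δ) (hδ2 : δ ≤ 1 / 2) {x : Euc d} (hx : ∀ j, |x j| ≤ 1 - δ) :
    16 * δ ^ 2 * ‖x‖ ^ 2 ≤ latSymbol d x := by
  rw [EuclideanSpace.norm_sq_eq, latSymbol, Finset.mul_sum]
  refine Finset.sum_le_sum fun j _ => ?_
  have h1 := pow_le_pow_left₀ (by positivity) (two_mul_abs_le_abs_sin hδ0 hδ2 (hx j)) 2
  rw [sq_abs, mul_pow] at h1
  rw [Real.norm_eq_abs]
  linarith

end Kinetic

section KineticError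

variable {d : ℕ}

open scoped SchwartzMap

lemma projFun_neg (φ : 𝓢(Euc d, ℂ)) (h : ℝ) (u : Euc d → ℂ) (z : Zd d) :
    projFun φ h (fun x => -u x) z = -projFun φ h u z := by
  simp only [projFun, mul_neg, integral_neg]

lemma discLap_projFun (φ : 𝓢(Euc d, ℂ)) {h : ℝ} (hh : 0 < h) {u g : Euc d → ℂ}
    (hu : MemLp u 2 volume) (hg : (𝓕 (hu.toLp u) : L2 d) =ᵐ[volume] g) (z : Zd d) :
    discLap d h (projFun φ h u) z = (h ^ d : ℂ)⁻¹ * ∫ η, latChar d z η *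
      ((h ^ 2 : ℂ)⁻¹ * latSymbol d η * (conj (𝓕 φ η) * g (h⁻¹ • η))) := by
  have hg2 : MemLp g 2 volume := (memLp_congr_ae hg).mp (Lp.memLp _)
  have hi := integrable_conj_mul ((𝓕 φ).memLp 2 volume) (MemLp.comp_inv_smul hg2 hh)
  rw [← discLap_integral_latChar h _ hi]
  congr 1
  exact funext fun z => projFun_eq φ hh hu hg z

lemma integrable_latChar_latSymbol_mul (a : ℂ) {G : Euc d → ℂ} (hG : Integrable G) (z : Zd d) :
    Integrable fun η => latChar d z η * (a * latSymbol d η * G η) := by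
  have h (η : Euc d) : ‖latChar d z η * (a * latSymbol d η)‖ ≤ ‖a‖ * ∑ _j : Fin d, 4 := by
    rw [norm_mul, norm_latChar, one_mul, norm_mul, Complex.norm_real, latSymbol,
      Real.norm_of_nonneg (by positivity)]
    gcongr with j
    have := Real.sin_sq_le_one (π * η j)
    linarith
  have hc : Continuous fun η => latChar d z η * (a * latSymbol d η) := by
    have h1 := continuous_latChar d z
    have h2 := continuous_latSymbol (d := d)
    fun_prop
  refine (hG.bdd_mul hc.aestronglyMeasurable (.of_forall h)).congr (.of_forall fun η => ?_)
  simp only [mul_assoc]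

/-- The relative error between the symbols of `-Δ` and of the discrete Laplacian,
on the support of `𝓕 φ`. -/
def symbolError (φ : 𝓢(Euc d, ℂ)) : Euc d → ℝ :=
  {η | 𝓕 φ η ≠ 0}.indicator fun η => (4 * π ^ 2 * ‖η‖ ^ 2 - latSymbol d η) / latSymbol d η

lemma measurable_symbolError (φ : 𝓢(Euc d, ℂ)) : Measurable (symbolError φ) := by
  have h : MeasurableSet {η | 𝓕 φ η ≠ 0} := by
    have : IsOpen {η | 𝓕 φ η ≠ 0} := (𝓕 φ).continuous.isOpen_preimage _ isOpen_compl_singleton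
    exact this.measurableSet
  refine Measurable.indicator ?_ h
  have := (continuous_latSymbol (d := d)).measurable
  fun_prop

section

variable {φ : 𝓢(Euc d, ℂ)} {δ : ℝ}

lemma abs_symbolError_le (hδ : ∀ ξ, 𝓕 φ ξ ≠ 0 → ∀ j, |ξ j| ≤ 1 - δ)
    (hδ0 : 0 < δ) (hδ2 : δ ≤ 1 / 2)
    (η : Euc d) : |symbolError φ η| ≤ π ^ 4 / (4 * δ ^ 2) * ‖η‖ ^ 2 := by
  by_cases h : 𝓕 φ η = 0
  · rw [symbolError, Set.indicator_of_notMem (by simpa using h), abs_zero]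
    positivity
  rw [symbolError, Set.indicator_of_mem (by simpa using h)]
  obtain ⟨h1, h2⟩ := norm_sq_sub_latSymbol η
  have h3 := le_latSymbol hδ0 hδ2 (hδ η h)
  rcases eq_or_ne η 0 with rfl | h0
  · simp [latSymbol]
  have hη : 0 < ‖η‖ ^ 2 := by positivity
  have h4 : 0 < latSymbol d η := lt_of_lt_of_le (by positivity) h3
  rw [abs_of_nonneg (by positivity), div_le_iff₀ h4]
  refine h2.trans ?_
  calc 4 * π ^ 4 * (‖η‖ ^ 2) ^ 2 = π ^ 4 / (4 * δ ^ 2) * ‖η‖ ^ 2 * (16 * δ ^ 2 * ‖η‖ ^ 2) := by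
        field_simp; ring
    _ ≤ _ := by gcongr

lemma latSymbol_mul_symbolError (hδ : ∀ ξ, 𝓕 φ ξ ≠ 0 → ∀ j, |ξ j| ≤ 1 - δ)
    (hδ0 : 0 < δ) (hδ2 : δ ≤ 1 / 2)
    {η : Euc d} (h : 𝓕 φ η ≠ 0) :
    latSymbol d η * symbolError φ η = 4 * π ^ 2 * ‖η‖ ^ 2 - latSymbol d η := by
  rw [symbolError, Set.indicator_of_mem (by simpa using h)]
  have h3 := le_latSymbol hδ0 hδ2 (hδ η h)
  rcases eq_or_ne η 0 with rfl | h0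
  · simp [latSymbol]
  have h4 : 0 < latSymbol d η := lt_of_lt_of_le (by positivity) h3
  field_simp

lemma exists_kinetic_remainder (hδ : ∀ ξ, 𝓕 φ ξ ≠ 0 → ∀ j, |ξ j| ≤ 1 - δ)
    (hδ0 : 0 < δ) (hδ2 : δ ≤ 1 / 2)
    {h : ℝ} (hh : 0 < h) {u : Euc d → ℂ} (hu : ContDiff ℝ (⊤ : ℕ∞) u)
    (hc : HasCompactSupport u) (hu2 : MemLp u 2 volume) :
    ∃ v : L2 d, ‖v‖ ≤ π ^ 4 / (4 * δ ^ 2) * ((4 * π ^ 2)⁻¹ * lpNorm (lapl d u) 2 volume) ∧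
      ∀ z, projFun φ h (fun x => -lapl d u x) z - discLap d h (projFun φ h u) z =
        h ^ 2 * discLap d h (projFun φ h v) z := by
  have hl := memLp_lapl hu hc
  set U := ⇑(𝓕 (hu2.toLp u) : L2 d) with hU
  let g : Euc d → ℂ := fun ξ => (((h ^ 2)⁻¹ * symbolError φ (h • ξ) : ℝ) : ℂ) * U ξ
  have hUm : AEStronglyMeasurable U volume := Lp.aestronglyMeasurable _
  have hgm : AEStronglyMeasurable g volume := by
    refine AEStronglyMeasurable.mul (Measurable.aestronglyMeasurable ?_) hUm
    have := measurable_symbolError φ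
    fun_prop
  have h0 : (h : ℂ) ≠ 0 := by exact_mod_cast hh.ne'
  obtain ⟨k1, k2⟩ := norm_lapl_fourier hu hc hu2
  obtain ⟨hg, hgn⟩ := lpNorm_le_mul_of_norm_le (C := π ^ 4 / (4 * δ ^ 2)) hgm k1 (by positivity)
    fun ξ => by
      simp only [g]
      rw [norm_mul, norm_mul, ← mul_assoc, Complex.norm_real, Complex.norm_real, norm_mul,
        Real.norm_of_nonneg (by positivity : (0 : ℝ) ≤ (h ^ 2)⁻¹),
        Real.norm_of_nonneg (by positivity : (0 : ℝ) ≤ ‖ξ‖ ^ 2)]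
      refine mul_le_mul_of_nonneg_right ?_ (norm_nonneg _)
      have := abs_symbolError_le hδ hδ0 hδ2 (h • ξ)
      rw [norm_smul, mul_pow, Real.norm_of_nonneg hh.le] at this
      rw [inv_mul_le_iff₀ (by positivity), Real.norm_eq_abs]
      linarith
  obtain ⟨v, hv, hvn⟩ := exists_fourier_eq hg
  refine ⟨v, by rw [hvn, ← k2]; exact hgn, fun z => ?_⟩
  have hv2 : (𝓕 ((Lp.memLp v).toLp v) : L2 d) =ᵐ[volume] g := by rwa [Lp.toLp_coeFn]
  have hg2 := MemLp.comp_inv_smul hg hh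
  have hU2 : MemLp U 2 volume := Lp.memLp _
  have hf := fourier_lapl hu hc hu2 hl
  rw [projFun_neg, projFun_eq φ hh hl hf, discLap_projFun φ hh hu2 (g := U) (by rfl),
    discLap_projFun φ hh (Lp.memLp v) hv2]
  have i1 := integrable_latChar_latSymbol_mul (h ^ 2 : ℂ)⁻¹
    (integrable_conj_mul ((𝓕 φ).memLp 2 volume) (MemLp.comp_inv_smul hU2 hh)) z
  have i2 := integrable_latChar_latSymbol_mul (h ^ 2 : ℂ)⁻¹
    (integrable_conj_mul ((𝓕 φ).memLp 2 volume) hg2) z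
  rw [← mul_neg, ← mul_sub, mul_left_comm, ← integral_neg, ← integral_const_mul]
  congr 1
  rw [sub_eq_iff_eq_add, ← integral_add (i2.const_mul _) i1]
  refine integral_congr_ae (.of_forall fun η => ?_)
  simp only [g, smul_inv_smul₀ hh.ne']
  by_cases hη : 𝓕 φ η = 0
  · simp [hη]
  have e := latSymbol_mul_symbolError hδ hδ0 hδ2 hη
  have e2 : (latSymbol d η : ℂ) * symbolError φ η = 4 * π ^ 2 * ‖η‖ ^ 2 - latSymbol d η := by
    exact_mod_cast e
  rw [norm_smul, Real.norm_of_nonneg (inv_nonneg.mpr hh.le)]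
  rw [← hU]
  generalize U (h⁻¹ • η) = q
  push_cast
  field_simp
  linear_combination (-latChar d z η * conj (𝓕 φ η) * q) * e2

lemma norm_integral_kinetic_error_le (hδ : ∀ ξ, 𝓕 φ ξ ≠ 0 → ∀ j, |ξ j| ≤ 1 - δ)
    (hδ0 : 0 < δ) (hδ2 : δ ≤ 1 / 2)
    (hφ : ∀ ξ : Euc d, ∑' n : Zd d, ‖𝓕 φ (ξ + latVec d n)‖ ^ 2 = 1)
    {h : ℝ} (hh : 0 < h) {u : Euc d → ℂ} (hu : ContDiff ℝ (⊤ : ℕ∞) u) (hc : HasCompactSupport u)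
    (hu2 : MemLp u 2 volume) {w : Zd d → ℂ} (hw : MemLp w 2 (latMeas d h)) :
    ‖∫ z, conj (projFun φ h (fun x => -lapl d u x) z - discLap d h (projFun φ h u) z) * w z
      ∂latMeas d h‖ ≤ h ^ 2 * ((π ^ 4 / (4 * δ ^ 2) * (4 * π ^ 2)⁻¹) * lpNorm (lapl d u) 2 volume *
        lpNorm (discLap d h w) 2 (latMeas d h)) := by
  obtain ⟨v, hv, he⟩ := exists_kinetic_remainder hδ hδ0 hδ2 hh hu hc hu2
  have hP : MemLp (projFun φ h v) 2 (latMeas d h) :=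
    (lpNorm_projFun_sq hφ hδ hδ0 hh (Lp.memLp v) (by rfl)).1
  have hPn := lpNorm_projFun_le hφ hδ hδ0 hh (Lp.memLp v)
  rw [lpNorm_coeFn] at hPn
  simp only [he, map_mul, map_pow, Complex.conj_ofReal, mul_assoc]
  rw [integral_const_mul, integral_conj_discLap_mul hP hw, norm_mul, norm_pow, Complex.norm_real,
    Real.norm_of_nonneg hh.le]
  gcongr
  refine (norm_integral_conj_mul_le hP (memLp_discLap hw)).trans ?_
  rw [← mul_assoc, ← mul_assoc]
  refine mul_le_mul_of_nonneg_right (hPn.trans (hv.trans_eq (by ring))) lpNorm_nonneg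

end

end KineticError

lemma summable_inv_one_add_sq : Summable fun m : ℤ => (1 + (m : ℝ) ^ 2)⁻¹ := by
  refine (Real.summable_one_div_int_pow.mpr one_lt_two).of_norm_bounded_eventually ?_
  have h : ∀ᶠ m : ℤ in Filter.cofinite, m ≠ 0 :=
    (Set.finite_singleton 0).eventually_cofinite_notMem
  filter_upwards [h] with m hm
  have : (m : ℝ) ≠ 0 := by exact_mod_cast hm
  rw [Real.norm_of_nonneg (by positivity), one_div]
  gcongr
  linarith

lemma exists_sum_inv_one_add_sq_le :
    ∃ S : ℝ, ∀ (y : ℝ) (t : Finset ℤ), ∑ k ∈ t, (1 + (y - k) ^ 2)⁻¹ ≤ S := by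
  refine ⟨3 * ∑' m : ℤ, (1 + (m : ℝ) ^ 2)⁻¹, fun y t => ?_⟩
  calc ∑ k ∈ t, (1 + (y - k) ^ 2)⁻¹ ≤ ∑ k ∈ t, 3 * (1 + ((⌊y⌋ - k : ℤ) : ℝ) ^ 2)⁻¹ := by
        refine Finset.sum_le_sum fun k _ => ?_
        rw [← div_eq_mul_inv, inv_eq_one_div, div_le_div_iff₀ (by positivity) (by positivity)]
        push_cast
        have h1 := Int.fract_nonneg y
        have h2 := (Int.fract_lt_one y).le
        have h3 : y = ⌊y⌋ + Int.fract y := (Int.floor_add_fract y).symm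
        generalize Int.fract y = f at *
        generalize (⌊y⌋ : ℝ) = n at *
        rw [h3]
        nlinarith [sq_nonneg (n - k + 2 * f)]
    _ = 3 * ∑ m ∈ t.image (fun k => ⌊y⌋ - k), (1 + (m : ℝ) ^ 2)⁻¹ := by
        rw [← Finset.mul_sum, Finset.sum_image (fun a _ b _ h => by simpa using h)]
    _ ≤ _ := by
        gcongr
        exact summable_inv_one_add_sq.sum_le_tsum _ fun m _ => by positivity

section Kernel

variable {d : ℕ}

/-- An integrable radial kernel with uniformly bounded lattice sums. -/
def decayKernel (d : ℕ) (y : Euc d) : ℝ := ((1 + ‖y‖) ^ (2 * d + 1))⁻¹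

lemma decayKernel_pos (y : Euc d) : 0 < decayKernel d y := by
  unfold decayKernel
  positivity

lemma continuous_decayKernel : Continuous (decayKernel d) := by
  unfold decayKernel
  exact Continuous.inv₀ (by fun_prop) fun y => by positivity

lemma integrable_decayKernel : Integrable (decayKernel d) := by
  have h := integrable_one_add_norm (E := Euc d) (μ := volume) (r := ((2 * d + 1 : ℕ) : ℝ)) (by
    rw [finrank_euclideanSpace, Fintype.card_fin]
    push_cast
    linarith [Nat.cast_nonneg (α := ℝ) d])
  refine h.congr (.of_forall fun y => ?_)
  simp only [decayKernel]
  rw [Real.rpow_neg (by positivity), Real.rpow_natCast]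

lemma exists_sum_decayKernel_le (d : ℕ) :
    ∃ S : ℝ, 0 ≤ S ∧ ∀ (y : Euc d) (s : Finset (Zd d)),
      ∑ z ∈ s, decayKernel d (y - latVec d z) ≤ S := by
  classical
  obtain ⟨S, hS⟩ := exists_sum_inv_one_add_sq_le
  have hS0 : 0 ≤ S := by simpa using hS 0 ∅
  refine ⟨S ^ d, by positivity, fun y s => ?_⟩
  calc ∑ z ∈ s, decayKernel d (y - latVec d z)
      ≤ ∑ z ∈ s, ∏ j, (1 + (y j - z j) ^ 2)⁻¹ := by
        refine Finset.sum_le_sum fun z _ => ?_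
        rw [decayKernel, Finset.prod_inv_distrib]
        gcongr
        set x := y - latVec d z with hx
        calc ∏ j, (1 + (y j - z j) ^ 2) ≤ ∏ _j : Fin d, (1 + ‖x‖) ^ 2 := by
              refine Finset.prod_le_prod (fun j _ => by positivity) fun j _ => ?_
              have h1 : ‖x j‖ ≤ ‖x‖ := PiLp.norm_apply_le x j
              have h2 : y j - z j = x j := by simp [hx]
              rw [h2, ← sq_abs, ← Real.norm_eq_abs]
              nlinarith [norm_nonneg (x j)]
          _ = (1 + ‖x‖) ^ (2 * d) := by
              rw [Finset.prod_const, Finset.card_univ, Fintype.card_fin, ← pow_mul]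
          _ ≤ _ := pow_le_pow_right₀ (by linarith [norm_nonneg x]) (by omega)
    _ ≤ ∑ z ∈ Fintype.piFinset fun j => s.image (fun z => z j), ∏ j, (1 + (y j - z j) ^ 2)⁻¹ := by
        refine Finset.sum_le_sum_of_subset_of_nonneg (fun z hz => ?_) fun z _ _ => by positivity
        exact Fintype.mem_piFinset.mpr fun j => Finset.mem_image_of_mem _ hz
    _ = ∏ j, ∑ k ∈ s.image (fun z => z j), (1 + (y j - k) ^ 2)⁻¹ :=
        (Finset.prod_univ_sum _ fun j (k : ℤ) => (1 + (y j - k) ^ 2)⁻¹).symm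
    _ ≤ ∏ _j : Fin d, S := Finset.prod_le_prod (fun j _ => by positivity) fun j _ => hS _ _
    _ = S ^ d := by simp

open scoped SchwartzMap in
lemma exists_schwartz_le_decayKernel (φ : 𝓢(Euc d, ℂ)) {α : ℝ} (hα0 : 0 < α) (hα1 : α ≤ 1) :
    ∃ A : ℝ, 0 ≤ A ∧ ∀ y, ‖φ y‖ * ‖y‖ ^ α ≤ A * decayKernel d y := by
  have h := SchwartzMap.one_add_le_sup_seminorm_apply (𝕜 := ℂ) (m := (2 * d + 2, 0))
    (k := 2 * d + 2) (n := 0) le_rfl le_rfl φ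
  simp only [norm_iteratedFDeriv_zero] at h
  refine ⟨_, le_trans (by positivity) (h 0), fun y => ?_⟩
  rw [decayKernel, ← div_eq_mul_inv, le_div_iff₀ (by positivity)]
  refine le_trans ?_ (h y)
  have h1 : ‖y‖ ^ α ≤ 1 + ‖y‖ := by
    have h2 : (1 : ℝ) ≤ 1 + ‖y‖ := by linarith [norm_nonneg y]
    calc ‖y‖ ^ α ≤ (1 + ‖y‖) ^ α :=
          Real.rpow_le_rpow (norm_nonneg y) (by linarith) hα0.le
      _ ≤ (1 + ‖y‖) ^ (1 : ℝ) := Real.rpow_le_rpow_of_exponent_le h2 hα1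
      _ = _ := Real.rpow_one _
  calc ‖φ y‖ * ‖y‖ ^ α * (1 + ‖y‖) ^ (2 * d + 1)
      ≤ ‖φ y‖ * (1 + ‖y‖) * (1 + ‖y‖) ^ (2 * d + 1) := by gcongr
    _ = _ := by ring

end Kernel

lemma integrable_mul_norm_sq {X : Type*} [MeasurableSpace X] {m : Measure X} {k : X → ℝ}
    {F : X → ℂ} (hk0 : ∀ x, 0 ≤ k x) (hk1 : ∀ x, k x ≤ 1) (hk : AEStronglyMeasurable k m)
    (hF : MemLp F 2 m) : Integrable (fun x => k x * ‖F x‖ ^ 2) m :=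
  (integrable_norm_sq hF).bdd_mul (c := 1) hk
    (.of_forall fun x => by rw [Real.norm_of_nonneg (hk0 x)]; exact hk1 x)

lemma sq_integral_mul_norm_le {X : Type*} [MeasurableSpace X] {m : Measure X} {k : X → ℝ}
    {F : X → ℂ} (hk0 : ∀ x, 0 ≤ k x) (hk1 : ∀ x, k x ≤ 1) (hk : Integrable k m)
    (hF : MemLp F 2 m) :
    (∫ x, k x * ‖F x‖ ∂m) ^ 2 ≤ (∫ x, k x ∂m) * ∫ x, k x * ‖F x‖ ^ 2 ∂m := by
  have hi := integrable_mul_norm_sq hk0 hk1 hk.1 hF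
  have hm : AEStronglyMeasurable (fun x => ((√(k x) : ℝ) : ℂ)) m :=
    (hk.1.aemeasurable.sqrt.complex_ofReal).aestronglyMeasurable
  have hm2 : AEStronglyMeasurable (fun x => ((√(k x) : ℝ) : ℂ) * ((‖F x‖ : ℝ) : ℂ)) m :=
    hm.mul (hF.1.norm.aemeasurable.complex_ofReal).aestronglyMeasurable
  have e1 (x : X) : ‖((√(k x) : ℝ) : ℂ)‖ ^ 2 = k x := by
    rw [Complex.norm_real, Real.norm_of_nonneg (Real.sqrt_nonneg _), Real.sq_sqrt (hk0 x)]
  have e2 (x : X) : ‖((√(k x) : ℝ) : ℂ) * ((‖F x‖ : ℝ) : ℂ)‖ ^ 2 = k x * ‖F x‖ ^ 2 := by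
    rw [norm_mul, mul_pow, e1, Complex.norm_real, norm_norm]
  have hf : MemLp (fun x => ((√(k x) : ℝ) : ℂ)) 2 m := by
    rw [memLp_two_iff_integrable_sq_norm hm]
    simpa only [e1] using hk
  have hg : MemLp (fun x => ((√(k x) : ℝ) : ℂ) * ((‖F x‖ : ℝ) : ℂ)) 2 m := by
    rw [memLp_two_iff_integrable_sq_norm hm2]
    simpa only [e2] using hi
  have h := norm_integral_conj_mul_le hf hg
  have e3 : ∫ x, conj ((√(k x) : ℝ) : ℂ) * (((√(k x) : ℝ) : ℂ) * ((‖F x‖ : ℝ) : ℂ)) ∂m =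
      ((∫ x, k x * ‖F x‖ ∂m : ℝ) : ℂ) := by
    rw [← integral_complex_ofReal]
    refine integral_congr_ae (.of_forall fun x => ?_)
    simp only [Complex.conj_ofReal]
    rw [← mul_assoc, ← Complex.ofReal_mul, ← Complex.ofReal_mul, Real.mul_self_sqrt (hk0 x)]
  rw [e3, Complex.norm_real, Real.norm_of_nonneg (integral_nonneg fun x =>
    mul_nonneg (hk0 x) (norm_nonneg _))] at h
  have h2 := pow_le_pow_left₀ (integral_nonneg fun x => mul_nonneg (hk0 x) (norm_nonneg _)) h 2
  rw [mul_pow, lpNorm_two_sq hf, lpNorm_two_sq hg] at h2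
  simpa only [e1, e2] using h2

section Schur

variable {d : ℕ}

/-- Lattice samples of `‖F‖` smeared by the decay kernel. -/
def smear (h : ℝ) (F : Euc d → ℂ) (z : Zd d) : ℝ :=
  (h ^ d)⁻¹ * ∫ x, decayKernel d (h⁻¹ • (x - latPt d h z)) * ‖F x‖

lemma decayKernel_le_one (y : Euc d) : decayKernel d y ≤ 1 := by
  rw [decayKernel]
  exact inv_le_one_of_one_le₀ (one_le_pow₀ (by linarith [norm_nonneg y]))

lemma integral_decayKernel_scaled {h : ℝ} (hh : 0 < h) (p : Euc d) :
    Integrable (fun x => decayKernel d (h⁻¹ • (x - p))) ∧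
    ∫ x, decayKernel d (h⁻¹ • (x - p)) = h ^ d * ∫ x, decayKernel d x := by
  refine ⟨(integrable_decayKernel.comp_smul (inv_ne_zero hh.ne')).comp_sub_right p, ?_⟩
  rw [integral_sub_right_eq_self (fun x => decayKernel d (h⁻¹ • x)),
    Measure.integral_comp_inv_smul_of_nonneg (volume : Measure (Euc d)) _ hh.le]
  simp

lemma exists_lpNorm_smear_le (d : ℕ) :
    ∃ S : ℝ, 0 ≤ S ∧ ∀ h : ℝ, 0 < h → ∀ F : Euc d → ℂ, MemLp F 2 volume →
      MemLp (fun z => (smear h F z : ℂ)) 2 (latMeas d h) ∧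
      lpNorm (fun z => (smear h F z : ℂ)) 2 (latMeas d h) ≤ S * lpNorm F 2 volume := by
  obtain ⟨S, hS0, hS⟩ := exists_sum_decayKernel_le d
  set J := ∫ x, decayKernel d x with hJ
  have hJ0 : 0 ≤ J := integral_nonneg fun x => (decayKernel_pos x).le
  refine ⟨√(J * S), Real.sqrt_nonneg _, fun h hh F hF => ?_⟩
  have hd : 0 < h ^ d := by positivity
  have hk (z : Zd d) := integral_decayKernel_scaled hh (latPt d h z)
  have hi (z : Zd d) : Integrable fun x => decayKernel d (h⁻¹ • (x - latPt d h z)) * ‖F x‖ ^ 2 :=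
    integrable_mul_norm_sq (fun x => (decayKernel_pos _).le) (fun x => decayKernel_le_one _)
      (hk z).1.1 hF
  have h1 (z : Zd d) : ‖(smear h F z : ℂ)‖ ^ 2 ≤ (h ^ d)⁻¹ * J *
      ∫ x, decayKernel d (h⁻¹ • (x - latPt d h z)) * ‖F x‖ ^ 2 := by
    have h2 := sq_integral_mul_norm_le (fun x => (decayKernel_pos _).le)
      (fun x => decayKernel_le_one _) (hk z).1 hF
    rw [(hk z).2, ← hJ] at h2
    rw [Complex.norm_real, Real.norm_eq_abs, sq_abs, smear, mul_pow]
    refine (mul_le_mul_of_nonneg_left h2 (by positivity)).trans_eq ?_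
    field_simp
  have h3 (s : Finset (Zd d)) : ∑ z ∈ s, ‖(smear h F z : ℂ)‖ ^ 2 ≤
      (h ^ d)⁻¹ * (J * S * lpNorm F 2 volume ^ 2) := by
    calc _ ≤ ∑ z ∈ s, (h ^ d)⁻¹ * J *
          ∫ x, decayKernel d (h⁻¹ • (x - latPt d h z)) * ‖F x‖ ^ 2 :=
          Finset.sum_le_sum fun z _ => h1 z
      _ = (h ^ d)⁻¹ * J * ∫ x, (∑ z ∈ s, decayKernel d (h⁻¹ • (x - latPt d h z))) * ‖F x‖ ^ 2 := by
          rw [← Finset.mul_sum, ← integral_finsetSum _ fun z _ => hi z]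
          simp only [Finset.sum_mul]
      _ ≤ (h ^ d)⁻¹ * J * ∫ x, S * ‖F x‖ ^ 2 := by
          gcongr
          · simp only [Finset.sum_mul]
            exact integrable_finsetSum _ fun z _ => hi z
          · exact (integrable_norm_sq hF).const_mul _
          intro x
          simp only
          gcongr
          refine (hS (h⁻¹ • x) s).trans' (le_of_eq (Finset.sum_congr rfl fun z _ => ?_))
          congr 1
          ext j
          simp [mul_sub, inv_mul_cancel_left₀ hh.ne']
      _ = _ := by rw [integral_const_mul, ← lpNorm_two_sq hF]; ring
  have hs : Summable fun z => ‖(smear h F z : ℂ)‖ ^ 2 :=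
    summable_of_sum_le (fun z => by positivity) h3
  have hm := memLp_latMeas_of_summable (h := h) hs
  refine ⟨hm, ?_⟩
  have h4 := hasSum_le_of_sum_le (lpNorm_latMeas_sq hh hm) h3
  rw [mul_le_mul_iff_right₀ (by positivity)] at h4
  refine le_of_sq_le_sq ?_ (mul_nonneg (Real.sqrt_nonneg _) lpNorm_nonneg)
  rw [mul_pow, Real.sq_sqrt (by positivity)]
  exact h4

end Schur

section Potential

variable {d : ℕ}

open scoped SchwartzMap

lemma norm_projFun_weight_sub_le {φ : 𝓢(Euc d, ℂ)} {W : Euc d → ℝ} (hWc : Continuous W)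
    (hW0 : ∀ x, 0 < W x) {L α A : ℝ} (hL : 0 ≤ L)
    (hWL : ∀ x y, |W x - W y| ≤ L * dist x y ^ α * (W x * W y))
    (hA : ∀ y, ‖φ y‖ * ‖y‖ ^ α ≤ A * decayKernel d y) {h : ℝ} (hh : 0 < h) {u : Euc d → ℂ}
    (hu : Continuous u) (hc : HasCompactSupport u) (z : Zd d) :
    ‖projFun φ h (fun x => W x * u x) z - W (latPt d h z) * projFun φ h u z‖ ≤
      L * A * h ^ α * (W (latPt d h z) * smear h (fun x => W x * u x) z) := by
  set p := latPt d h z with hp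
  have hφc : Continuous φ := φ.continuous
  have hcWu : HasCompactSupport fun x => (W x : ℂ) * u x := hc.mul_left
  have i1 : Integrable fun x => conj (φ (h⁻¹ • (x - p))) * (W x * u x) := by
    refine Continuous.integrable_of_hasCompactSupport (by fun_prop) hcWu.mul_left
  have i2 : Integrable fun x => conj (φ (h⁻¹ • (x - p))) * u x := by
    refine Continuous.integrable_of_hasCompactSupport (by fun_prop) hc.mul_left
  have i3 : Integrable fun x => decayKernel d (h⁻¹ • (x - p)) * ‖(W x : ℂ) * u x‖ := by
    have := continuous_decayKernel (d := d)
    refine Continuous.integrable_of_hasCompactSupport (by fun_prop) hcWu.norm.mul_left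
  have e : projFun φ h (fun x => W x * u x) z - W p * projFun φ h u z = (h ^ d : ℂ)⁻¹ *
      ∫ x, conj (φ (h⁻¹ • (x - p))) * (((W x - W p : ℝ) : ℂ) * u x) := by
    rw [projFun, projFun, mul_left_comm, ← mul_sub, ← integral_const_mul, ← hp,
      ← integral_sub i1 (i2.const_mul _)]
    congr 1
    refine integral_congr_ae (.of_forall fun x => ?_)
    simp only
    push_cast
    ring
  rw [e, norm_mul, norm_inv, norm_pow, Complex.norm_real, Real.norm_of_nonneg hh.le, smear]
  have key : ‖∫ x, conj (φ (h⁻¹ • (x - p))) * (((W x - W p : ℝ) : ℂ) * u x)‖ ≤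
      ∫ x, L * A * h ^ α * W p * (decayKernel d (h⁻¹ • (x - p)) * ‖(W x : ℂ) * u x‖) := by
    refine norm_integral_le_of_norm_le (i3.const_mul _) (.of_forall fun x => ?_)
    rw [norm_mul, norm_mul, norm_mul, RCLike.norm_conj, Complex.norm_real, Complex.norm_real,
      Real.norm_of_nonneg (hW0 x).le, Real.norm_eq_abs]
    have h1 : dist x p ^ α = h ^ α * ‖h⁻¹ • (x - p)‖ ^ α := by
      rw [← Real.mul_rpow hh.le (norm_nonneg _), norm_smul, norm_inv, Real.norm_of_nonneg hh.le,
        mul_inv_cancel_left₀ hh.ne', dist_eq_norm]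
    have h2 := hWL x p
    rw [h1] at h2
    have h3 := hA (h⁻¹ • (x - p))
    have hx := (hW0 x).le
    have hpp := (hW0 p).le
    calc ‖φ (h⁻¹ • (x - p))‖ * (|W x - W p| * ‖u x‖)
        ≤ ‖φ (h⁻¹ • (x - p))‖ * (L * (h ^ α * ‖h⁻¹ • (x - p)‖ ^ α) * (W x * W p) * ‖u x‖) := by
          gcongr
      _ = L * h ^ α * W p * (W x * ‖u x‖) * (‖φ (h⁻¹ • (x - p))‖ * ‖h⁻¹ • (x - p)‖ ^ α) := by ring
      _ ≤ L * h ^ α * W p * (W x * ‖u x‖) * (A * decayKernel d (h⁻¹ • (x - p))) := by gcongr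
      _ = _ := by ring
  rw [integral_const_mul] at key
  refine (mul_le_mul_of_nonneg_left key (by positivity)).trans_eq ?_
  ring

lemma exists_potential_error_le (φ : 𝓢(Euc d, ℂ)) {W : Euc d → ℝ} (hWc : Continuous W)
    (hW0 : ∀ x, 0 < W x) {L α : ℝ} (hL : 0 ≤ L) (hα0 : 0 < α) (hα1 : α ≤ 1)
    (hWL : ∀ x y, |W x - W y| ≤ L * dist x y ^ α * (W x * W y)) :
    ∃ C : ℝ, 0 ≤ C ∧ ∀ h : ℝ, 0 < h → ∀ u : Euc d → ℂ, Continuous u → HasCompactSupport u →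
      ∀ w : Zd d → ℂ, MemLp (fun z => (W (latPt d h z) : ℂ) * w z) 2 (latMeas d h) →
      ‖∫ z, conj (projFun φ h (fun x => W x * u x) z - W (latPt d h z) * projFun φ h u z) * w z
        ∂latMeas d h‖ ≤ C * h ^ α * (lpNorm (fun x => (W x : ℂ) * u x) 2 volume *
          lpNorm (fun z => (W (latPt d h z) : ℂ) * w z) 2 (latMeas d h)) := by
  obtain ⟨A, hA0, hA⟩ := exists_schwartz_le_decayKernel φ hα0 hα1
  obtain ⟨S, hS0, hS⟩ := exists_lpNorm_smear_le d
  refine ⟨L * A * S, by positivity, fun h hh u hu hc w hw => ?_⟩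
  have hWu : MemLp (fun x => (W x : ℂ) * u x) 2 volume :=
    Continuous.memLp_of_hasCompactSupport (by fun_prop) hc.mul_left
  obtain ⟨s1, s2⟩ := hS h hh _ hWu
  let D : Zd d → ℂ := fun z => ((W (latPt d h z) : ℝ) : ℂ)⁻¹ *
    (projFun φ h (fun x => W x * u x) z - W (latPt d h z) * projFun φ h u z)
  obtain ⟨d1, d2⟩ := lpNorm_le_mul_of_norm_le (f := D) (C := L * A * h ^ α)
    (aestronglyMeasurable_latMeas D) s1 (by positivity) fun z => by
      have h1 := norm_projFun_weight_sub_le hWc hW0 hL hWL hA hh hu hc z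
      have hz := hW0 (latPt d h z)
      simp only [D]
      rw [norm_mul, norm_inv, Complex.norm_real, Real.norm_of_nonneg hz.le, Complex.norm_real,
        inv_mul_le_iff₀ hz]
      refine h1.trans ?_
      have h2 : smear h (fun x => W x * u x) z ≤ ‖smear h (fun x => W x * u x) z‖ := le_abs_self _
      calc _ ≤ L * A * h ^ α * (W (latPt d h z) * ‖smear h (fun x => W x * u x) z‖) := by gcongr
        _ = _ := by ring
  have e (z : Zd d) :
      conj (projFun φ h (fun x => W x * u x) z - W (latPt d h z) * projFun φ h u z) * w z =
      conj (D z) * ((W (latPt d h z) : ℂ) * w z) := by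
    have hz : (W (latPt d h z) : ℂ) ≠ 0 := by exact_mod_cast (hW0 (latPt d h z)).ne'
    simp only [D, map_mul, map_inv₀, Complex.conj_ofReal]
    field_simp
  simp only [e]
  refine (norm_integral_conj_mul_le d1 hw).trans ?_
  calc _ ≤ (L * A * h ^ α * (S * lpNorm (fun x => (W x : ℂ) * u x) 2 volume)) *
        lpNorm (fun z => (W (latPt d h z) : ℂ) * w z) 2 (latMeas d h) := by
        refine mul_le_mul_of_nonneg_right (d2.trans ?_) lpNorm_nonneg
        exact mul_le_mul_of_nonneg_left s2 (by positivity)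
    _ = _ := by ring

end Potential

lemma inner_Lp_two_eq_integral {X : Type*} [MeasurableSpace X] {m : Measure X} (f g : Lp ℂ 2 m) :
    ⟪f, g⟫_ℂ = ∫ x, conj (f x) * g x ∂m := by
  have h := inner_toLp_toLp (Lp.memLp f) (Lp.memLp g)
  rwa [Lp.toLp_coeFn, Lp.toLp_coeFn] at h

lemma norm_le_of_norm_inner_le {E : Type*} [NormedAddCommGroup E] [InnerProductSpace ℂ E] {x : E}
    {B : ℝ} (hB : 0 ≤ B) (h : ∀ v, ‖⟪x, v⟫_ℂ‖ ≤ B * ‖v‖) : ‖x‖ ≤ B := by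
  have h1 := h x
  rw [inner_self_eq_norm_sq_to_K, norm_pow, RCLike.norm_ofReal, abs_norm, sq] at h1
  rcases (norm_nonneg x).eq_or_lt with h0 | h0
  · rwa [← h0]
  · exact le_of_mul_le_mul_right h1 h0

section Assembly

variable {d : ℕ}

open scoped SchwartzMap

lemma projFun_toLp (φ : 𝓢(Euc d, ℂ)) (h : ℝ) {f : Euc d → ℂ} (hf : MemLp f 2 volume) :
    projFun φ h (hf.toLp f) = projFun φ h f := by
  funext z
  rw [projFun, projFun]
  congr 1
  refine integral_congr_ae ?_
  filter_upwards [hf.coeFn_toLp] with x hx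
  rw [hx]

lemma projFun_linear_comb (φ : 𝓢(Euc d, ℂ)) (h : ℝ) {a b u : Euc d → ℂ} (ha : Continuous a)
    (ha2 : HasCompactSupport a) (hb : Continuous b) (hb2 : HasCompactSupport b)
    (hu : Continuous u) (hu2 : HasCompactSupport u) (κ : ℂ) (z : Zd d) :
    projFun φ h (fun x => a x + b x - κ * u x) z =
      projFun φ h a z + projFun φ h b z - κ * projFun φ h u z := by
  have hφc : Continuous φ := φ.continuous
  have hi {f : Euc d → ℂ} (hf : Continuous f) (hf2 : HasCompactSupport f) :
      Integrable fun x => conj (φ (h⁻¹ • (x - latPt d h z))) * f x :=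
    Continuous.integrable_of_hasCompactSupport (by fun_prop) hf2.mul_left
  rw [projFun, projFun, projFun, projFun, mul_left_comm κ, ← mul_add, ← mul_sub,
    ← integral_const_mul κ, ← integral_add (hi ha ha2) (hi hb hb2),
    ← integral_sub (f := fun x => conj (φ (h⁻¹ • (x - latPt d h z))) * a x +
      conj (φ (h⁻¹ • (x - latPt d h z))) * b x) ((hi ha ha2).add (hi hb hb2))
      ((hi hu hu2).const_mul κ)]
  congr 1
  refine integral_congr_ae (.of_forall fun x => ?_)
  simp only
  ring

lemma integral_resolvent_error {h : ℝ} {p q r w : Zd d → ℂ} {b : Zd d → ℝ}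
    (hp : MemLp p 2 (latMeas d h)) (hq : MemLp q 2 (latMeas d h)) (hr : MemLp r 2 (latMeas d h))
    (hw : MemLp w 2 (latMeas d h)) (hbw : MemLp (fun z => (b z : ℂ) * w z) 2 (latMeas d h))
    (κ : ℂ) :
    (∫ z, conj (q z + r z - κ * p z) * w z ∂latMeas d h) -
      ∫ z, conj (p z) * (discLap d h w z + b z * w z - conj κ * w z) ∂latMeas d h =
    (∫ z, conj (q z - discLap d h p z) * w z ∂latMeas d h) +
      ∫ z, conj (r z - b z * p z) * w z ∂latMeas d h := by
  have hL := memLp_discLap hp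
  have i1 := integrable_conj_mul (hq.sub hL) hw
  have i2 : Integrable (fun z => conj (r z - b z * p z) * w z) (latMeas d h) := by
    refine ((integrable_conj_mul hr hw).sub (integrable_conj_mul hp hbw)).congr
      (.of_forall fun z => ?_)
    simp only [Pi.sub_apply, map_sub, map_mul, Complex.conj_ofReal]
    ring
  have i3 := integrable_conj_mul hL hw
  have i4 := integrable_conj_mul hp (memLp_discLap hw)
  have i5 := integrable_conj_mul hp (hbw.sub (hw.const_mul (conj κ)))
  have e1 : ∫ z, conj (q z + r z - κ * p z) * w z ∂latMeas d h =
      (∫ z, conj (q z - discLap d h p z) * w z ∂latMeas d h) +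
      (∫ z, conj (r z - b z * p z) * w z ∂latMeas d h) +
      (∫ z, conj (discLap d h p z) * w z ∂latMeas d h) +
      ∫ z, conj (p z) * (b z * w z - conj κ * w z) ∂latMeas d h := by
    have j1 := integral_add i1 i2
    have j2 := integral_add (i1.add i2) i3
    have j3 := integral_add ((i1.add i2).add i3) i5
    simp only [Pi.add_apply, Pi.sub_apply] at j1 j2 j3
    rw [← j1, ← j2, ← j3]
    refine integral_congr_ae (.of_forall fun z => ?_)
    simp only [map_add, map_sub, map_mul, Complex.conj_ofReal]
    ring
  have e2 : ∫ z, conj (p z) * (discLap d h w z + b z * w z - conj κ * w z) ∂latMeas d h =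
      (∫ z, conj (p z) * discLap d h w z ∂latMeas d h) +
      ∫ z, conj (p z) * (b z * w z - conj κ * w z) ∂latMeas d h := by
    have j1 := integral_add i4 i5
    simp only [Pi.sub_apply] at j1
    rw [← j1]
    refine integral_congr_ae (.of_forall fun z => ?_)
    simp only
    ring
  rw [e1, e2, integral_conj_discLap_mul hp hw]
  ring

lemma exists_resolvent_intertwining_error_le {φ : 𝓢(Euc d, ℂ)}
    (hφ : ∀ ξ, ∑' n : Zd d, ‖(𝓕 φ : 𝓢(Euc d, ℂ)) (ξ + latVec d n)‖ ^ 2 = 1) {δ : ℝ}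
    (hδ : ∀ ξ : Euc d, (𝓕 φ : 𝓢(Euc d, ℂ)) ξ ≠ 0 → ∀ j, |ξ j| ≤ 1 - δ)
    (hδ0 : 0 < δ) (hδ2 : δ ≤ 1 / 2) {V : Euc d → ℝ} (hVc : Continuous V) {m c L α : ℝ}
    (hW : ∀ x, 0 < V x + m) (hc : ∀ x y, dist x y ≤ 1 → V y + m ≤ c * (V x + m))
    (hL : 0 ≤ L) (hα0 : 0 < α) (hα1 : α ≤ 1)
    (hWL : ∀ x y, |V x - V y| ≤ L * dist x y ^ α * ((V x + m) * (V y + m)))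
    {μ : ℂ} (hμ : μ.im ≠ 0) :
    ∃ C, 0 ≤ C ∧ ∀ h, 0 < h → h ≤ 1 / 2 → ∀ Ph : L2 d →L[ℂ] l2h d h, IsProjOp d h φ Ph →
      ∀ Hh, IsDiscreteHam d h V Hh → ∀ Rh, IsResolventAt Hh μ Rh →
      ∀ u, ContDiff ℝ (⊤ : ℕ∞) u → HasCompactSupport u → ∀ hu2 : MemLp u 2 volume,
      ∀ hf : MemLp (fun x => -(lapl d u x) + (V x : ℂ) * u x - μ * u x) 2 volume,
        ‖Rh (Ph (hf.toLp _)) - Ph (hu2.toLp u)‖ ≤ C * h ^ α * ‖hf.toLp _‖ := by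
  obtain ⟨A, hA0, hA⟩ := exists_continuum_apriori hVc hW hc hμ
  obtain ⟨B, hB0, hB⟩ := exists_discrete_apriori hVc hW hc (ν := conj μ) (by simpa using hμ)
  obtain ⟨D, hD0, hD⟩ := exists_potential_error_le φ (W := fun x => V x + m)
    (hVc.add continuous_const) hW hL hα0 hα1 (by simpa using hWL)
  set K : ℝ := Real.pi ^ 4 / (4 * δ ^ 2) * (4 * Real.pi ^ 2)⁻¹ with hK
  have hK0 : 0 ≤ K := by positivity
  refine ⟨(K + D) * (A * B), by positivity, fun h hh hh2 Ph hPh Hh hHh Rh hRh u hu huc hu2 hf => ?_⟩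
  have hα : h ^ 2 ≤ h ^ α := by
    rw [← Real.rpow_two]
    exact Real.rpow_le_rpow_of_exponent_ge hh (by linarith) (by linarith)
  have hf0 : 0 ≤ ‖hf.toLp _‖ := norm_nonneg _
  refine norm_le_of_norm_inner_le (by positivity) fun v => ?_
  set w : l2h d h := ContinuousLinearMap.adjoint Rh v with hw
  have hw2 : MemLp w 2 (latMeas d h) := Lp.memLp w
  have hv2 : MemLp v 2 (latMeas d h) := Lp.memLp v
  have hwv := discAct_adjoint_resolvent hh hHh hRh v
  obtain ⟨hVw, hVwle, hLwle⟩ := hB h hh hh2 w v hw2 hv2 hwv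
  obtain ⟨hVu, hLu⟩ := hA u hu huc
  rw [← norm_toLp_eq_lpNorm hf] at hVu hLu
  rw [lpNorm_coeFn] at hVwle hLwle
  have hWu : Continuous fun x => ((V x + m : ℝ) : ℂ) * u x := by
    have := hu.continuous; fun_prop
  have hWuc : HasCompactSupport fun x => ((V x + m : ℝ) : ℂ) * u x := huc.mul_left
  have hWu2 : MemLp (fun x => ((V x + m : ℝ) : ℂ) * u x) 2 volume :=
    hWu.memLp_of_hasCompactSupport hWuc
  have hlu2 : MemLp (fun x => -lapl d u x) 2 volume := (memLp_lapl hu huc).neg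
  have hp := (lpNorm_projFun_sq hφ hδ hδ0 hh hu2 (.refl _ _)).1
  have hq := (lpNorm_projFun_sq hφ hδ hδ0 hh hlu2 (.refl _ _)).1
  have hr := (lpNorm_projFun_sq hφ hδ hδ0 hh hWu2 (.refl _ _)).1
  have hPf : ⇑(Ph (hf.toLp _)) = fun z => projFun φ h (fun x => -lapl d u x) z +
      projFun φ h (fun x => ((V x + m : ℝ) : ℂ) * u x) z - (μ + m) * projFun φ h u z := by
    rw [hPh.coe_eq, projFun_toLp]
    funext z
    rw [← projFun_linear_comb φ h (a := fun x => -lapl d u x) (contDiff_lapl hu).continuous.neg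
      (hasCompactSupport_lapl huc).neg hWu hWuc hu.continuous huc]
    congr 1
    funext x
    push_cast
    ring
  have hPu : ⇑(Ph (hu2.toLp u)) = projFun φ h u := by rw [hPh.coe_eq, projFun_toLp]
  have hv : ⇑v = fun z => discLap d h w z + ((V (latPt d h z) + m : ℝ) : ℂ) * w z -
      conj (μ + m) * w z := by
    funext z
    rw [← hwv z, show discAct d h V w z = discLap d h w z + V (latPt d h z) * w z from rfl]
    simp only [map_add, Complex.conj_ofReal]
    push_cast
    ring
  have key := integral_resolvent_error hp hq hr hw2 hVw (μ + m)
  have hin : ⟪Rh (Ph (hf.toLp _)) - Ph (hu2.toLp u), v⟫_ℂ =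
      ⟪Ph (hf.toLp _), w⟫_ℂ - ⟪Ph (hu2.toLp u), v⟫_ℂ := by
    rw [inner_sub_left, hw, ContinuousLinearMap.adjoint_inner_right]
  rw [hin, inner_Lp_two_eq_integral, inner_Lp_two_eq_integral, hPf, hPu]
  have e1 : ∫ z, conj (projFun φ h u z) * v z ∂latMeas d h =
      ∫ z, conj (projFun φ h u z) * (discLap d h w z + ((V (latPt d h z) + m : ℝ) : ℂ) * w z -
      conj (μ + m) * w z) ∂latMeas d h :=
    integral_congr_ae (.of_forall fun z => by simp only [congrFun hv z])
  rw [e1, key]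
  refine (norm_add_le _ _).trans ?_
  have k1 := norm_integral_kinetic_error_le hδ hδ0 hδ2 hφ hh hu huc hu2 hw2
  have k2 := hD h hh u hu.continuous huc w hVw
  rw [← hK] at k1
  have n1 : lpNorm (lapl d u) 2 volume * lpNorm (discLap d h w) 2 (latMeas d h) ≤
      (A * ‖hf.toLp _‖) * (B * ‖v‖) :=
    mul_le_mul hLu hLwle lpNorm_nonneg (by positivity)
  have n2 : lpNorm (fun x => ((V x + m : ℝ) : ℂ) * u x) 2 volume *
      lpNorm (fun z => ((V (latPt d h z) + m : ℝ) : ℂ) * w z) 2 (latMeas d h) ≤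
      (A * ‖hf.toLp _‖) * (B * ‖v‖) :=
    mul_le_mul hVu hVwle lpNorm_nonneg (by positivity)
  calc _ ≤ h ^ 2 * (K * lpNorm (lapl d u) 2 volume * lpNorm (discLap d h w) 2 (latMeas d h)) +
        D * h ^ α * (lpNorm (fun x => ((V x + m : ℝ) : ℂ) * u x) 2 volume *
          lpNorm (fun z => ((V (latPt d h z) + m : ℝ) : ℂ) * w z) 2 (latMeas d h)) :=
        add_le_add k1 k2
    _ ≤ h ^ α * (K * ((A * ‖hf.toLp _‖) * (B * ‖v‖))) +
        D * h ^ α * ((A * ‖hf.toLp _‖) * (B * ‖v‖)) := by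
        have hα' : 0 ≤ h ^ α := Real.rpow_nonneg hh.le _
        rw [mul_assoc K]
        exact add_le_add (mul_le_mul hα (mul_le_mul_of_nonneg_left n1 hK0)
          (mul_nonneg hK0 (mul_nonneg lpNorm_nonneg lpNorm_nonneg)) hα')
          (mul_le_mul_of_nonneg_left n2 (mul_nonneg hD0 hα'))
    _ = _ := by ring

end Assembly

lemma abs_sub_le_of_inv_holder {X : Type*} [PseudoMetricSpace X] {V : X → ℝ} {M m L α : ℝ}
    (hVM : ∀ x, 0 < V x + M) (hm : M ≤ m) (hL : 0 ≤ L)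
    (hV : ∀ x y, |(V x + M)⁻¹ - (V y + M)⁻¹| ≤ L * dist x y ^ α) (x y : X) :
    |V x - V y| ≤ L * dist x y ^ α * ((V x + m) * (V y + m)) := by
  have hx := hVM x
  have hy := hVM y
  have e : V x - V y = -((V x + M)⁻¹ - (V y + M)⁻¹) * ((V x + M) * (V y + M)) := by
    field_simp
    ring
  rw [e, abs_mul, abs_neg, abs_of_pos (mul_pos hx hy)]
  have : 0 ≤ dist x y ^ α := Real.rpow_nonneg dist_nonneg _
  have hxm : 0 ≤ V x + m := by linarith
  gcongr
  exact hV x y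

lemma IsResolventAt.apply_schrodingerRange {d : ℕ} {V : Euc d → ℝ} (hVc : Continuous V)
    {H : L2 d →ₗ.[ℂ] L2 d} (hH : IsSchrodingerOp d V H) {μ : ℂ} {R : L2 d →L[ℂ] L2 d}
    (hR : IsResolventAt H μ R) {u : Euc d → ℂ} (hu : ContDiff ℝ (⊤ : ℕ∞) u)
    (huc : HasCompactSupport u) (hu2 : MemLp u 2 volume)
    (hf : MemLp (fun x => -(lapl d u x) + (V x : ℂ) * u x - μ * u x) 2 volume) :
    R (hf.toLp _) = hu2.toLp u := by
  have hHu2 : MemLp (fun x => -(lapl d u x) + (V x : ℂ) * u x) 2 (volume : Measure (Euc d)) := by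
    simpa using memLp_neg_lapl_add hVc 0 hu huc
  obtain ⟨hdom, hHu⟩ := hH.2 u hu huc hu2 hHu2
  have hfu : H ⟨hu2.toLp u, hdom⟩ - μ • hu2.toLp u = hf.toLp _ := by
    rw [hHu, ← MemLp.toLp_const_smul, ← MemLp.toLp_sub]
    rfl
  rw [← hfu]
  exact hR.2 ⟨hu2.toLp u, hdom⟩

lemma norm_compression_sub_apply_le {E F : Type*} [NormedAddCommGroup E] [InnerProductSpace ℂ E]
    [CompleteSpace E] [NormedAddCommGroup F] [InnerProductSpace ℂ F] [CompleteSpace F]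
    {P : E →L[ℂ] F} (hP : ‖P‖ ≤ 1) {R : E →L[ℂ] E} {S : F →L[ℂ] F} {f u : E} (hu : R f = u)
    {a b : ℝ} (ha : ‖S (P f) - P u‖ ≤ a) (hb : ‖ContinuousLinearMap.adjoint P (P u) - u‖ ≤ b) :
    ‖((ContinuousLinearMap.adjoint P).comp (S.comp P) - R) f‖ ≤ a + b := by
  have hPadj : ‖ContinuousLinearMap.adjoint P‖ ≤ 1 := by
    rwa [LinearIsometryEquiv.norm_map]
  have h1 : ‖ContinuousLinearMap.adjoint P (S (P f) - P u)‖ ≤ a :=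
    ((ContinuousLinearMap.adjoint P).le_of_opNorm_le hPadj _).trans (by rwa [one_mul])
  have e : ((ContinuousLinearMap.adjoint P).comp (S.comp P) - R) f =
      ContinuousLinearMap.adjoint P (S (P f) - P u) +
        (ContinuousLinearMap.adjoint P (P u) - u) := by
    rw [map_sub, sub_apply, hu]
    simp only [ContinuousLinearMap.comp_apply]
    abel
  rw [e]
  exact (norm_add_le _ _).trans (add_le_add h1 hb)

open scoped SchwartzMap in
lemma exists_norm_compressed_resolvent_sub_le {d : ℕ} {φ : 𝓢(Euc d, ℂ)}
    (hφ : ∀ ξ, ∑' n : Zd d, ‖(𝓕 φ : 𝓢(Euc d, ℂ)) (ξ + latVec d n)‖ ^ 2 = 1) {δ : ℝ}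
    (hδ : ∀ ξ : Euc d, (𝓕 φ : 𝓢(Euc d, ℂ)) ξ ≠ 0 → ∀ j, |ξ j| ≤ 1 - δ)
    (hδ0 : 0 < δ) (hδ2 : δ ≤ 1 / 2) {V : Euc d → ℝ} (hVc : Continuous V) {m c L α : ℝ}
    (hW : ∀ x, 0 < V x + m) (hc : ∀ x y, dist x y ≤ 1 → V y + m ≤ c * (V x + m))
    (hL : 0 ≤ L) (hα0 : 0 < α) (hα1 : α ≤ 1)
    (hWL : ∀ x y, |V x - V y| ≤ L * dist x y ^ α * ((V x + m) * (V y + m)))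
    {H : L2 d →ₗ.[ℂ] L2 d} (hH : IsSchrodingerOp d V H) {μ : ℂ} (hμ : μ.im ≠ 0)
    {R : L2 d →L[ℂ] L2 d} (hR : IsResolventAt H μ R) :
    ∃ C, 0 ≤ C ∧ ∀ h, 0 < h → h ≤ 1 / 2 → ∀ Ph : L2 d →L[ℂ] l2h d h, IsProjOp d h φ Ph →
      ∀ Hh, IsDiscreteHam d h V Hh → ∀ Rh, IsResolventAt Hh μ Rh →
        ‖(ContinuousLinearMap.adjoint Ph).comp (Rh.comp Ph) - R‖ ≤ C * h ^ α := by
  obtain ⟨A, hA0, hA⟩ := exists_continuum_apriori hVc hW hc hμ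
  obtain ⟨C, hC0, hC⟩ := exists_resolvent_intertwining_error_le hφ hδ hδ0 hδ2 hVc hW hc
    hL hα0 hα1 hWL hμ
  set K : ℝ := (2 * Real.pi ^ 2 * δ ^ 2)⁻¹ with hK
  have hK0 : 0 ≤ K := by positivity
  refine ⟨C + K * A, by positivity, fun h hh hh2 Ph hPh Hh hHh Rh hRh => ?_⟩
  have hα : h ^ 2 ≤ h ^ α := by
    rw [← Real.rpow_two]
    exact Real.rpow_le_rpow_of_exponent_ge hh (by linarith) (by linarith)
  refine opNorm_le_of_schrodingerRange hVc (fun x => (hW x).le) hμ (by positivity)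
    fun u hu huc hf => ?_
  have hu2 : MemLp u 2 (volume : Measure (Euc d)) := hu.continuous.memLp_of_hasCompactSupport huc
  have hRf := IsResolventAt.apply_schrodingerRange hVc hH hR hu huc hu2 hf
  have b1 := hC h hh hh2 Ph hPh Hh hHh Rh hRh u hu huc hu2 hf
  have b2 := IsProjOp.norm_adjoint_apply_sub_le hφ hδ hδ0 hh hPh hδ2 hu huc hu2
  have b3 := (hA u hu huc).2
  rw [← norm_toLp_eq_lpNorm hf] at b3
  rw [← hK] at b2
  refine (norm_compression_sub_apply_le (IsProjOp.opNorm_le hφ hδ hδ0 hh hPh) hRf b1 b2).trans ?_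
  have h3 : K * h ^ 2 * lpNorm (lapl d u) 2 volume ≤ K * h ^ α * (A * ‖hf.toLp _‖) :=
    mul_le_mul (mul_le_mul_of_nonneg_left hα hK0) b3 lpNorm_nonneg (by positivity)
  linarith

/-- Theorem 1 of the paper, quantitative form.  Suppose Assumptions (V)
and (φ) hold, and in addition `(V+M)⁻¹` is uniformly Hölder continuous of order
`α ∈ (0,1]` for some `M > 0`.  Then for any `μ ∈ ℂ \ ℝ` and any `0 < β < α` there is
`C_μ > 0` with `‖P_h*(H_h − μ)⁻¹P_h − (H − μ)⁻¹‖_{B(L²(ℝ^d))} ≤ C_μ h^β` as `h → 0`. -/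
theorem norm_resolvent_convergence_rate
    (d : ℕ) (φ : SchwartzMap (Euc d) ℂ)
    -- Assumption (φ)
    (hφ1 : ∀ ξ : Euc d, ∑' n : Zd d, ‖𝓕 ⇑φ (ξ + latVec d n)‖ ^ 2 = 1)
    (hφ2 : tsupport (𝓕 ⇑φ) ⊆ {ξ : Euc d | ∀ j, ξ j ∈ Set.Ioo (-1 : ℝ) 1})
    -- Assumption (V)
    (V : Euc d → ℝ) (hVcont : Continuous V) (hVbdd : BddBelow (Set.range V))
    (M : ℝ) (hM : 0 < M) (hVM : ∀ x, 0 < V x + M)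
    (hVu : UniformContinuous fun x => (V x + M)⁻¹)
    (c₁ : ℝ) (hc₁ : 0 < c₁)
    (hVcomp : ∀ x y : Euc d, dist x y ≤ 1 →
      c₁⁻¹ * (V x + M) ≤ V y + M ∧ V y + M ≤ c₁ * (V x + M))
    -- additional Hölder continuity of `(V+M')⁻¹` of order `α ∈ (0,1]`, for some `M' > 0`
    (α : ℝ) (hα0 : 0 < α) (hα1 : α ≤ 1)
    (M' : ℝ) (hM' : 0 < M') (hVM' : ∀ x, 0 < V x + M')
    (hHolder : ∃ L > (0 : ℝ), ∀ x y : Euc d,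
      |(V x + M')⁻¹ - (V y + M')⁻¹| ≤ L * dist x y ^ α)
    -- the self-adjoint operator `H = −Δ + V` and its resolvent at `μ ∉ ℝ`
    (H : L2 d →ₗ.[ℂ] L2 d) (hH : IsSchrodingerOp d V H)
    (μ : ℂ) (hμ : μ.im ≠ 0)
    (R : L2 d →L[ℂ] L2 d) (hR : IsResolventAt H μ R)
    (β : ℝ) (hβ0 : 0 < β) (hβα : β < α) :
    ∃ C > (0 : ℝ), ∃ h₀ > (0 : ℝ), ∀ h : ℝ, 0 < h → h < h₀ →
      ∀ Ph : L2 d →L[ℂ] l2h d h, IsProjOp d h φ Ph →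
      ∀ Hh : l2h d h →ₗ.[ℂ] l2h d h, IsDiscreteHam d h V Hh →
      ∀ Rh : l2h d h →L[ℂ] l2h d h, IsResolventAt Hh μ Rh →
        ‖(ContinuousLinearMap.adjoint Ph).comp (Rh.comp Ph) - R‖ ≤ C * h ^ β := by

  obtain ⟨δ, hδ0, hδ2, hgap⟩ := exists_support_gap (isClosed_tsupport _) hφ2
  rw [← SchwartzMap.fourier_coe] at hφ1 hgap
  have hδ : ∀ ξ : Euc d, (𝓕 φ) ξ ≠ 0 → ∀ j, |ξ j| ≤ 1 - δ := fun ξ hξ =>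
    hgap ξ (subset_tsupport _ hξ)
  obtain ⟨L, hL0, hL⟩ := hHolder
  set m := max M M'
  have hW : ∀ x, 0 < V x + m := fun x => (hVM x).trans_le (by gcongr; exact le_max_left _ _)
  have hc : ∀ x y, dist x y ≤ 1 → V y + m ≤ max c₁ 1 * (V x + m) := fun x y hxy => by
    have h1 := (hVcomp x y hxy).2
    have h2 : c₁ * (V x + M) ≤ max c₁ 1 * (V x + M) :=
      mul_le_mul_of_nonneg_right (le_max_left _ _) (hVM x).le
    have h3 : 1 * (m - M) ≤ max c₁ 1 * (m - M) :=
      mul_le_mul_of_nonneg_right (le_max_right _ _) (sub_nonneg.2 (le_max_left _ _))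
    linarith
  obtain ⟨C, hC0, hC⟩ := exists_norm_compressed_resolvent_sub_le hφ1 hδ hδ0 hδ2 hVcont hW hc
    hL0.le hα0 hα1 (abs_sub_le_of_inv_holder hVM' (le_max_right M M') hL0.le hL) hH hμ hR
  refine ⟨C + 1, by positivity, 1 / 2, by norm_num, fun h hh hh2 Ph hPh Hh hHh Rh hRh => ?_⟩
  refine (hC h hh hh2.le Ph hPh Hh hHh Rh hRh).trans ?_
  exact mul_le_mul (by linarith)
    (Real.rpow_le_rpow_of_exponent_ge hh (by linarith) hβα.le) (Real.rpow_nonneg hh.le _)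
    (by positivity)
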